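/- There is no (r)-bipancyclic graph with r ≥ 3 on v vertices having at most v + 5 edges. That is, for every r ≥ 3 and every even v, no finite simple bipartite graph on v vertices with at most v + 5 edges contains precisely r cycles of each even length from 4 to v. -/

import Mathlib

open SimpleGraph

/-- The number of cycles of length `k` in `G`, counted as subgraphs of `G`
isomorphic to the cycle graph `C_k`. -/
noncomputable def cycleCount {V : Type*} (G : SimpleGraph V) (k : ℕ) : ℕ :=
  {H : G.Subgraph | Nonempty (H.coe ≃g cycleGraph k)}.ncard

/-- A bipartite graph on an even number `v ≥ 4` of vertices is `(r)`-bipancyclic if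
it contains precisely `r` cycles of each even length from `4` to `v`. -/
def IsRBipancyclic {V : Type*} [Fintype V] (G : SimpleGraph V) (r : ℕ) : Prop :=
  G.Colorable 2 ∧ Even (Fintype.card V) ∧ 4 ≤ Fintype.card V ∧
    ∀ k : ℕ, 4 ≤ k → k ≤ Fintype.card V → Even k → cycleCount G k = r

namespace BP
notation "BR" => @Bool.rec (fun _ => Bool)
notation "BN" => @Bool.rec (fun _ => Nat)

inductive AL where
  | nil : AL
  | cons (lo w x : Nat) (t : AL) : AL
inductive ZL where
  | nil : ZL
  | cons (zok : Bool) (lo w x vr suf : Nat) (t : ZL) : ZL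
inductive EL where
  | nil : EL
  | cons (i m lab R J w x vr suf : Nat) (t : EL) : EL
inductive CL where
  | nil : CL
  | cons (tv C E : Nat) (t : CL) : CL
inductive RL where
  | nil : RL
  | cons (R J : Nat) (t : RL) : RL

noncomputable section

/-- search for the value of `r` -/
def rloop (HAB HA HB E : Nat) (K : Bool) (fuel : Nat) : Nat → Bool :=
  @Nat.rec (fun _ => Nat → Bool) (fun _ => false)
   (fun _ ih T => BR (BR true (ih (Nat.add T E)) (Nat.beq (Nat.land T HA) 0)) K (Nat.beq (Nat.land T HAB) HB)) fuel

def pickC (v : Nat) (K : Nat → Nat → Bool) (F : Bool) (cs : CL) : Bool :=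
  @CL.rec (fun _ => Bool) F (fun tv C E _ ih => BR ih (K C E) (Nat.ble tv v)) cs

structure Cst where
  HI : Nat
  OFF : Nat
  M : Nat
  HAB : Nat
  HA : Nat
  HB : Nat
  cs : CL
  N0 : Nat
  N2 : Nat
  rows : RL
  ones : Nat
  allp : Nat
  fulln : Nat
  half : Nat
  hi230 : Nat
  spread : Nat
  zoff : Nat
  v0 : Nat
  ml : Nat
  md : Nat
  xl : Nat
  xd : Nat
  X0 : Nat
  R0 : Nat
  J0 : Nat
  nn : Nat
  c : Nat

def flags (k : Cst) (X : Nat) : Nat := Nat.shiftRight (Nat.land (Nat.add X k.OFF) k.HI) 10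
/-- `true` if pruned, otherwise continue with `K` -/
def check (k : Cst) (v X : Nat) (K : Nat → Bool) : Bool :=
  pickC v (fun C E => (fun Z => rloop k.HAB k.HA k.HB E (K Z) 70 (Nat.add (Nat.mod Z k.M) C)) (flags k X)) (K (flags k X)) k.cs

def rapp (a : AL) : AL → AL :=
  @AL.rec (fun _ => AL → AL) (fun b => b) (fun lo w x _ ih b => ih (AL.cons lo w x b)) a

def pick (m : Nat) (K : Nat → Nat → Nat → AL → Bool) (F : Bool) (l : AL) : AL → Bool :=
  @AL.rec (fun _ => AL → Bool) (fun _ => F)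
   (fun lo w x t ih acc => BR (K lo w x (rapp acc t)) (ih (AL.cons lo w x acc)) (Nat.beq (Nat.land m w) 0)) l

/-- smallest `h' ≥ h` of the same parity with `h' ≥ a` -/
def bumped (h a : Nat) (K : Nat → Nat → Bool) : Bool :=
  BR (K (Nat.sub (Nat.add a (Nat.mod (Nat.sub a h) 2)) h) (Nat.add a (Nat.mod (Nat.sub a h) 2))) (K 0 h) (Nat.ble a h)

abbrev SF := AL → Nat → Bool → Nat → Nat → Bool

def hdStep (hw hx : Nat) (ih : SF) (h v X : Nat) : Bool :=
  BR false (ih AL.nil (Nat.add h 2) false (Nat.add v 2) (Nat.add X (Nat.mul 2 hw))) (ih AL.nil h true v (Nat.sub X hx))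
def act (hw : Nat) (ih : SF) (h : Nat) (hex : Bool) (v X lo w x : Nat) (t : AL) : Bool :=
  BR false (bumped h (Nat.add lo 2) fun dh h' => ih (AL.cons (Nat.add lo 2) w x t) h' hex (Nat.add v (Nat.add 2 dh)) (Nat.add X (Nat.add (Nat.mul 2 w) (Nat.mul dh hw))))
   (ih t h hex v (Nat.sub X x))
def ch3 (P : AL) (K : Nat → Nat → Nat → AL → Bool) (F : Bool) : Bool := @AL.rec (fun _ => Bool) F (fun lo w x t _ => K lo w x t) P
def ch2 (k : Cst) (Z : Nat) (P : AL) (K : Nat → Nat → Nat → AL → Bool) (F : Bool) : Bool :=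
  pick (Nat.xor (Nat.land Z k.N2) k.N2) K (ch3 P K F) P AL.nil
def ch1 (k : Cst) (Z : Nat) (P : AL) (K : Nat → Nat → Nat → AL → Bool) (F : Bool) : Bool :=
  pick (Nat.xor (Nat.land Z k.N0) k.N0) K (ch2 k Z P K F) P AL.nil

def search (k : Cst) (hw hx : Nat) (fuel : Nat) : SF :=
  @Nat.rec (fun _ => SF) (fun _ _ _ _ _ => false)
   (fun _ ih P h hex v X =>
     BR false (check k v X fun Z => ch1 k Z P (act hw ih h hex v X) (BR (hdStep hw hx ih h v X) false hex)) (Nat.ble v 200)) fuel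

def dead (k : Cst) (V : Nat) : Nat :=
  Nat.mul k.spread (Nat.add 1 (Nat.shiftRight (Nat.land (Nat.add (Nat.xor k.allp V) k.half) k.hi230) 230))

abbrev ZF := Nat → AL → Nat → Nat → Nat → Bool
def zbr (hw : Nat) (ih : ZF) (w x vr : Nat) (V : Nat) (P : AL) (h v X : Nat) : Bool :=
  BR false (bumped h 2 fun dh h' => ih (Nat.lor V vr) (AL.cons 2 w x P) h' (Nat.add v (Nat.add 2 dh)) (Nat.add X (Nat.add (Nat.mul 2 w) (Nat.mul dh hw))))
    (ih V P h v (Nat.sub X x))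
def zs (k : Cst) (hw hx : Nat) (todo : ZL) : ZF :=
  @ZL.rec (fun _ => ZF) (fun V P h v X => search k hw hx 40 P h false v (Nat.add X (dead k V)))
   (fun zok lo w x vr suf _ ih V P h v X => BR
      (ih (Nat.lor V vr) (AL.cons lo w x P) h v X)
      (check k v (Nat.add (Nat.add X k.zoff) (dead k (Nat.lor V suf))) fun _ => zbr hw ih w x vr V P h v X)
      zok) todo

def sumZ (t : ZL) : Nat → Nat → Nat → (Nat → Nat → Nat → Bool) → Bool :=
  @ZL.rec (fun _ => Nat → Nat → Nat → (Nat → Nat → Nat → Bool) → Bool) (fun m v X K => K m v X)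
   (fun _ lo w x _ _ _ ih m v X K => ih (BN m lo (Nat.ble m lo)) (Nat.add v lo) (Nat.add X (Nat.add (Nat.mul lo w) x)) K) t

/-- colour of an entry -/
def colr (y i m lab : Nat) : Nat := Nat.land (Nat.add (Nat.shiftRight y lab) (BN 0 1 (Nat.ble m i))) 1

def arcs (y : Nat) (l : EL) : Nat → Nat → Nat → (ZL → Bool) → Bool :=
  @EL.rec (fun _ => Nat → Nat → Nat → (ZL → Bool) → Bool) (fun _ _ _ K => K ZL.nil)
   (fun i m lab _ _ w x vr suf _ ih nc nm ni K => ih (colr y i m lab) m i fun t =>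
     BR
      (BR (K (ZL.cons true 0 w x vr suf t)) (K (ZL.cons false 2 w x vr suf t)) (Nat.ble m nm))
      (K (ZL.cons false (BN 1 3 (Nat.beq m ni)) w x vr suf t))
      (Nat.beq (Nat.land (Nat.add (colr y i m lab) nc) 1) 1)) l

def colored (k : Cst) (l : EL) (y : Nat) : Bool :=
  arcs y l 0 k.nn 0 fun t => @ZL.rec (fun _ => Bool) false
    (fun _ lo w x vr _ t _ => sumZ t 0 lo (Nat.add k.X0 (Nat.add (Nat.mul lo w) x)) fun m v X =>
      bumped lo m fun dh h' => zs k w x t (Nat.lor k.v0 vr) AL.nil h' (Nat.add v dh) (Nat.add X (Nat.mul dh w))) t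

def allCol (k : Cst) (l : EL) (n : Nat) : Bool :=
  @Nat.rec (fun _ => Bool) true (fun i ih => BR false ih (colored k l (Nat.mul 2 i))) n

def findM (j : Nat) (K : Nat → Nat → Bool) (F : Bool) (l : EL) : Bool :=
  @EL.rec (fun _ => Bool) F (fun i m lab _ _ _ _ _ _ _ ih => BR ih (K i lab) (Nat.beq m j)) l
def freeM (j : Nat) (l : EL) : Bool :=
  @EL.rec (fun _ => Bool) true (fun _ m _ _ _ _ _ _ _ _ ih => BR ih false (Nat.beq m j)) l
def nOpen (l : EL) : Nat :=
  @EL.rec (fun _ => Nat) 0 (fun i m _ _ _ _ _ _ _ _ ih => BN (Nat.succ ih) ih (Nat.ble m i)) l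
def getRow (l : RL) : Nat → (Nat → Nat → Bool) → Bool :=
  @RL.rec (fun _ => Nat → (Nat → Nat → Bool) → Bool) (fun _ _ => false)
    (fun R J _ ih i K => @Nat.rec (fun _ => Bool) (K R J) (fun i _ => ih i K) i) l

def vrw (k : Cst) (R J : Nat) : Nat := Nat.land (Nat.mul R k.ones) (Nat.xor k.allp (Nat.mul J k.fulln))
def mkEn3 (k : Cst) (i m lab R J J' vr u : Nat) (pre : EL) (K : EL → Bool) : Bool :=
  K (EL.cons i m lab R J (Nat.add (Nat.mul J k.ml) (Nat.mul J' k.md)) (Nat.add (Nat.mul J k.xl) (Nat.mul J' k.xd)) vr (Nat.lor u vr) pre)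
def mkEn2 (k : Cst) (i m lab : Nat) (pre : EL) (K : EL → Bool) (R J u : Nat) : Bool :=
  getRow k.rows lab fun r j => mkEn3 k i m lab (Nat.xor R r) (Nat.xor J j) (Nat.xor (Nat.xor J j) k.ones) (vrw k (Nat.xor R r) (Nat.xor J j)) u pre K
def mkEn (k : Cst) (i m lab : Nat) (pre : EL) (K : EL → Bool) : Bool :=
  @EL.rec (fun _ => Bool) (mkEn2 k i m lab pre K k.R0 k.J0 0) (fun _ _ _ R J _ _ _ suf _ _ => mkEn2 k i m lab pre K R J suf) pre

def openers (j : Nat) (pre : EL) (K : Nat → Bool) (m : Nat) : Bool :=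
  @Nat.rec (fun _ => Bool) true (fun m ih => BR (BR ih (BR false ih (K m)) (freeM m pre)) true (Nat.ble m j)) m

def gen (k : Cst) (n : Nat) : Nat → EL → Bool :=
  @Nat.rec (fun _ => Nat → EL → Bool) (fun _ pre => allCol k pre (Nat.pow 2 (Nat.pred k.c)))
   (fun _ ih j pre => findM j (fun i lab => mkEn k j i lab pre (ih (Nat.succ j)))
      (openers j pre (fun m => mkEn k j m (nOpen pre) pre (ih (Nat.succ j))) k.nn) pre) n

/-- packing -/
def pk (b : Nat) (a : Nat → Nat) (n : Nat) : Nat :=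
  @Nat.rec (fun _ => Nat) 0 (fun i ih => Nat.add ih (Nat.mul (a i) (Nat.pow 2 (Nat.mul b i)))) n
def bit (f i : Nat) : Nat := Nat.land (Nat.shiftRight f i) 1
def mkRows (n c : Nat) : Nat → RL :=
  @Nat.rec (fun _ => Nat → RL) (fun _ => RL.nil) (fun _ ih i => RL.cons (pk 1 (fun f => bit f (Nat.succ i)) n) (pk 231 (fun f => bit f (Nat.succ i)) n) (ih (Nat.succ i))) c
/-- number of chords of a codeword -/
def popc (f c : Nat) : Nat := @Nat.rec (fun _ => Nat) 0 (fun i ih => Nat.add ih (bit f (Nat.succ i))) c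
def v0bit (f g : Nat) : Nat :=
  BN (BN (BN 1 0 (Nat.beq (Nat.land (Nat.shiftRight g 1) (Nat.shiftRight f 1)) (Nat.shiftRight g 1))) 1 (Nat.beq g f)) 1 (Nat.beq g 0)

/-- thresholds for the 21 sublanes -/
def thr (s : Nat) : Nat :=
  if s < 5 then 2*s+4 else if s < 10 then 2*(s-5)+8 else if s < 15 then 2*(s-10)+4 else if s < 20 then 2*(s-15)+8 else 2
def isL (s : Nat) : Nat := if s < 5 then 1 else if s < 10 then 0 else if s < 15 then 1 else if s < 20 then 0 else 1
def laneC (n a s : Nat) : Nat :=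
  if s < 10 then (if s % 5 < a then 3*(s % 5 + 1) + (1023 - n) else 0)
      else if s < 20 then (if s % 5 < a then 3*(s % 5+1) + (1024 - n) else 1024) else 1024 - n
def laneE (a s : Nat) : Nat := if s < 20 then (if s % 5 < a then s % 5 + 1 else 0) else 0
def mkCE (n a : Nat) (t : CL) : CL := CL.cons (2*a+2) (pk 11 (laneC n a) 21) (pk 11 (laneE a) 21) t
def mkCst (c : Nat) : Cst :=
  (fun n =>
  { HI := pk 231 (fun _ => pk 11 (fun _ => 1024) 21) n
    OFF := pk 231 (fun _ => pk 11 (fun s => 1023 - thr s) 21) n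
    M := Nat.sub (Nat.pow 2 231) 1
    HAB := pk 11 (fun _ => 1024) 21
    HA := pk 11 (fun s => if s < 10 then 1024 else 0) 21
    HB := pk 11 (fun s => if s < 10 then 0 else 1024) 21
    cs := mkCE n 5 (mkCE n 4 (mkCE n 3 (mkCE n 2 (mkCE n 1 CL.nil))))
    N0 := pk 231 (fun _ => Nat.pow 2 55) n
    N2 := pk 231 (fun _ => Nat.pow 2 66) n
    rows := mkRows n c 0
    ones := pk 231 (fun _ => 1) n
    allp := pk 231 (fun _ => pk 1 (fun _ => 1) n) n
    fulln := pk 1 (fun _ => 1) n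
    half := pk 231 (fun _ => Nat.sub (Nat.pow 2 230) 1) n
    hi230 := pk 231 (fun _ => Nat.pow 2 230) n
    spread := pk 11 (fun _ => 32) 21
    zoff := pk 231 (fun _ => pk 11 (fun s => if s < 10 then 0 else 32) 21) n
    v0 := pk 231 (fun f => pk 1 (fun g => v0bit f g) n) n
    ml := pk 11 isL 21
    md := pk 11 (fun s => 1 - isL s) 21
    xl := pk 11 (fun s => if s < 10 then 0 else 32 * isL s) 21
    xd := pk 11 (fun s => if s < 10 then 0 else 32 * (1 - isL s)) 21
    X0 := pk 231 (fun f => pk 11 (fun s => if isL s = 1 then popc f c else 8 - popc f c) 21) n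
    R0 := pk 1 (fun f => bit f 0) n
    J0 := pk 231 (fun f => bit f 0) n
    nn := Nat.mul 2 c
    c := c }) (Nat.pow 2 (Nat.succ c))
def chunk (c m : Nat) : Bool := mkEn (mkCst c) 0 m 0 EL.nil (gen (mkCst c) (Nat.pred (Nat.mul 2 c)) 1)
end
end BP

namespace BP
theorem pk_zero (b a) : pk b a 0 = 0 := rfl
theorem pk_succ (b a n) : pk b a (n+1) = pk b a n + a n * 2^(b*n) := rfl
theorem pk_add (b x y n) : pk b x n + pk b y n = pk b (fun i => x i + y i) n := by
  induction n with
  | zero => rfl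
  | succ n ih => rw [pk_succ, pk_succ, pk_succ, ← ih]; ring
theorem pk_mul (b x n K) : pk b x n * K = pk b (fun i => x i * K) n := by
  induction n with
  | zero => simp [pk_zero]
  | succ n ih => rw [pk_succ, pk_succ, ← ih]; ring
theorem pk_mul' (b x n K) : K * pk b x n = pk b (fun i => K * x i) n := by
  rw [mul_comm, pk_mul]; simp only [mul_comm]
theorem pk_congr {b x y n} (h : ∀ i < n, x i = y i) : pk b x n = pk b y n := by
  induction n with
  | zero => rfl
  | succ n ih => rw [pk_succ, pk_succ, ih (fun i hi => h i (by omega)), h n (by omega)]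
theorem pk_sub {b x y n} (h : ∀ i < n, y i ≤ x i) : pk b x n - pk b y n = pk b (fun i => x i - y i) n := by
  have : pk b x n = pk b (fun i => x i - y i) n + pk b y n := by
    rw [pk_add]; exact pk_congr fun i hi => by have := h i hi; omega
  omega
theorem pk_lt {b x n} (h : ∀ i < n, x i < 2^b) : pk b x n < 2^(b*n) := by
  induction n with
  | zero => simp [pk_zero]
  | succ n ih =>
    rw [pk_succ]
    have h1 := ih fun i hi => h i (by omega)
    have h2 : x n + 1 ≤ 2^b := h n (by omega)
    have h3 : 2^(b*(n+1)) = 2^b * 2^(b*n) := by rw [← pow_add]; congr 1; ring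
    have := Nat.mul_le_mul_right (2^(b*n)) h2
    rw [h3]; nlinarith
theorem pk_testBit {b x n} (hb : 0 < b) (h : ∀ i < n, x i < 2^b) (k : ℕ) :
    (pk b x n).testBit k = (decide (k / b < n) && (x (k/b)).testBit (k % b)) := by
  induction n with
  | zero => simp [pk_zero]
  | succ n ih =>
    have h1 := pk_lt (b := b) (x := x) (n := n) fun i hi => h i (by omega)
    rw [pk_succ, add_comm, mul_comm, Nat.testBit_two_pow_mul_add _ h1, ih fun i hi => h i (by omega)]
    have hd : k / b < n ↔ k < b * n := by rw [Nat.div_lt_iff_lt_mul hb, mul_comm]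
    split_ifs with hk
    · have : k / b < n := hd.2 hk
      simp [this, Nat.lt_succ_of_lt this]
    · have hk' : ¬ k / b < n := fun h => hk (hd.1 h)
      by_cases hkn : k / b = n
      · have : k % b = k - b * n := by rw [← hkn, Nat.mod_def]
        simp [hkn, this]
      · have h4 : ¬ k / b < n + 1 := by omega
        have h5 : x n < 2 ^ (k - b*n) := by
          refine lt_of_lt_of_le (h n (by omega)) (Nat.pow_le_pow_right (by norm_num) ?_)
          have : (n+1) * b ≤ k := (Nat.le_div_iff_mul_le hb).1 (by omega)
          have : (n+1)*b = b * n + b := by ring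
          omega
        rw [Nat.testBit_lt_two_pow h5]; simp [h4]
theorem pk_land {b x y n} (hb : 0 < b) (hx : ∀ i < n, x i < 2^b) (hy : ∀ i < n, y i < 2^b) :
    pk b x n &&& pk b y n = pk b (fun i => x i &&& y i) n := by
  apply Nat.eq_of_testBit_eq; intro k
  rw [Nat.testBit_and, pk_testBit hb hx, pk_testBit hb hy,
    pk_testBit hb (fun i hi => lt_of_le_of_lt Nat.and_le_left (hx i hi)), Nat.testBit_and]
  cases decide (k / b < n) <;> simp
theorem pk_lor {b x y n} (hb : 0 < b) (hx : ∀ i < n, x i < 2^b) (hy : ∀ i < n, y i < 2^b) :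
    pk b x n ||| pk b y n = pk b (fun i => x i ||| y i) n := by
  apply Nat.eq_of_testBit_eq; intro k
  rw [Nat.testBit_or, pk_testBit hb hx, pk_testBit hb hy,
    pk_testBit hb (fun i hi => Nat.or_lt_two_pow (hx i hi) (hy i hi)), Nat.testBit_or]
  cases decide (k / b < n) <;> simp
theorem pk_xor {b x y n} (hb : 0 < b) (hx : ∀ i < n, x i < 2^b) (hy : ∀ i < n, y i < 2^b) :
    pk b x n ^^^ pk b y n = pk b (fun i => x i ^^^ y i) n := by
  apply Nat.eq_of_testBit_eq; intro k
  rw [Nat.testBit_xor, pk_testBit hb hx, pk_testBit hb hy,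
    pk_testBit hb (fun i hi => Nat.xor_lt_two_pow (hx i hi) (hy i hi)), Nat.testBit_xor]
  cases decide (k / b < n) <;> simp
theorem pk_inj {b x y n} (hx : ∀ i < n, x i < 2^b) (hy : ∀ i < n, y i < 2^b) 
    (h : pk b x n = pk b y n) : ∀ i < n, x i = y i := by
  induction n with
  | zero => simp
  | succ n ih =>
    rw [pk_succ, pk_succ] at h
    have h1 := pk_lt (b := b) (x := x) (n := n) fun i hi => hx i (by omega)
    have h2 := pk_lt (b := b) (x := y) (n := n) fun i hi => hy i (by omega)
    have e1 : pk b x n = pk b y n := by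
      have := congrArg (· % 2^(b*n)) h
      simpa [Nat.mod_eq_of_lt h1, Nat.mod_eq_of_lt h2] using this
    have e2 : x n = y n := by
      rw [e1] at h
      exact Nat.eq_of_mul_eq_mul_right (by positivity) (Nat.add_left_cancel h)
    intro i hi
    rcases Nat.lt_succ_iff_lt_or_eq.1 hi with h' | rfl
    · exact ih (fun i hi => hx i (by omega)) (fun i hi => hy i (by omega)) e1 i h'
    · exact e2
theorem pk_mod (b x n) : pk b x n ≡ ∑ i ∈ Finset.range n, x i [MOD 2^b - 1] := by
  induction n with
  | zero => rfl
  | succ n ih =>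
    rw [pk_succ, Finset.sum_range_succ]
    refine ih.add ?_
    have h1 : 2^b ≡ 1 [MOD 2^b - 1] := by
      have h0 : 0 < 2^b := by positivity
      refine (Nat.modEq_iff_dvd' (Nat.one_le_two_pow)).2 dvd_rfl |>.symm
    have h2 := (h1.pow n).mul_left (x n)
    rwa [one_pow, mul_one, ← pow_mul] at h2
theorem pk_sum (b n) {ι} (S : Finset ι) (x : ι → ℕ → ℕ) : ∑ j ∈ S, pk b (x j) n = pk b (fun i => ∑ j ∈ S, x j i) n := by
  induction n with
  | zero => simp [pk_zero]
  | succ n ih => simp only [pk_succ, Finset.sum_add_distrib, ih, Finset.sum_mul]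

/-- two level packing -/
def P2 (n : ℕ) (x : ℕ → ℕ → ℕ) : ℕ := pk 231 (fun f => pk 11 (x f) 21) n
theorem P2_add (n x y) : P2 n x + P2 n y = P2 n (fun f s => x f s + y f s) := by
  simp only [P2, pk_add]
theorem P2_mul (n x K) : K * P2 n x = P2 n (fun f s => K * x f s) := by
  simp only [P2, pk_mul']
theorem P2_congr {n x y} (h : ∀ f < n, ∀ s < 21, x f s = y f s) : P2 n x = P2 n y :=
  pk_congr fun f hf => pk_congr fun s hs => h f hf s hs
theorem P2_sub {n x y} (h : ∀ f < n, ∀ s < 21, y f s ≤ x f s) : P2 n x - P2 n y = P2 n (fun f s => x f s - y f s) := by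
  have : P2 n x = P2 n (fun f s => x f s - y f s) + P2 n y := by
    rw [P2_add]; exact P2_congr fun f hf s hs => by have := h f hf s hs; omega
  omega
theorem pk11_lt {x : ℕ → ℕ} (h : ∀ s < 21, x s < 2048) : pk 11 x 21 < 2^231 := pk_lt (b := 11) (n := 21) h
theorem P2_land {n x y} (hx : ∀ f < n, ∀ s < 21, x f s < 2048) (hy : ∀ f < n, ∀ s < 21, y f s < 2048) :
    P2 n x &&& P2 n y = P2 n (fun f s => x f s &&& y f s) := by
  unfold P2
  rw [pk_land (by norm_num) (fun f hf => pk11_lt (hx f hf)) (fun f hf => pk11_lt (hy f hf))]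
  exact pk_congr fun f hf => pk_land (by norm_num) (hx f hf) (hy f hf)
theorem and1024 {y : ℕ} (h : y < 2048) : y &&& 1024 = if 1024 ≤ y then 1024 else 0 := by
  have h2 := Nat.and_two_pow y 10
  norm_num at h2
  rw [h2]
  have : y.testBit 10 = decide (1024 ≤ y) := by
    rw [Nat.testBit_eq_decide_div_mod_eq]; congr 1; norm_num; omega
  rw [this]; split_ifs <;> simp [*]
end BP

namespace BP
theorem thr_bd (s) (h : s < 21) : thr s ≤ 16 := by unfold thr; split_ifs <;> omega

theorem flags_eq (c : ℕ) (x : ℕ → ℕ → ℕ) (hx : ∀ f < 2^(c+1), ∀ s < 21, x f s ≤ 1000) :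
    flags (mkCst c) (P2 (2^(c+1)) x) = P2 (2^(c+1)) (fun f s => if x f s ≤ thr s then 0 else 1) := by
  have h1 : flags (mkCst c) (P2 (2^(c+1)) x) = ((P2 (2^(c+1)) x + P2 (2^(c+1)) (fun _ s => 1023 - thr s)) &&& P2 (2^(c+1)) (fun _ _ => 1024)) >>> 10 := rfl
  rw [h1, P2_add, P2_land, Nat.shiftRight_eq_div_pow]
  · have : P2 (2^(c+1)) (fun f s => (x f s + (1023 - thr s)) &&& 1024) = 2^10 * P2 (2^(c+1)) (fun f s => if x f s ≤ thr s then 0 else 1) := by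
      rw [P2_mul]
      refine P2_congr fun f hf s hs => ?_
      have := hx f hf s hs
      have := thr_bd s hs
      rw [and1024 (by omega)]
      split_ifs <;> omega
    rw [this]; simp
  · intro f hf s hs
    have := hx f hf s hs
    omega
  · intros; norm_num

theorem Zmod {n : ℕ} (hn : n ≤ 64) (z : ℕ → ℕ → ℕ) (hz : ∀ f s, z f s ≤ 1) :
    P2 n z % (2^231 - 1) = pk 11 (fun s => ∑ f ∈ Finset.range n, z f s) 21 := by
  have h1 : P2 n z ≡ _ [MOD 2^231 - 1] := pk_mod 231 _ n
  rw [pk_sum] at h1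
  have hs : ∀ s, ∑ f ∈ Finset.range n, z f s ≤ 64 := fun s =>
    (Finset.sum_le_card_nsmul _ _ 1 (fun f _ => hz f s)).trans (by simpa using hn)
  have h2 : pk 11 (fun s => ∑ f ∈ Finset.range n, z f s) 21 + pk 11 (fun _ => 1) 21 < 2^231 := by
    rw [pk_add]; exact pk11_lt fun s _ => by have := hs s; omega
  have h3 : 1 ≤ pk 11 (fun _ => 1) 21 := by
    decide +kernel
  have h4 : pk 11 (fun s => ∑ f ∈ Finset.range n, z f s) 21 < 2^231 - 1 := by omega
  rw [h1, Nat.mod_eq_of_lt h4]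

def HABc : ℕ := pk 11 (fun _ => 1024) 21
def HAc : ℕ := pk 11 (fun s => if s < 10 then 1024 else 0) 21
def HBc : ℕ := pk 11 (fun s => if s < 10 then 0 else 1024) 21

theorem landHAB {t : ℕ → ℕ} (ht : ∀ s < 21, t s < 2048) (h : ∀ s < 21, (s < 10 → t s < 1024) ∧ (10 ≤ s → 1024 ≤ t s)) :
    pk 11 t 21 &&& HABc = HBc := by
  unfold HABc HBc
  rw [pk_land (by norm_num) ht (by intros; norm_num)]
  refine pk_congr fun s hs => ?_
  have := ht s hs
  have := h s hs
  rw [and1024 (by assumption)]; split_ifs <;> omega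
theorem landHA {t : ℕ → ℕ} (ht : ∀ s < 21, t s < 2048) (h : ∀ s < 10, t s < 1024) :
    pk 11 t 21 &&& HAc = 0 := by
  unfold HAc
  rw [pk_land (by norm_num) ht (by intros; split_ifs <;> norm_num)]
  have e0 : pk 11 (fun _ => 0) 21 = 0 := by decide +kernel
  refine Eq.trans (pk_congr fun s hs => ?_) e0
  have := ht s hs
  have := h s 
  by_cases h : s < 10
  · simp only [h, if_true]; rw [and1024 (by assumption)]; split_ifs <;> omega
  · simp [h]

theorem rloop_succ (HAB HA HB E : ℕ) (K : Bool) (fuel T : ℕ) : rloop HAB HA HB E K (fuel+1) T =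
    BR (BR true (rloop HAB HA HB E K fuel (T + E)) (Nat.beq (T &&& HA) 0)) K (Nat.beq (T &&& HAB) HB) := rfl

theorem rloop_sound {n a r : ℕ} (hn : n ≤ 64) (hr64 : r ≤ 64) (g : ℕ → ℕ) (hg : ∀ s < 21, g s ≤ n)
    (H1 : ∀ s < 10, s % 5 < a → (s % 5 + 1) * r + g s ≤ n)
    (H2 : ∀ s < 20, 10 ≤ s → s % 5 < a → n ≤ (s % 5 + 1) * r + g s)
    (H3 : n ≤ g 20) (K : Bool) (fuel : ℕ) : ∀ q, q + 3 ≤ r → r < q + 3 + fuel →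
    rloop HABc HAc HBc (pk 11 (laneE a) 21) K fuel (pk 11 (fun s => g s + laneC n a s + q * laneE a s) 21) = true → K = true := by
  induction fuel with
  | zero => intro q h1 h2; omega
  | succ fuel ih =>
    intro q hq1 hq2 h
    rw [rloop_succ] at h
    have key : ∀ s < 21, s % 5 + 1 ≤ 5 := fun s _ => by omega
    have hA : ∀ s < 10, g s + laneC n a s + q * laneE a s < 1024 := by
      intro s hs
      have h1 := H1 s hs
      have h2 := hg s (by omega)
      unfold laneC laneE
      simp only [hs, if_true, show s < 20 by omega]
      split_ifs with h5
      · have h1 := h1 h5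
        have : (s % 5 + 1) * (q + 3) ≤ (s%5+1) * r := Nat.mul_le_mul_left _ hq1
        have e : q * (s % 5 + 1) + 3 * (s % 5 + 1) = (s%5+1)*(q+3) := by ring
        omega
      · omega
    have ht : ∀ s < 21, g s + laneC n a s + q * laneE a s < 2048 := by
      intro s hs
      by_cases h10 : s < 10
      · have := hA s h10; omega
      · have h2 := hg s (by omega)
        have h3 : q * laneE a s ≤ 61 * 5 := Nat.mul_le_mul (by omega) (by unfold laneE; split_ifs <;> omega)
        unfold laneC
        split_ifs <;> omega
    rw [landHA ht hA] at h
    rcases Nat.lt_or_ge (q + 3) r with hlt | hge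
    · cases hb : (Nat.beq (pk 11 (fun s => g s + laneC n a s + q * laneE a s) 21 &&& HABc) HBc) with
      | true => rw [hb] at h; exact h
      | false =>
        rw [hb] at h
        have h : rloop HABc HAc HBc (pk 11 (laneE a) 21) K fuel (pk 11 (fun s => g s + laneC n a s + q * laneE a s) 21 + pk 11 (laneE a) 21) = true := h
        rw [pk_add] at h
        refine ih (q+1) (by omega) (by omega) ?_
        rw [← h]; congr 1
        exact pk_congr fun s _ => by ring
    · rw [landHAB ht] at h
      · simpa using h
      · intro s hs
        refine ⟨fun h => hA s h, fun h10 => ?_⟩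
        have hq : q + 3 = r := by omega
        have h2 := hg s (by omega)
        unfold laneC laneE
        simp only [show ¬ s < 10 by omega, if_false]
        by_cases h20 : s < 20
        · simp only [h20, if_true]
          split_ifs with h5
          · have := H2 s h20 h10 h5
            have e : q * (s % 5 + 1) + 3 * (s % 5 + 1) = (s%5+1)*r := by rw [← hq]; ring
            omega
          · omega
        · simp only [h20, if_false]
          have : s = 20 := by omega
          subst this; omega

/-- abstract condition on a lane bound under which `check` is sound -/
structure Good (c r v : ℕ) (x : ℕ → ℕ → ℕ) : Prop where
  bd : ∀ f < 2^(c+1), ∀ s < 21, x f s ≤ 1000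
  r3 : 3 ≤ r
  r64 : r ≤ 64
  A : ∀ i < 5, 2*i+4 ≤ v → (i+1) * r ≤ ((Finset.range (2^(c+1))).filter fun f => x f i ≤ 2*i+4).card
  A' : ∀ i < 5, 2*i+4 ≤ v → (i+1) * r ≤ ((Finset.range (2^(c+1))).filter fun f => x f (5+i) ≤ 2*i+8).card
  B : ∀ i < 5, 2*i+4 ≤ v → ((Finset.range (2^(c+1))).filter fun f => x f (10+i) ≤ 2*i+4).card ≤ (i+1) * r 
  B' : ∀ i < 5, 2*i+4 ≤ v → ((Finset.range (2^(c+1))).filter fun f => x f (15+i) ≤ 2*i+8).card ≤ (i+1) * r 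
  D : ((Finset.range (2^(c+1))).filter fun f => x f 20 ≤ 2).card = 0

theorem sum_flag (n t : ℕ) (x : ℕ → ℕ) : (∑ f ∈ Finset.range n, if x f ≤ t then 0 else 1) + ((Finset.range n).filter fun f => x f ≤ t).card = n := by
  rw [Finset.card_filter, ← Finset.sum_add_distrib]
  rw [Finset.sum_congr rfl (g := fun _ => 1)]
  · simp
  · intros; split_ifs <;> rfl

theorem check_eq (k : Cst) (v X : ℕ) (K : ℕ → Bool) : check k v X K =
  pickC v (fun C E => rloop k.HAB k.HA k.HB E (K (flags k X)) 70 (flags k X % k.M + C)) (K (flags k X)) k.cs := rfl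
theorem pickC_nil (v : ℕ) (K : ℕ → ℕ → Bool) (F : Bool) : pickC v K F CL.nil = F := rfl
theorem pickC_cons (v : ℕ) (K : ℕ → ℕ → Bool) (F : Bool) (tv C E t) : pickC v K F (CL.cons tv C E t) =
  BR (pickC v K F t) (K C E) (Nat.ble tv v) := rfl
theorem csEq (c : ℕ) : (mkCst c).cs = mkCE (2^(c+1)) 5 (mkCE (2^(c+1)) 4 (mkCE (2^(c+1)) 3 (mkCE (2^(c+1)) 2 (mkCE (2^(c+1)) 1 CL.nil)))) := rfl

theorem check_sound {c r v x} (hc : c ≤ 5) (G : Good c r v x) (K : ℕ → Bool) :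
    check (mkCst c) v (P2 (2^(c+1)) x) K = true → K (flags (mkCst c) (P2 (2^(c+1)) x)) = true := by
  have hn : 2^(c+1) ≤ 64 := (Nat.pow_le_pow_right (by norm_num) (by omega : c + 1 ≤ 6)).trans (by norm_num)
  generalize hZ : flags (mkCst c) (P2 (2^(c+1)) x) = Z
  have hZ2 := flags_eq c x G.bd
  rw [hZ] at hZ2
  have main : ∀ a, 1 ≤ a → a ≤ 5 → 2*a+2 ≤ v → 
      rloop HABc HAc HBc (pk 11 (laneE a) 21) (K Z) 70 (Z % (2^231-1) + pk 11 (laneC (2^(c+1)) a) 21) = true → K Z = true := by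
    intro a ha1 ha5 hav h
    rw [hZ2, Zmod hn _ (by intros; split_ifs <;> norm_num), pk_add, ← hZ2] at h
    set g : ℕ → ℕ := fun s => ∑ f ∈ Finset.range (2^(c+1)), if x f s ≤ thr s then 0 else 1 with hg
    have hs : ∀ s t, thr s = t → g s + ((Finset.range (2^(c+1))).filter fun f => x f s ≤ t).card = 2^(c+1) := by
      rintro s _ rfl
      exact sum_flag (2^(c+1)) (thr s) (fun f => x f s)
    refine rloop_sound (a := a) (r := r) hn G.r64 g (fun s _ => ?_) ?_ ?_ ?_ (K Z) 70 0 (by have := G.r3; omega) (by have := G.r64; omega) ?_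
    · have := hs s _ rfl; omega
    · intro s h10 h5
      by_cases h : s < 5
      · have e : s % 5 = s := by omega
        have := G.A s h (by omega)
        have e2 : thr s = 2*s+4 := by unfold thr; simp [h]
        have := hs s _ e2
        rw [e]; omega
      · have := G.A' (s-5) (by omega) (by omega)
        have e : s % 5 = s - 5 := by omega
        have e2 : thr s = 2*(s-5)+8 := by unfold thr; simp [h, h10]
        rw [show 5 + (s - 5) = s by omega] at this
        have := hs s _ e2
        rw [e]; omega
    · intro s h20 h10 h5
      by_cases h : s < 15
      · have e : s % 5 = s - 10 := by omega
        have := G.B (s-10) (by omega) (by omega)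
        have e2 : thr s = 2*(s-10)+4 := by unfold thr; simp [h, show ¬ s < 5 by omega, show ¬ s < 10 by omega]
        rw [show 10 + (s - 10) = s by omega] at this
        have := hs s _ e2
        rw [e]; omega
      · have := G.B' (s-15) (by omega) (by omega)
        have e : s % 5 = s - 15 := by omega
        have e2 : thr s = 2*(s-15)+8 := by unfold thr; simp [h, show ¬ s < 5 by omega, show ¬ s < 10 by omega, h20]
        rw [show 15 + (s - 15) = s by omega] at this
        have := hs s _ e2
        rw [e]; omega
    · have := hs 20 2 rfl
      have h0 := G.D
      omega
    · rw [← h]; congr 1; exact pk_congr fun s _ => by simp [hg]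
  have hexp : check (mkCst c) v (P2 (2^(c+1)) x) K = 
     BR (BR (BR (BR (BR (K Z) (rloop HABc HAc HBc (pk 11 (laneE 1) 21) (K Z) 70 (Z % (2^231-1) + pk 11 (laneC (2^(c+1)) 1) 21)) (Nat.ble 4 v))
        (rloop HABc HAc HBc (pk 11 (laneE 2) 21) (K Z) 70 (Z % (2^231-1) + pk 11 (laneC (2^(c+1)) 2) 21)) (Nat.ble 6 v))
        (rloop HABc HAc HBc (pk 11 (laneE 3) 21) (K Z) 70 (Z % (2^231-1) + pk 11 (laneC (2^(c+1)) 3) 21)) (Nat.ble 8 v))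
        (rloop HABc HAc HBc (pk 11 (laneE 4) 21) (K Z) 70 (Z % (2^231-1) + pk 11 (laneC (2^(c+1)) 4) 21)) (Nat.ble 10 v))
        (rloop HABc HAc HBc (pk 11 (laneE 5) 21) (K Z) 70 (Z % (2^231-1) + pk 11 (laneC (2^(c+1)) 5) 21)) (Nat.ble 12 v) := by
    rw [← hZ, check_eq, csEq]
    simp only [mkCE, pickC_cons, pickC_nil]
    rfl
  rw [hexp]
  have step : ∀ a, 1 ≤ a → a ≤ 5 → ∀ R : Bool, (R = true → K Z = true) → 
    BR R (rloop HABc HAc HBc (pk 11 (laneE a) 21) (K Z) 70 (Z % (2^231-1) + pk 11 (laneC (2^(c+1)) a) 21)) (Nat.ble (2*a+2) v) = true → K Z = true := by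
    intro a h1 h5 R hR
    cases hb : Nat.ble (2*a+2) v with
    | false => exact hR
    | true => exact main a h1 h5 (Nat.le_of_ble_eq_true hb)
  exact step 5 (by omega) (by omega) _ (step 4 (by omega) (by omega) _ (step 3 (by omega) (by omega) _ (step 2 (by omega) (by omega) _ (step 1 (by omega) (by omega) _ id))))
end BP

namespace BP
open Finset
def lab (m : ℕ → ℕ) (j : ℕ) : ℕ := ((range (min j (m j))).filter fun i => i < m i).card
def inn (m : ℕ → ℕ) (f j : ℕ) : ℕ := (bit f 0 + ∑ i ∈ range (j+1), bit f (lab m i + 1)) % 2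
def wt (c : ℕ) (m w : ℕ → ℕ) (f : ℕ) : ℕ := popc f c + ∑ j ∈ range (2*c), inn m f j * w j
def subc (c : ℕ) (m w : ℕ → ℕ) (g f : ℕ) : Prop :=
  (∀ i < c, bit g (i+1) ≤ bit f (i+1)) ∧ ∀ j < 2*c, w j ≠ 0 → inn m g j ≤ inn m f j
def circ (c : ℕ) (m w : ℕ → ℕ) (f : ℕ) : Prop :=
  f ≠ 0 ∧ ∀ g < 2^(c+1), g ≠ 0 → subc c m w g f → g = f

open Classical in
/-- a Hamiltonian cycle with `c` chords whose cycle spectrum is constant -/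
structure Model (c r : ℕ) (m w col : ℕ → ℕ) : Prop where
  c1 : 1 ≤ c
  c5 : c ≤ 5
  m_lt : ∀ j < 2*c, m j < 2*c
  m_inv : ∀ j < 2*c, m (m j) = j
  m_ne : ∀ j < 2*c, m j ≠ j
  col0 : col 0 = 0
  col_m : ∀ j < 2*c, col j + col (m j) = 1
  par : ∀ j < 2*c, w j % 2 = (col j + col ((j+1) % (2*c))) % 2
  tie : ∀ j, j + 1 < 2*c → w j = 0 → m (j+1) < m j
  wmax : ∀ j < 2*c, w j ≤ w (2*c-1)
  wpos : 0 < w (2*c-1)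
  no1 : ∀ j < 2*c, m j = (j+1) % (2*c) → w j ≠ 1
  r3 : 3 ≤ r
  v4 : 4 ≤ ∑ j ∈ range (2*c), w j
  vev : Even (∑ j ∈ range (2*c), w j)
  ceven : ∀ f < 2^(c+1), circ c m w f → Even (wt c m w f)
  cge : ∀ f < 2^(c+1), circ c m w f → 4 ≤ wt c m w f
  cle : ∀ f < 2^(c+1), circ c m w f → wt c m w f ≤ ∑ j ∈ range (2*c), w j
  cnt : ∀ k, 4 ≤ k → k ≤ ∑ j ∈ range (2*c), w j → Even k →
    ((range (2^(c+1))).filter fun f => circ c m w f ∧ wt c m w f = k).card = r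

theorem bit_le (f i) : bit f i ≤ 1 := by
  show (f >>> i) &&& 1 ≤ 1
  exact Nat.and_le_right
theorem popc_le (f c) : popc f c ≤ c := by
  induction c with
  | zero => exact le_rfl
  | succ c ih =>
    show popc f c + bit f (c+1) ≤ _
    have := bit_le f (c+1); omega
theorem inn_le (m f j) : inn m f j ≤ 1 := by unfold inn; omega

section
variable {c r : ℕ} {m w col : ℕ → ℕ}
open Classical in
theorem cntL (M : Model c r m w col) (i : ℕ) (hi : 2*i+4 ≤ ∑ j ∈ range (2*c), w j) :
    ((range (2^(c+1))).filter fun f => circ c m w f ∧ wt c m w f ≤ 2*i+4).card = (i+1)*r := by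
  induction i with
  | zero =>
    rw [← M.cnt 4 le_rfl hi (by decide), zero_add, one_mul]
    congr 1; ext f; simp only [mem_filter, mem_range]
    constructor
    · rintro ⟨h1, h2, h3⟩; have := M.cge f h1 h2; exact ⟨h1, h2, by omega⟩
    · rintro ⟨h1, h2, h3⟩; exact ⟨h1, h2, by omega⟩
  | succ i ih =>
    rw [show (i+1+1)*r = (i+1)*r + r by ring, ← ih (by omega)]
    conv_rhs => rw [← M.cnt (2*(i+1)+4) (by omega) hi ⟨i+3, by ring⟩]
    rw [← card_union_of_disjoint]
    · congr 1; ext f; simp only [mem_filter, mem_range, mem_union]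
      constructor
      · rintro ⟨h1, h2, h3⟩; obtain ⟨q, hq⟩ := M.ceven f h1 h2
        by_cases h : wt c m w f = 2*(i+1)+4
        · exact Or.inr ⟨h1, h2, h⟩
        · exact Or.inl ⟨h1, h2, by omega⟩
      · rintro (⟨h1, h2, h3⟩ | ⟨h1, h2, h3⟩) <;> exact ⟨h1, h2, by omega⟩
    · rw [Finset.disjoint_left]; intro f; simp only [mem_filter, mem_range]
      rintro ⟨_, _, h⟩ ⟨_, _, h'⟩; omega
open Classical in
theorem cntD (M : Model c r m w col) (i : ℕ) (hi : 2*i+4 ≤ ∑ j ∈ range (2*c), w j) :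
    ((range (2^(c+1))).filter fun f => circ c m w f ∧ ∑ j ∈ range (2*c), w j ≤ wt c m w f + 2*i).card = (i+1)*r := by
  obtain ⟨q, hq⟩ := M.vev
  induction i with
  | zero =>
    rw [← M.cnt _ M.v4 le_rfl M.vev, zero_add, one_mul]
    congr 1; ext f; simp only [mem_filter, mem_range]
    constructor
    · rintro ⟨h1, h2, h3⟩; have := M.cle f h1 h2; exact ⟨h1, h2, by omega⟩
    · rintro ⟨h1, h2, h3⟩; exact ⟨h1, h2, by omega⟩
  | succ i ih =>
    rw [show (i+1+1)*r = (i+1)*r + r by ring, ← ih (by omega)]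
    conv_rhs => rw [← M.cnt (∑ j ∈ range (2*c), w j - 2*(i+1)) (by omega) (by omega) ⟨q - (i+1), by omega⟩]
    rw [← card_union_of_disjoint]
    · congr 1; ext f; simp only [mem_filter, mem_range, mem_union]
      constructor
      · rintro ⟨h1, h2, h3⟩; obtain ⟨q', hq'⟩ := M.ceven f h1 h2
        by_cases h : wt c m w f = ∑ j ∈ range (2*c), w j - 2*(i+1)
        · exact Or.inr ⟨h1, h2, h⟩
        · exact Or.inl ⟨h1, h2, by omega⟩
      · rintro (⟨h1, h2, h3⟩ | ⟨h1, h2, h3⟩) <;> exact ⟨h1, h2, by omega⟩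
    · rw [Finset.disjoint_left]; intro f; simp only [mem_filter, mem_range]
      rintro ⟨_, _, h⟩ ⟨_, _, h'⟩; omega

theorem n64 (M : Model c r m w col) : 2^(c+1) ≤ 64 :=
  (Nat.pow_le_pow_right (by norm_num) (by have := M.c5; omega : c + 1 ≤ 6)).trans (by norm_num)
theorem r64 (M : Model c r m w col) : r ≤ 64 := by
  classical
  rw [← M.cnt _ M.v4 le_rfl M.vev]
  exact (card_filter_le _ _).trans (by simpa using n64 M)

theorem mkGood (M : Model c r m w col) {vlo : ℕ} {x : ℕ → ℕ → ℕ} (hv : vlo ≤ ∑ j ∈ range (2*c), w j)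
    (bd : ∀ f < 2^(c+1), ∀ s < 21, x f s ≤ 1000)
    (A : ∀ f < 2^(c+1), circ c m w f → ∀ i < 5, x f i ≤ wt c m w f ∧ x f (5+i) + wt c m w f ≤ ∑ j ∈ range (2*c), w j + 8)
    (B : ∀ f < 2^(c+1), ∀ s < 21, 10 ≤ s → x f s ≤ 16 → circ c m w f ∧
       (isL s = 1 → wt c m w f ≤ x f s) ∧ (isL s ≠ 1 → ∑ j ∈ range (2*c), w j + 8 ≤ x f s + wt c m w f)) :
    Good c r vlo x where
  bd := bd
  r3 := M.r3
  r64 := r64 M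
  A i hi hv' := by
    classical
    rw [← cntL M i (by omega)]
    refine card_le_card fun f => ?_
    simp only [mem_filter, mem_range]
    rintro ⟨h1, h2, h3⟩
    have := A f h1 h2 i hi
    exact ⟨h1, by omega⟩
  A' i hi hv' := by
    classical
    rw [← cntD M i (by omega)]
    refine card_le_card fun f => ?_
    simp only [mem_filter, mem_range]
    rintro ⟨h1, h2, h3⟩
    have := A f h1 h2 i hi
    exact ⟨h1, by omega⟩
  B i hi hv' := by
    classical
    rw [← cntL M i (by omega)]
    refine card_le_card fun f => ?_
    simp only [mem_filter, mem_range]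
    rintro ⟨h1, h3⟩
    obtain ⟨h2, h4, _⟩ := B f h1 (10+i) (by omega) (by omega) (by omega)
    have := h4 (by unfold isL; split_ifs <;> omega)
    exact ⟨h1, h2, by omega⟩
  B' i hi hv' := by
    classical
    rw [← cntD M i (by omega)]
    refine card_le_card fun f => ?_
    simp only [mem_filter, mem_range]
    rintro ⟨h1, h3⟩
    obtain ⟨h2, _, h4⟩ := B f h1 (15+i) (by omega) (by omega) (by omega)
    have := h4 (by unfold isL; split_ifs <;> omega)
    exact ⟨h1, h2, by omega⟩
  D := by
    rw [card_eq_zero, filter_eq_empty_iff]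
    intro f hf h
    rw [mem_range] at hf
    obtain ⟨h2, h4, _⟩ := B f hf 20 (by omega) (by omega) (by omega)
    have := h4 (by decide)
    have := M.cge f hf h2
    omega
end
end BP

namespace BP
open Finset
def Wl (m : ℕ → ℕ) (j f s : ℕ) : ℕ := inn m f j * isL s + (1 - inn m f j) * (1 - isL s)
def Xl (m : ℕ → ℕ) (j f s : ℕ) : ℕ := if s < 10 then 0 else 32 * Wl m j f s
def Wp (c : ℕ) (m : ℕ → ℕ) (j : ℕ) : ℕ := P2 (2^(c+1)) (Wl m j)
def Xp (c : ℕ) (m : ℕ → ℕ) (j : ℕ) : ℕ := P2 (2^(c+1)) (Xl m j)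
def x0 (c f s : ℕ) : ℕ := if isL s = 1 then popc f c else 8 - popc f c
def XX (c : ℕ) (m lo : ℕ → ℕ) (S : Finset ℕ) (d : ℕ → ℕ → ℕ) (f s : ℕ) : ℕ :=
  x0 c f s + ∑ j ∈ range (2*c), lo j * Wl m j f s + ∑ j ∈ S, Xl m j f s + d f s

theorem isL_01 (s) : isL s = 0 ∨ isL s = 1 := by unfold isL; split_ifs <;> simp
theorem Wl_le (m j f s) : Wl m j f s ≤ 1 := by
  have := inn_le m f j
  unfold Wl; rcases isL_01 s with h | h <;> rw [h] <;> simp <;> omega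
theorem Xl_le (m j f s) : Xl m j f s ≤ 32 := by
  have := Wl_le m j f s
  unfold Xl; split_ifs <;> omega

theorem XX_erase {c m lo S d j} (hj : j ∈ S) :
    P2 (2^(c+1)) (XX c m lo S d) - Xp c m j = P2 (2^(c+1)) (XX c m lo (S.erase j) d) := by
  have : P2 (2^(c+1)) (XX c m lo S d) = P2 (2^(c+1)) (XX c m lo (S.erase j) d) + Xp c m j := by
    unfold Xp; rw [P2_add]
    refine P2_congr fun f _ s _ => ?_
    unfold XX
    rw [← sum_erase_add S _ hj]; ring
  omega
theorem XX_bump {c m S d} (lo e : ℕ → ℕ) :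
    P2 (2^(c+1)) (XX c m lo S d) + ∑ j ∈ range (2*c), e j * Wp c m j = P2 (2^(c+1)) (XX c m (fun i => lo i + e i) S d) := by
  have h : ∑ j ∈ range (2*c), e j * Wp c m j = P2 (2^(c+1)) (fun f s => ∑ j ∈ range (2*c), e j * Wl m j f s) := by
    simp only [Wp, P2_mul]
    simp only [P2, pk_sum]
  rw [h, P2_add]
  refine P2_congr fun f _ s _ => ?_
  unfold XX
  simp only [add_mul, sum_add_distrib]; ring
theorem XX_d {c m lo S d} (d' : ℕ → ℕ → ℕ) :
    P2 (2^(c+1)) (XX c m lo S d) + P2 (2^(c+1)) d' = P2 (2^(c+1)) (XX c m lo S (fun f s => d f s + d' f s)) := by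
  rw [P2_add]
  refine P2_congr fun f _ s _ => ?_
  unfold XX; ring

section
variable {c r : ℕ} {m w col : ℕ → ℕ}

theorem XX_good (M : Model c r m w col) {lo : ℕ → ℕ} {S : Finset ℕ} {d : ℕ → ℕ → ℕ}
    (hlo : ∀ j < 2*c, lo j ≤ w j) (hS : S ⊆ range (2*c)) (hex : ∀ j < 2*c, j ∉ S → lo j = w j)
    (hv : ∑ j ∈ range (2*c), lo j ≤ 200)
    (hd : ∀ f s, d f s ≤ 96)
    (hd1 : ∀ f < 2^(c+1), circ c m w f → ∀ s < 10, d f s = 0)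
    (hd2 : ∀ f < 2^(c+1), ∀ s < 21, 10 ≤ s → d f s ≤ 16 → circ c m w f) :
    Good c r (∑ j ∈ range (2*c), lo j) (XX c m lo S d) := by
  have hp : ∀ f, popc f c ≤ 5 := fun f => (popc_le f c).trans M.c5
  have hx0 : ∀ f s, x0 c f s ≤ 8 := fun f s => by have := hp f; unfold x0; split_ifs <;> omega
  have hc := M.c5
  have hSc : S.card ≤ 10 := (card_le_card hS).trans (by simp; omega)
  refine mkGood M (sum_le_sum fun j hj => hlo j (mem_range.1 hj)) ?_ ?_ ?_
  · intro f _ s _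
    have h1 : ∑ j ∈ range (2*c), lo j * Wl m j f s ≤ ∑ j ∈ range (2*c), lo j :=
      sum_le_sum fun j _ => by simpa using Nat.mul_le_mul_left (lo j) (Wl_le m j f s)
    have h2 : ∑ j ∈ S, Xl m j f s ≤ 320 :=
      (sum_le_card_nsmul _ _ 32 (fun j _ => Xl_le m j f s)).trans (by simp; omega)
    have := hx0 f s
    have := hd f s
    unfold XX; omega
  · intro f hf hcf i hi
    have e1 : isL i = 1 := by unfold isL; split_ifs <;> omega
    have e2 : isL (5+i) = 0 := by unfold isL; split_ifs <;> omega
    have z1 : ∑ j ∈ S, Xl m j f i = 0 := sum_eq_zero fun j _ => by unfold Xl; rw [if_pos (by omega)]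
    have z2 : ∑ j ∈ S, Xl m j f (5+i) = 0 := sum_eq_zero fun j _ => by unfold Xl; rw [if_pos (by omega)]
    unfold XX wt
    rw [z1, z2, hd1 f hf hcf i (by omega), hd1 f hf hcf (5+i) (by omega)]
    constructor
    · unfold x0; rw [if_pos e1]
      have : ∑ j ∈ range (2*c), lo j * Wl m j f i ≤ ∑ j ∈ range (2*c), inn m f j * w j := by
        refine sum_le_sum fun j hj => ?_
        unfold Wl; rw [e1]; simp only [mul_one, Nat.sub_self, mul_zero, add_zero]
        rw [mul_comm]; exact Nat.mul_le_mul_left _ (hlo j (mem_range.1 hj))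
      omega
    · unfold x0; rw [if_neg (by omega)]
      have : ∑ j ∈ range (2*c), lo j * Wl m j f (5+i) + ∑ j ∈ range (2*c), inn m f j * w j ≤ ∑ j ∈ range (2*c), w j := by
        rw [← sum_add_distrib]
        refine sum_le_sum fun j hj => ?_
        unfold Wl; rw [e2]; simp only [mul_zero, Nat.sub_zero, mul_one, zero_add]
        have h1 := inn_le m f j
        have := hlo j (mem_range.1 hj)
        interval_cases inn m f j <;> simp <;> omega
      have := hp f
      omega
  · intro f hf s hs hs10 hx
    have hS0 : ∀ j ∈ S, Wl m j f s = 0 := by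
      intro j hj
      have h1 : Xl m j f s ≤ ∑ j ∈ S, Xl m j f s := single_le_sum (f := fun j => Xl m j f s) (fun _ _ => Nat.zero_le _) hj
      unfold XX at hx
      have h2 : Xl m j f s ≤ 16 := by omega
      unfold Xl at h2
      rw [if_neg (by omega)] at h2
      omega
    have hcf : circ c m w f := hd2 f hf s hs hs10 (by unfold XX at hx; omega)
    have hlw : ∀ j ∈ range (2*c), lo j * Wl m j f s = w j * Wl m j f s := by
      intro j hj
      by_cases h : j ∈ S
      · rw [hS0 j h]; simp
      · rw [hex j (mem_range.1 hj) h]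
    refine ⟨hcf, fun h => ?_, fun h => ?_⟩
    · unfold XX wt x0
      rw [if_pos h, sum_congr rfl hlw]
      have : ∑ j ∈ range (2*c), w j * Wl m j f s = ∑ j ∈ range (2*c), inn m f j * w j := by
        refine sum_congr rfl fun j hj => ?_
        unfold Wl; rw [h]; simp [mul_comm]
      omega
    · have h : isL s = 0 := by rcases isL_01 s with h | h <;> tauto
      unfold XX wt x0
      rw [if_neg (by omega), sum_congr rfl hlw]
      have : ∑ j ∈ range (2*c), w j * Wl m j f s + ∑ j ∈ range (2*c), inn m f j * w j = ∑ j ∈ range (2*c), w j := by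
        rw [← sum_add_distrib]
        refine sum_congr rfl fun j hj => ?_
        unfold Wl; rw [h]
        have h1 := inn_le m f j
        interval_cases inn m f j <;> simp
      have := hp f
      omega

def toAL (c : ℕ) (m lo : ℕ → ℕ) : List ℕ → AL
  | [] => AL.nil
  | j :: js => AL.cons (lo j) (Wp c m j) (Xp c m j) (toAL c m lo js)

theorem toAL_congr {lo lo' : ℕ → ℕ} {js : List ℕ} (h : ∀ j ∈ js, lo j = lo' j) : toAL c m lo js = toAL c m lo' js := by
  induction js with
  | nil => rfl
  | cons j js ih =>
    simp only [toAL]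
    rw [h j (by simp), ih fun i hi => h i (by simp [hi])]

theorem rapp_toAL (lo : ℕ → ℕ) (a : List ℕ) : ∀ b, rapp (toAL c m lo a) (toAL c m lo b) = toAL c m lo (a.reverse ++ b) := by
  induction a with
  | nil => intro b; rfl
  | cons j a ih =>
    intro b
    have : rapp (toAL c m lo (j :: a)) (toAL c m lo b) = rapp (toAL c m lo a) (toAL c m lo (j :: b)) := rfl
    rw [this, ih]; simp

theorem pick_sound (lo : ℕ → ℕ) (q : ℕ) (K : ℕ → ℕ → ℕ → AL → Bool) (F : Bool) (js : List ℕ) : ∀ acc : List ℕ,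
    pick q K F (toAL c m lo js) (toAL c m lo acc) = true → F = true ∨ 
    ∃ j rest, List.Perm (j :: rest) (js ++ acc) ∧ K (lo j) (Wp c m j) (Xp c m j) (toAL c m lo rest) = true := by
  induction js with
  | nil => intro acc h; exact Or.inl h
  | cons j js ih =>
    intro acc h
    have h : BR (K (lo j) (Wp c m j) (Xp c m j) (rapp (toAL c m lo acc) (toAL c m lo js))) 
        (pick q K F (toAL c m lo js) (toAL c m lo (j :: acc))) (Nat.beq (Nat.land q (Wp c m j)) 0) = true := h
    cases hb : Nat.beq (Nat.land q (Wp c m j)) 0 with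
    | false =>
      rw [hb] at h
      refine Or.inr ⟨j, acc.reverse ++ js, ?_, ?_⟩
      · rw [List.cons_append, List.perm_cons]
        exact List.perm_append_comm.trans (List.Perm.append_left _ (List.reverse_perm _))
      · rw [← rapp_toAL]; exact h
    | true =>
      rw [hb] at h
      rcases ih (j :: acc) h with h | ⟨i, rest, hp, hk⟩
      · exact Or.inl h
      · refine Or.inr ⟨i, rest, hp.trans ?_, hk⟩
        simp

theorem ch1_sound (k : Cst) (Z : ℕ) (lo : ℕ → ℕ) (K : ℕ → ℕ → ℕ → AL → Bool) (F : Bool) (js : List ℕ)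
    (h : ch1 k Z (toAL c m lo js) K F = true) : (js = [] ∧ F = true) ∨ 
    ∃ j rest, List.Perm (j :: rest) js ∧ K (lo j) (Wp c m j) (Xp c m j) (toAL c m lo rest) = true := by
  rcases pick_sound lo _ K _ js [] h with h | ⟨j, rest, hp, hk⟩
  · rcases pick_sound lo _ K _ js [] h with h | ⟨j, rest, hp, hk⟩
    · cases js with
      | nil => exact Or.inl ⟨rfl, h⟩
      | cons j js => exact Or.inr ⟨j, js, List.Perm.refl _, h⟩
    · exact Or.inr ⟨j, rest, by simpa using hp, hk⟩
  · exact Or.inr ⟨j, rest, by simpa using hp, hk⟩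

theorem BR_and {A B : Bool} (h : BR false A B = true) : A = true ∧ B = true := by
  cases B with
  | false => cases h
  | true => exact ⟨h, rfl⟩

theorem bumped_sound {h a W : ℕ} {K : ℕ → ℕ → Bool} (hW : h ≤ W) (haW : a ≤ W) (hp : h % 2 = W % 2) 
    (hb : bumped h a K = true) : ∃ dh, K dh (h+dh) = true ∧ h + dh ≤ W ∧ dh % 2 = 0 ∧ a ≤ h + dh ∧ h + dh ≤ max h (a+1) := by
  unfold bumped at hb
  cases hba : Nat.ble a h with
  | true =>
    rw [hba] at hb
    have := Nat.le_of_ble_eq_true hba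
    exact ⟨0, hb, hW, rfl, this, by simp⟩
  | false =>
    rw [hba] at hb
    have h1 : ¬ a ≤ h := fun hh => by rw [Nat.ble_eq_true_of_le hh] at hba; cases hba
    have hb : K ((a + (a - h) % 2) - h) (a + (a - h) % 2) = true := hb
    refine ⟨a + (a-h)%2 - h, ?_, ?_, ?_, ?_, ?_⟩
    · rwa [show h + (a + (a - h) % 2 - h) = a + (a - h) % 2 by omega]
    all_goals omega

def bmp (N j a dh i : ℕ) : ℕ := (if i = j then a else 0) + (if i = N - 1 then dh else 0)
theorem bmp_sum {N j a dh : ℕ} (hj : j < N) (y : ℕ → ℕ) : ∑ i ∈ range N, bmp N j a dh i * y i = a * y j + dh * y (N-1) := by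
  unfold bmp
  simp only [add_mul, sum_add_distrib, ite_mul, zero_mul, sum_ite_eq', mem_range]
  rw [if_pos hj, if_pos (by omega)]
theorem bmp_sum1 {N j a dh : ℕ} (hj : j < N) : ∑ i ∈ range N, bmp N j a dh i = a + dh := by
  have := bmp_sum (a := a) (dh := dh) hj (fun _ => 1)
  simpa using this

structure Inv (c : ℕ) (w lo : ℕ → ℕ) (S : Finset ℕ) (js : List ℕ) (hex : Bool) : Prop where
  le : ∀ j < 2*c, lo j ≤ w j
  par : ∀ j < 2*c, lo j % 2 = w j % 2
  ex : ∀ j < 2*c, j ∉ S → lo j = w j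
  nd : js.Nodup
  lt : ∀ j ∈ js, j < 2*c-1
  hS : ∀ j, j ∈ S ↔ j ∈ js ∨ (hex = false ∧ j = 2*c-1)

theorem Inv.perm {lo S js js' hex} (I : Inv c w lo S js hex) (h : List.Perm js' js) : Inv c w lo S js' hex :=
  ⟨I.le, I.par, I.ex, h.nodup_iff.2 I.nd, fun j hj => I.lt j (h.mem_iff.1 hj), fun j => by rw [I.hS, h.mem_iff]⟩

theorem Inv.exact {lo S j js hex} (I : Inv c w lo S (j :: js) hex) (h : lo j = w j) : Inv c w lo (S.erase j) js hex := by
  have hnd := List.nodup_cons.1 I.nd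
  have hj := I.lt j (by simp)
  refine ⟨I.le, I.par, fun i hi hiS => ?_, hnd.2, fun i hi => I.lt i (by simp [hi]), fun i => ?_⟩
  · by_cases hij : i = j
    · rw [hij]; exact h
    · exact I.ex i hi fun hh => hiS (mem_erase.2 ⟨hij, hh⟩)
  · rw [mem_erase, I.hS, List.mem_cons]
    constructor
    · tauto
    · rintro (h | ⟨h1, h2⟩)
      · exact ⟨fun e => hnd.1 (e ▸ h), Or.inl (Or.inr h)⟩
      · exact ⟨by omega, Or.inr ⟨h1, h2⟩⟩

theorem Inv.bump {lo S j js hex a dh} (I : Inv c w lo S (j :: js) hex) (h1 : lo j + a ≤ w j) (ha : a % 2 = 0)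
    (h2 : lo (2*c-1) + dh ≤ w (2*c-1)) (hdh : dh % 2 = 0) : 
    Inv c w (fun i => lo i + bmp (2*c) j a dh i) S (j :: js) hex := by
  have hj := I.lt j (by simp)
  refine ⟨fun i hi => ?_, fun i hi => ?_, fun i hi hiS => ?_, I.nd, I.lt, I.hS⟩
  · have := I.le i hi
    unfold bmp; split_ifs with h h' h' 
    · omega
    · rw [h]; omega
    · rw [h']; omega
    · omega
  · have := I.par i hi
    unfold bmp; split_ifs <;> omega
  · have := I.ex i hi hiS
    have hij : i ≠ j := fun e => hiS ((I.hS i).2 (Or.inl (by simp [e])))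
    unfold bmp; rw [if_neg hij]
    split_ifs with h
    · subst h; omega
    · omega

theorem search_sound (M : Model c r m w col) (d : ℕ → ℕ → ℕ)
    (hd : ∀ f s, d f s ≤ 96)
    (hd1 : ∀ f < 2^(c+1), circ c m w f → ∀ s < 10, d f s = 0)
    (hd2 : ∀ f < 2^(c+1), ∀ s < 21, 10 ≤ s → d f s ≤ 16 → circ c m w f) (fuel : ℕ) :
    ∀ js lo S hex, Inv c w lo S js hex →
    search (mkCst c) (Wp c m (2*c-1)) (Xp c m (2*c-1)) fuel (toAL c m lo js) (lo (2*c-1)) hex (∑ j ∈ range (2*c), lo j)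
      (P2 (2^(c+1)) (XX c m lo S d)) = true → False := by
  have hc1 := M.c1
  induction fuel with
  | zero => intro js lo S hex _ h; cases h
  | succ fuel ih =>
    intro js lo S hex I h
    obtain ⟨h, hv⟩ := BR_and h
    have hv := Nat.le_of_ble_eq_true hv
    have hSsub : S ⊆ range (2*c) := by
      intro j hj
      rw [mem_range]
      rcases (I.hS j).1 hj with h | ⟨_, h⟩
      · have := I.lt j h; omega
      · omega
    have h := check_sound M.c5 (XX_good M I.le hSsub I.ex hv hd hd1 hd2) _ h
    rcases ch1_sound _ _ lo _ _ js h with ⟨rfl, h⟩ | ⟨j, rest, hp, h⟩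
    · cases hex with
      | true => cases h
      | false =>
        obtain ⟨h1, h2⟩ := BR_and (show BR false _ _ = true from h)
        have hmem : 2*c-1 ∈ S := (I.hS _).2 (Or.inr ⟨rfl, rfl⟩)
        have hS1 : ∀ j, j ∈ S → j = 2*c-1 := fun j hj => by simpa using (I.hS j).1 hj
        by_cases hw : lo (2*c-1) = w (2*c-1)
        · rw [show Nat.sub _ _ = P2 (2^(c+1)) (XX c m lo S d) - Xp c m (2*c-1) from rfl, XX_erase hmem] at h2
          refine ih [] _ _ _ ⟨I.le, I.par, fun j hj hjS => ?_, List.nodup_nil, by simp, fun j => ?_⟩ h2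
          · by_cases hj' : j = 2*c-1
            · rw [hj']; exact hw
            · exact I.ex j hj fun h => hj' (hS1 j h)
          · simp only [mem_erase]
            constructor
            · rintro ⟨a, b⟩; exact absurd (hS1 j b) a
            · simp
        · have hle := I.le (2*c-1) (by omega)
          have hpar := I.par (2*c-1) (by omega)
          have hb := I
          refine ih [] (fun i => lo i + bmp (2*c) (2*c-1) 2 0 i) S false ⟨fun j hj => ?_, fun j hj => ?_, fun j hj hjS => ?_, I.nd, I.lt, I.hS⟩ ?_
          · have := I.le j hj
            unfold bmp; split_ifs with h
            · rw [h]; omega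
            · omega
          · have := I.par j hj
            unfold bmp; split_ifs <;> omega
          · have := I.ex j hj hjS
            unfold bmp
            rw [if_neg fun e : j = 2*c-1 => hjS (e ▸ hmem)]; simpa using this
          · rw [← h1]
            rw [← XX_bump, bmp_sum (by omega), sum_add_distrib, bmp_sum1 (by omega)]
            have e1 : bmp (2*c) (2*c-1) 2 0 (2*c-1) = 2 := by unfold bmp; simp
            simp only [toAL, e1, zero_mul, add_zero]
            rfl
    · have I := I.perm hp
      obtain ⟨h1, h2⟩ := BR_and (show BR false _ _ = true from h)
      have hj := I.lt j (by simp)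
      by_cases hw : lo j = w j
      · have hjS : j ∈ S := (I.hS j).2 (Or.inl (by simp))
        rw [show Nat.sub _ _ = P2 (2^(c+1)) (XX c m lo S d) - Xp c m j from rfl, XX_erase hjS] at h2
        exact ih _ _ _ _ (I.exact hw) h2
      · have hle := I.le j (by omega)
        have hpar := I.par j (by omega)
        have hmax := M.wmax j (by omega)
        obtain ⟨dh, hK, b1, b2, b3, b4⟩ := bumped_sound (I.le (2*c-1) (by omega)) (show Nat.add (lo j) 2 ≤ w (2*c-1) by show lo j + 2 ≤ _; omega)
          (I.par (2*c-1) (by omega)) h1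
        refine ih _ _ _ _ (I.bump (a := 2) (dh := dh) (by omega) rfl b1 b2) ?_
        rw [← hK]
        rw [← XX_bump, bmp_sum (by omega), sum_add_distrib, bmp_sum1 (by omega)]
        have e1 : bmp (2*c) j 2 dh j = 2 := by unfold bmp; rw [if_pos rfl, if_neg (by omega)]
        have e2 : bmp (2*c) j 2 dh (2*c-1) = dh := by unfold bmp; rw [if_neg (by omega), if_pos rfl, zero_add]
        have e3 : toAL c m (fun i => lo i + bmp (2*c) j 2 dh i) rest = toAL c m lo rest := by
          refine toAL_congr fun i hi => ?_
          have := I.lt i (by simp [hi])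
          unfold bmp
          rw [if_neg (fun e : i = j => (List.nodup_cons.1 I.nd).1 (e ▸ hi)), if_neg (by omega)]
          rfl
        simp only [toAL, e3, e1, e2]
        rfl
end
end BP

namespace BP
open Finset
open Classical in
noncomputable def PB (n : ℕ) (p : ℕ → ℕ → Prop) : ℕ := pk 231 (fun f => pk 1 (fun g => if p f g then 1 else 0) n) n

theorem pk1_lt {n : ℕ} (hn : n ≤ 64) {x : ℕ → ℕ} (h : ∀ g < n, x g < 2) : pk 1 x n < 2^64 := by
  have h1 := pk_lt (b := 1) (n := n) (x := x) (by simpa using h)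
  exact h1.trans_le (Nat.pow_le_pow_right (by norm_num) (by omega))

theorem PB_congr {n p q} (h : ∀ f < n, ∀ g < n, (p f g ↔ q f g)) : PB n p = PB n q := by
  unfold PB
  refine pk_congr fun f hf => pk_congr fun g hg => ?_
  rw [propext (h f hf g hg)]

theorem PB_lor {n : ℕ} (hn : n ≤ 64) (p q) : PB n p ||| PB n q = PB n (fun f g => p f g ∨ q f g) := by
  unfold PB
  rw [pk_lor (by norm_num) (fun f hf => (pk1_lt hn (by intros; split_ifs <;> norm_num)).trans (by norm_num))
    (fun f hf => (pk1_lt hn (by intros; split_ifs <;> norm_num)).trans (by norm_num))]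
  refine pk_congr fun f hf => ?_
  rw [pk_lor (by norm_num) (by intros; split_ifs <;> norm_num) (by intros; split_ifs <;> norm_num)]
  refine pk_congr fun g hg => ?_
  by_cases h1 : p f g <;> by_cases h2 : q f g <;> simp [h1, h2]

open Classical in
noncomputable def ddl (n : ℕ) (p : ℕ → ℕ → Prop) (f _s : ℕ) : ℕ := 32 * ((if ∀ g < n, p f g then 0 else 1) + (if f = 0 then 1 else 0))

theorem pk_zero_fun (b n) : pk b (fun _ => 0) n = 0 := by
  induction n with
  | zero => rfl
  | succ n ih => rw [pk_succ, ih]; simp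
theorem pk_one (b n) (hn : 0 < n) : pk b (fun f => if f = 0 then 1 else 0) n = 1 := by
  induction n with
  | zero => omega
  | succ n ih =>
    rw [pk_succ]
    rcases Nat.eq_zero_or_pos n with h | h
    · subst h; simp [pk_zero]
    · rw [ih h]; simp [show n ≠ 0 by omega]
theorem pk1_eq_zero {n : ℕ} {x : ℕ → ℕ} (hx : ∀ g < n, x g < 2) : pk 1 x n = 0 ↔ ∀ g < n, x g = 0 := by
  constructor
  · intro h
    exact pk_inj (b := 1) (by simpa using hx) (by simp) (h.trans (pk_zero_fun 1 n).symm)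
  · intro h; rw [← pk_zero_fun 1 n]; exact pk_congr h

theorem dead_eq {c : ℕ} (hc : c ≤ 5) (p : ℕ → ℕ → Prop) :
    dead (mkCst c) (PB (2^(c+1)) p) = P2 (2^(c+1)) (ddl (2^(c+1)) p) := by
  classical
  have hn : 2^(c+1) ≤ 64 := (Nat.pow_le_pow_right (by norm_num) (by omega : c + 1 ≤ 6)).trans (by norm_num)
  have hn0 : 0 < 2^(c+1) := by positivity
  have e0 : dead (mkCst c) (PB (2^(c+1)) p) = pk 11 (fun _ => 32) 21 * (1 + (((pk 231 (fun _ => pk 1 (fun _ => 1) (2^(c+1))) (2^(c+1)) ^^^ PB (2^(c+1)) p)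
     + pk 231 (fun _ => 2^230-1) (2^(c+1))) &&& pk 231 (fun _ => 2^230) (2^(c+1))) >>> 230) := rfl
  rw [e0]; clear e0
  generalize 2^(c+1) = n at *
  have hu : ∀ f, pk 1 (fun g => 1 ^^^ (if p f g then 1 else 0)) n < 2^64 := fun f => 
    pk1_lt hn (by intros; split_ifs <;> norm_num)
  have e1 : pk 231 (fun _ => pk 1 (fun _ => 1) n) n ^^^ PB n p = pk 231 (fun f => pk 1 (fun g => 1 ^^^ (if p f g then 1 else 0)) n) n := by
    unfold PB
    rw [pk_xor (by norm_num) (fun f hf => (pk1_lt hn (by intros; norm_num)).trans (by norm_num)) 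
      (fun f hf => (pk1_lt hn (by intros; split_ifs <;> norm_num)).trans (by norm_num))]
    refine pk_congr fun f hf => ?_
    rw [pk_xor (by norm_num) (by intros; norm_num) (by intros; split_ifs <;> norm_num)]
  rw [e1, pk_add, pk_land (by norm_num) (fun f _ => by have := hu f; omega) (by intros; norm_num)]
  have e2 : pk 231 (fun f => (pk 1 (fun g => 1 ^^^ (if p f g then 1 else 0)) n + (2^230-1)) &&& 2^230) n
     = 2^230 * pk 231 (fun f => if ∀ g < n, p f g then 0 else 1) n := by
    rw [pk_mul']
    refine pk_congr fun f hf => ?_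
    have h1 := hu f
    have h2 := pk1_eq_zero (n := n) (x := fun g => 1 ^^^ (if p f g then 1 else 0)) (by intros; split_ifs <;> norm_num)
    have h3 : (∀ g < n, (1 ^^^ (if p f g then 1 else 0)) = 0) ↔ ∀ g < n, p f g := by
      refine forall₂_congr fun g hg => ?_
      split_ifs with h <;> simp [h]
    rw [h3] at h2
    generalize pk 1 (fun g => 1 ^^^ (if p f g then 1 else 0)) n = u at *
    have h4 : (u + (2^230-1)).testBit 230 = decide (u ≠ 0) := by
      rw [Nat.testBit_eq_decide_div_mod_eq]; congr 1
      rw [eq_iff_iff]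
      by_cases hu0 : u = 0
      · subst hu0; simp
      · have : (u + (2^230-1)) / 2^230 = 1 := by omega
        rw [this]; simp [hu0]
    rw [Nat.and_two_pow, h4]
    by_cases hu0 : u = 0
    · rw [if_pos (h2.1 hu0)]; simp [hu0]
    · rw [if_neg (fun h => hu0 (h2.2 h))]; simp [hu0]
  rw [e2, Nat.shiftRight_eq_div_pow, Nat.mul_div_cancel_left _ (by positivity), add_comm]
  have e3 := pk_one 231 n hn0
  rw [show pk 231 (fun f => if ∀ g < n, p f g then 0 else 1) n + 1 = pk 231 (fun f => if ∀ g < n, p f g then 0 else 1) n + pk 231 (fun f => if f = 0 then 1 else 0) n by rw [e3]]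
  rw [pk_add, pk_mul']
  unfold P2
  refine pk_congr fun f hf => ?_
  rw [mul_comm, pk_mul']
  refine pk_congr fun s hs => ?_
  unfold ddl; ring

/-- basic pairs -/
def bp (c : ℕ) (f g : ℕ) : Prop := g = 0 ∨ g = f ∨ ¬ ∀ i < c, bit g (i+1) ≤ bit f (i+1)
def vrp (m : ℕ → ℕ) (e f g : ℕ) : Prop := inn m g e = 1 ∧ inn m f e = 0
def vp (c : ℕ) (m : ℕ → ℕ) (E : Finset ℕ) (f g : ℕ) : Prop := bp c f g ∨ ∃ e ∈ E, vrp m e f g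

theorem vp_circ {c : ℕ} {m w : ℕ → ℕ} {E : Finset ℕ} (hE : ∀ e < 2*c, w e ≠ 0 → e ∈ E) {f : ℕ} (hf : circ c m w f) :
    ∀ g < 2^(c+1), vp c m E f g := by
  intro g hg
  by_contra h
  unfold vp bp vrp at h
  push Not at h
  obtain ⟨⟨h1, h2, h3⟩, h4⟩ := h
  refine h2 (hf.2 g hg h1 ⟨h3, fun j hj hw => ?_⟩)
  have := h4 j (hE j hj hw)
  have := inn_le m g j
  have := inn_le m f j
  omega
theorem circ_vp {c : ℕ} {m w : ℕ → ℕ} {E : Finset ℕ} (hE : ∀ e ∈ E, e < 2*c ∧ w e ≠ 0) {f : ℕ} (hf : f ≠ 0)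
    (h : ∀ g < 2^(c+1), vp c m E f g) : circ c m w f := by
  refine ⟨hf, fun g hg hg0 hs => ?_⟩
  rcases h g hg with (h1 | h1 | h1) | ⟨e, he, h1, h2⟩
  · exact absurd h1 hg0
  · exact h1
  · exact absurd hs.1 h1
  · have := hs.2 e (hE e he).1 (hE e he).2
    omega

noncomputable def vrP (c : ℕ) (m : ℕ → ℕ) (j : ℕ) : ℕ := PB (2^(c+1)) (vrp m j)
noncomputable def sufP (c : ℕ) (m : ℕ → ℕ) (j : ℕ) : ℕ := PB (2^(c+1)) (fun f g => ∃ e ∈ range (j+1), vrp m e f g)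

noncomputable def toZL (c : ℕ) (m : ℕ → ℕ) (z : ℕ → Bool) (lo : ℕ → ℕ) : ℕ → ZL
  | 0 => ZL.nil
  | j+1 => ZL.cons (z j) (lo j) (Wp c m j) (Xp c m j) (vrP c m j) (sufP c m j) (toZL c m z lo j)

section
variable {c r : ℕ} {m w col : ℕ → ℕ}

theorem zs_sound (M : Model c r m w col) (z : ℕ → Bool) (lo0 : ℕ → ℕ) (hz : ∀ j < 2*c, z j = true → lo0 j = 0)
    (hz' : ∀ j < 2*c, z j = false → w j ≠ 0) : ∀ t, t ≤ 2*c-1 → ∀ (js : List ℕ) (lo : ℕ → ℕ) (S E : Finset ℕ), 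
    Inv c w lo S (List.range t ++ js) false → (∀ j < t, lo j = lo0 j) → (∀ j < 2*c, lo j ≤ 20) →
    (∀ e, e ∈ E ↔ t ≤ e ∧ e < 2*c ∧ w e ≠ 0) →
    zs (mkCst c) (Wp c m (2*c-1)) (Xp c m (2*c-1)) (toZL c m z lo0 t) (PB (2^(c+1)) (vp c m E)) (toAL c m lo js)
      (lo (2*c-1)) (∑ j ∈ range (2*c), lo j) (P2 (2^(c+1)) (XX c m lo S (fun _ _ => 0))) = true → False := by
  have hn := n64 M
  have hc1 := M.c1
  intro t
  induction t with
  | zero =>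
    intro _ js lo S E I h0 h20 hE h
    have h : search (mkCst c) (Wp c m (2*c-1)) (Xp c m (2*c-1)) 40 (toAL c m lo js) (lo (2*c-1)) false (∑ j ∈ range (2*c), lo j)
      (P2 (2^(c+1)) (XX c m lo S (fun _ _ => 0)) + dead (mkCst c) (PB (2^(c+1)) (vp c m E))) = true := h
    rw [dead_eq M.c5, XX_d] at h
    refine search_sound M _ ?_ ?_ ?_ 40 js lo S false (by simpa using I) h
    · intro f s; unfold ddl; split_ifs <;> norm_num
    · intro f hf hcf s _
      unfold ddl
      rw [if_pos (vp_circ (fun e he hw => (hE e).2 ⟨by omega, he, hw⟩) hcf), if_neg hcf.1]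
    · intro f hf s _ _ hd
      unfold ddl at hd
      by_cases h1 : ∀ g < 2^(c+1), vp c m E f g
      · by_cases h2 : f = 0
        · rw [if_pos h2] at hd; omega
        · exact circ_vp (fun e he => ((hE e).1 he).2) h2 h1
      · rw [if_neg h1] at hd; omega
  | succ t ih =>
    intro ht js lo S E I h0 h20 hE h
    have hp1 : List.Perm (List.range t ++ (t :: js)) (List.range (t+1) ++ js) := by
      rw [List.range_succ]; simp
    have hp2 : List.Perm (t :: (List.range t ++ js)) (List.range (t+1) ++ js) :=
      (List.perm_middle.symm).trans hp1
    have hEt : w t ≠ 0 → PB (2^(c+1)) (vp c m E) ||| vrP c m t = PB (2^(c+1)) (vp c m (insert t E)) := by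
      intro _
      rw [vrP, PB_lor hn]
      refine PB_congr fun f _ g _ => ?_
      unfold vp
      simp only [mem_insert, exists_eq_or_imp]
      rw [or_assoc, or_comm (a := ∃ e ∈ E, _)]
    have hEi : w t ≠ 0 → ∀ e, e ∈ insert t E ↔ t ≤ e ∧ e < 2*c ∧ w e ≠ 0 := by
      intro hwt e
      rw [mem_insert, hE]
      constructor
      · rintro (rfl | h)
        · exact ⟨le_rfl, by omega, hwt⟩
        · exact ⟨by omega, h.2⟩
      · rintro ⟨h1, h2⟩
        rcases Nat.eq_or_lt_of_le h1 with h | h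
        · exact Or.inl h.symm
        · exact Or.inr ⟨h, h2⟩
    cases hzt : z t with
    | false =>
      have hwt := hz' t (by omega) hzt
      have h : BR (zs (mkCst c) (Wp c m (2*c-1)) (Xp c m (2*c-1)) (toZL c m z lo0 t) (PB (2^(c+1)) (vp c m E) ||| vrP c m t)
        (AL.cons (lo0 t) (Wp c m t) (Xp c m t) (toAL c m lo js)) (lo (2*c-1)) (∑ j ∈ range (2*c), lo j) (P2 (2^(c+1)) (XX c m lo S (fun _ _ => 0))))
        _ (z t) = true := h
      rw [hzt, ← h0 t (by omega), hEt hwt] at h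
      exact ih (by omega) (t :: js) lo S (insert t E) (I.perm hp1) (fun j hj => h0 j (by omega)) h20 (hEi hwt) h
    | true =>
      have h : BR _ (check (mkCst c) (∑ j ∈ range (2*c), lo j) (P2 (2^(c+1)) (XX c m lo S (fun _ _ => 0)) + 
          P2 (2^(c+1)) (fun _ s => if s < 10 then 0 else 32) + dead (mkCst c) (PB (2^(c+1)) (vp c m E) ||| sufP c m t)) 
          fun _ => zbr (Wp c m (2*c-1)) (zs (mkCst c) (Wp c m (2*c-1)) (Xp c m (2*c-1)) (toZL c m z lo0 t)) (Wp c m t) (Xp c m t)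
            (vrP c m t) (PB (2^(c+1)) (vp c m E)) (toAL c m lo js) (lo (2*c-1)) (∑ j ∈ range (2*c), lo j) (P2 (2^(c+1)) (XX c m lo S (fun _ _ => 0))))
        (z t) = true := h
      rw [hzt] at h
      have e1 : PB (2^(c+1)) (vp c m E) ||| sufP c m t = PB (2^(c+1)) (vp c m (E ∪ range (t+1))) := by
        rw [sufP, PB_lor hn]
        refine PB_congr fun f _ g _ => ?_
        unfold vp
        simp only [mem_union, or_and_right, exists_or]
        rw [or_assoc]
      have hSsub : S ⊆ range (2*c) := by
        intro j hj
        rw [mem_range]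
        rcases (I.hS j).1 hj with h | ⟨_, h⟩
        · have := I.lt j h; omega
        · omega
      have hc5 := M.c5
      have hsum : ∑ j ∈ range (2*c), lo j ≤ 200 :=
        (sum_le_card_nsmul _ _ 20 (fun j hj => h20 j (mem_range.1 hj))).trans (by simp; omega)
      rw [e1, dead_eq M.c5, XX_d, XX_d] at h
      have h := check_sound M.c5 (XX_good M I.le hSsub I.ex hsum ?_ ?_ ?_) _ h
      · obtain ⟨h1, h2⟩ := BR_and (show BR false _ _ = true from h)
        have hlo : lo t = 0 := by rw [h0 t (by omega)]; exact hz t (by omega) hzt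
        have I' := I.perm hp2
        by_cases hwt : w t = 0
        · have htS : t ∈ S := (I'.hS t).2 (Or.inl (by simp))
          rw [show Nat.sub _ _ = P2 (2^(c+1)) (XX c m lo S (fun _ _ => 0)) - Xp c m t from rfl, XX_erase htS] at h2
          refine ih (by omega) js lo (S.erase t) E (I'.exact (by omega)) (fun j hj => h0 j (by omega)) h20 (fun e => ?_) h2
          rw [hE]
          constructor
          · rintro ⟨h1, h2⟩; exact ⟨by omega, h2⟩
          · rintro ⟨h1, h2, h3⟩
            rcases Nat.eq_or_lt_of_le h1 with h | h
            · subst h; exact absurd hwt h3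
            · exact ⟨h, h2, h3⟩
        · have hpar := I.par t (by omega)
          have hmax := M.wmax t (by omega)
          obtain ⟨dh, hK, b1, b2, b3, b4⟩ := bumped_sound (I.le (2*c-1) (by omega)) (show 2 ≤ w (2*c-1) by omega)
            (I.par (2*c-1) (by omega)) h1
          have Ib := I'.bump (a := 2) (dh := dh) (by omega) rfl b1 b2
          have h20' := h20 (2*c-1) (by omega)
          refine ih (by omega) (t :: js) _ S (insert t E) (Ib.perm List.perm_middle) (fun j hj => ?_) (fun j hj => ?_) (hEi hwt) ?_
          · rw [← h0 j (by omega)]; unfold bmp; rw [if_neg (by omega), if_neg (by omega)]; rfl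
          · have := h20 j hj
            unfold bmp; split_ifs with q1 q2 q2
            · omega
            · rw [q1]; omega
            · rw [q2]; omega
            · omega
          rw [← hK]
          rw [← XX_bump, bmp_sum (by omega), sum_add_distrib, bmp_sum1 (by omega), ← hEt hwt]
          have e1 : bmp (2*c) t 2 dh t = 2 := by unfold bmp; rw [if_pos rfl, if_neg (by omega)]
          have e2 : bmp (2*c) t 2 dh (2*c-1) = dh := by unfold bmp; rw [if_neg (by omega), if_pos rfl, zero_add]
          have e3 : toAL c m (fun i => lo i + bmp (2*c) t 2 dh i) js = toAL c m lo js := by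
            refine toAL_congr fun i hi => ?_
            have := I'.lt i (by simp [hi])
            unfold bmp
            rw [if_neg (fun e : i = t => (List.nodup_cons.1 I'.nd).1 (by rw [← e]; simp [hi])), if_neg (by omega)]
            rfl
          simp only [toAL, e3, e1, e2, hlo, zero_add]
          rfl
      · intro f s; unfold ddl; split_ifs <;> norm_num
      · intro f hf hcf s hs
        unfold ddl
        rw [if_pos (vp_circ (fun e he hw => ?_) hcf), if_neg hcf.1]
        · simp [hs]
        · rw [mem_union, hE, mem_range]; by_cases e < t + 1
          · right; assumption
          · left; exact ⟨by omega, he, hw⟩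
      · intro f hf s _ hs hd
        rw [if_neg (by omega)] at hd; omega
end
end BP

namespace BP
open Finset

theorem bit_eq (f i : ℕ) : bit f i = (f.testBit i).toNat := by
  show (f >>> i) &&& 1 = _
  rw [Nat.and_one_is_mod, Nat.testBit_eq_decide_div_mod_eq, Nat.shiftRight_eq_div_pow]
  rcases Nat.mod_two_eq_zero_or_one (f / 2^i) with h | h <;> simp [h]

theorem xor2 (a b : ℕ) (hb : b ≤ 1) : (a % 2) ^^^ b = (a + b) % 2 := by
  have h : a % 2 < 2 := Nat.mod_lt _ (by norm_num)
  rw [Nat.add_mod]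
  interval_cases a % 2 <;> interval_cases b <;> rfl
theorem inn_zero (m f) : inn m f 0 = bit f 0 ^^^ bit f (lab m 0 + 1) := by
  unfold inn
  rw [range_one, sum_singleton, ← xor2 _ _ (bit_le _ _)]
  congr 1
  have := bit_le f 0
  omega
theorem inn_succ (m f j) : inn m f (j+1) = inn m f j ^^^ bit f (lab m (j+1) + 1) := by
  unfold inn
  rw [sum_range_succ, xor2 _ _ (bit_le _ _), ← add_assoc]

noncomputable def Rp (c : ℕ) (m : ℕ → ℕ) (j : ℕ) : ℕ := pk 1 (fun f => inn m f j) (2^(c+1))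
noncomputable def Jp (c : ℕ) (m : ℕ → ℕ) (j : ℕ) : ℕ := pk 231 (fun f => inn m f j) (2^(c+1))
noncomputable def preEL (c : ℕ) (m : ℕ → ℕ) : ℕ → EL
  | 0 => EL.nil
  | j+1 => EL.cons j (m j) (lab m j) (Rp c m j) (Jp c m j) (Wp c m j) (Xp c m j) (vrP c m j) (sufP c m j) (preEL c m j)

theorem getRow_eq (n c : ℕ) (K : ℕ → ℕ → Bool) : ∀ i l, l < c → getRow (mkRows n c i) l K =
    K (pk 1 (fun f => bit f (i+l+1)) n) (pk 231 (fun f => bit f (i+l+1)) n) := by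
  induction c with
  | zero => intro i l h; omega
  | succ c ih =>
    intro i l h
    cases l with
    | zero => rfl
    | succ l =>
      have : getRow (mkRows n (c+1) i) (l+1) K = getRow (mkRows n c (i+1)) l K := rfl
      rw [this, ih (i+1) l (by omega)]
      rw [show i + 1 + l + 1 = i + (l+1) + 1 by omega]

section
variable {c r : ℕ} {m w col : ℕ → ℕ}

theorem lt2_231 {x : ℕ} (h : x ≤ 1) : x < 2^231 := by
  have : (2:ℕ) ≤ 2^231 := by norm_num
  omega

theorem mkEn3_eq (hc : c ≤ 5) (j u : ℕ) (K : EL → Bool) (hu : u ||| vrP c m j = sufP c m j) :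
    mkEn3 (mkCst c) j (m j) (lab m j) (Rp c m j) (Jp c m j) (Jp c m j ^^^ (mkCst c).ones) (vrw (mkCst c) (Rp c m j) (Jp c m j)) u (preEL c m j) K
     = K (preEL c m (j+1)) := by
  classical
  have hn : 2^(c+1) ≤ 64 := (Nat.pow_le_pow_right (by norm_num) (by omega : c + 1 ≤ 6)).trans (by norm_num)
  have hl : ∀ f, inn m f j < 2 := fun f => by have := inn_le m f j; omega
  have eJ' : Jp c m j ^^^ (mkCst c).ones = pk 231 (fun f => 1 - inn m f j) (2^(c+1)) := by
    show Jp c m j ^^^ pk 231 (fun _ => 1) (2^(c+1)) = _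
    unfold Jp
    rw [pk_xor (by norm_num) (fun f _ => lt2_231 (inn_le m f j)) (fun f _ => lt2_231 le_rfl)]
    refine pk_congr fun f _ => ?_
    have := hl f
    interval_cases inn m f j <;> rfl
  have evr : vrw (mkCst c) (Rp c m j) (Jp c m j) = vrP c m j := by
    show (Rp c m j * pk 231 (fun _ => 1) (2^(c+1))) &&& (pk 231 (fun _ => pk 1 (fun _ => 1) (2^(c+1))) (2^(c+1)) ^^^ (Jp c m j * pk 1 (fun _ => 1) (2^(c+1)))) = _
    unfold Jp vrP PB
    rw [pk_mul', pk_mul]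
    simp only [mul_one, pk_mul']
    unfold Rp
    generalize 2^(c+1) = n at *
    have b1 : ∀ f < n, pk 1 (fun _ => 1) n < 2^231 := fun f _ => (pk1_lt hn (by intros; norm_num)).trans (by norm_num)
    have b2 : ∀ f < n, pk 1 (fun _ => inn m f j) n < 2^231 := fun f _ => (pk1_lt hn (fun g _ => hl f)).trans (by norm_num)
    have b3 : pk 1 (fun g => inn m g j) n < 2^231 := (pk1_lt hn (fun g _ => hl g)).trans (by norm_num)
    rw [pk_xor (by norm_num) b1 b2, pk_land (by norm_num) (fun f _ => ?_) (fun f hf => Nat.xor_lt_two_pow (b1 f hf) (b2 f hf))]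
    · refine pk_congr fun f _ => ?_
      rw [pk_xor (by norm_num) (by intros; norm_num) (fun _ _ => by simpa using hl f)]
      show pk 1 (fun g => inn m g j) _ &&& _ = _
      rw [pk_land (by norm_num) (fun g _ => by simpa using hl g) (fun g _ => Nat.xor_lt_two_pow (by norm_num) (by simpa using hl f))]
      refine pk_congr fun g _ => ?_
      have h1 := hl f
      have h2 := hl g
      unfold vrp
      interval_cases inn m f j <;> interval_cases inn m g j <;> simp
    · exact b3
  unfold mkEn3
  rw [eJ', evr]
  show K (EL.cons j (m j) (lab m j) (Rp c m j) (Jp c m j) (Jp c m j * pk 11 isL 21 + pk 231 (fun f => 1 - inn m f j) (2^(c+1)) * pk 11 (fun s => 1 - isL s) 21)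
    (Jp c m j * pk 11 (fun s => if s < 10 then 0 else 32 * isL s) 21 + pk 231 (fun f => 1 - inn m f j) (2^(c+1)) * pk 11 (fun s => if s < 10 then 0 else 32 * (1 - isL s)) 21)
     (vrP c m j) (u ||| vrP c m j) (preEL c m j)) = _
  have e1 : Jp c m j * pk 11 isL 21 + pk 231 (fun f => 1 - inn m f j) (2^(c+1)) * pk 11 (fun s => 1 - isL s) 21 = Wp c m j := by
    unfold Jp Wp P2
    rw [pk_mul, pk_mul, pk_add]
    refine pk_congr fun f _ => ?_
    rw [pk_mul', pk_mul', pk_add]; rfl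
  have e2 : Jp c m j * pk 11 (fun s => if s < 10 then 0 else 32 * isL s) 21 + pk 231 (fun f => 1 - inn m f j) (2^(c+1)) * pk 11 (fun s => if s < 10 then 0 else 32 * (1 - isL s)) 21 = Xp c m j := by
    unfold Jp Xp P2
    rw [pk_mul, pk_mul, pk_add]
    refine pk_congr fun f _ => ?_
    rw [pk_mul', pk_mul', pk_add]
    refine pk_congr fun s _ => ?_
    unfold Xl Wl
    split_ifs
    · rfl
    · ring
  rw [e1, e2, hu]; rfl

theorem mkEn_eq (hc : c ≤ 5) (j : ℕ) (hl : lab m j < c) (K : EL → Bool) :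
    mkEn (mkCst c) j (m j) (lab m j) (preEL c m j) K = K (preEL c m (j+1)) := by
  have hn : 2^(c+1) ≤ 64 := (Nat.pow_le_pow_right (by norm_num) (by omega : c + 1 ≤ 6)).trans (by norm_num)
  have main : ∀ R J u, R ^^^ pk 1 (fun f => bit f (lab m j + 1)) (2^(c+1)) = Rp c m j →
      J ^^^ pk 231 (fun f => bit f (lab m j + 1)) (2^(c+1)) = Jp c m j → u ||| vrP c m j = sufP c m j →
      mkEn2 (mkCst c) j (m j) (lab m j) (preEL c m j) K R J u = K (preEL c m (j+1)) := by
    intro R J u h1 h2 h3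
    unfold mkEn2
    rw [show (mkCst c).rows = mkRows (2^(c+1)) c 0 from rfl, getRow_eq _ _ _ _ _ hl, zero_add]
    rw [show Nat.xor R _ = Rp c m j from h1, show Nat.xor J _ = Jp c m j from h2]
    exact mkEn3_eq hc j u K h3
  have hb : ∀ f i, bit f i < 2^1 := fun f i => by have := bit_le f i; omega
  have hi : ∀ f i, inn m f i < 2^1 := fun f i => by have := inn_le m f i; omega
  cases j with
  | zero =>
    refine main (pk 1 (fun f => bit f 0) (2^(c+1))) (pk 231 (fun f => bit f 0) (2^(c+1))) 0 ?_ ?_ ?_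
    · rw [pk_xor (by norm_num) (fun f _ => hb f _) (fun f _ => hb f _)]
      exact pk_congr fun f _ => (inn_zero m f).symm
    · rw [pk_xor (by norm_num) (fun f _ => lt2_231 (bit_le f _)) (fun f _ => lt2_231 (bit_le f _))]
      exact pk_congr fun f _ => (inn_zero m f).symm
    · rw [Nat.zero_or]
      unfold vrP sufP
      exact PB_congr fun f _ g _ => by simp
  | succ j =>
    refine main (Rp c m j) (Jp c m j) (sufP c m j) ?_ ?_ ?_
    · unfold Rp
      rw [pk_xor (by norm_num) (fun f _ => hi f _) (fun f _ => hb f _)]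
      exact pk_congr fun f _ => (inn_succ m f j).symm
    · unfold Jp
      rw [pk_xor (by norm_num) (fun f _ => lt2_231 (inn_le m f _)) (fun f _ => lt2_231 (bit_le f _))]
      exact pk_congr fun f _ => (inn_succ m f j).symm
    · unfold vrP sufP
      rw [PB_lor hn]
      refine PB_congr fun f _ g _ => ?_
      rw [range_add_one (n := j+1)]
      simp only [mem_insert, exists_eq_or_imp]
      exact or_comm

theorem openers_card (hlt : ∀ j < 2*c, m j < 2*c) (hinv : ∀ j < 2*c, m (m j) = j) (hne : ∀ j < 2*c, m j ≠ j) :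
    ((range (2*c)).filter fun i => i < m i).card = c := by
  have e := card_filter_add_card_filter_not (s := range (2*c)) (fun i => i < m i)
  have e2 : ((range (2*c)).filter fun i => i < m i).card = ((range (2*c)).filter fun i => ¬ i < m i).card := by
    refine card_bij' (fun i _ => m i) (fun i _ => m i) ?_ ?_ ?_ ?_
    · intro i hi
      simp only [mem_filter, mem_range] at hi ⊢
      exact ⟨hlt i hi.1, by rw [hinv i hi.1]; omega⟩
    · intro i hi
      simp only [mem_filter, mem_range] at hi ⊢
      have := hne i hi.1
      exact ⟨hlt i hi.1, by rw [hinv i hi.1]; omega⟩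
    · intro i hi
      simp only [mem_filter, mem_range] at hi
      exact hinv i hi.1
    · intro i hi
      simp only [mem_filter, mem_range] at hi
      exact hinv i hi.1
  rw [card_range] at e
  omega

theorem lab_lt0 (hlt : ∀ j < 2*c, m j < 2*c) (hinv : ∀ j < 2*c, m (m j) = j) (hne : ∀ j < 2*c, m j ≠ j)
    {j : ℕ} (hj : j < 2*c) : lab m j < c := by
  rw [← openers_card hlt hinv hne]
  unfold lab
  have hm := hlt j hj
  have hne := hne j hj
  have hinv := hinv j hj
  refine card_lt_card (Finset.ssubset_iff.2 ⟨min j (m j), by simp, ?_⟩)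
  intro i hi
  simp only [mem_insert, mem_filter, mem_range] at hi ⊢
  rcases hi with rfl | ⟨h1, h2⟩
  · rcases Nat.lt_or_ge j (m j) with h | h
    · rw [min_eq_left h.le]; exact ⟨hj, h⟩
    · rw [min_eq_right h]; exact ⟨hm, by omega⟩
  · exact ⟨by omega, h2⟩

theorem lab_lt (M : Model c r m w col) {j : ℕ} (hj : j < 2*c) : lab m j < c :=
  lab_lt0 M.m_lt M.m_inv M.m_ne hj

theorem lab_m (M : Model c r m w col) {j : ℕ} (hj : j < 2*c) : lab m (m j) = lab m j := by
  unfold lab; rw [M.m_inv j hj, min_comm]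
theorem lab_open {j : ℕ} (h : j < m j) : lab m j = ((range j).filter fun i => i < m i).card := by
  unfold lab; rw [min_eq_left h.le]
theorem lab_strict {i j : ℕ} (hi : i < m i) (hj : j < m j) (hij : i < j) : lab m i < lab m j := by
  rw [lab_open hi, lab_open hj]
  refine card_lt_card (Finset.ssubset_iff.2 ⟨i, by simp, ?_⟩)
  intro a ha
  simp only [mem_insert, mem_filter, mem_range] at ha ⊢
  rcases ha with rfl | ⟨h1, h2⟩
  · exact ⟨hij, hi⟩
  · exact ⟨by omega, h2⟩

theorem exists_y (M : Model c r m w col) : ∃ i < 2^(c-1), ∀ j < 2*c, colr (2*i) j (m j) (lab m j) = col j := by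
  classical
  have hc1 := M.c1
  set x : ℕ → ℕ := fun l => if ∃ i < 2*c, i < m i ∧ lab m i = l ∧ col i = 1 then 1 else 0 with hx
  have hx2 : ∀ l < c, x l < 2^1 := fun l _ => by rw [hx]; dsimp only; split_ifs <;> norm_num
  have hlt : pk 1 x c < 2^c := by simpa using pk_lt hx2
  have hbit : ∀ l < c, (pk 1 x c / 2^l) % 2 = x l := by
    intro l hl
    have := pk_testBit (by norm_num) hx2 l
    have h2 := hx2 l hl
    rw [Nat.testBit_eq_decide_div_mod_eq] at this
    simp only [Nat.div_one, hl, decide_true, Bool.true_and, Nat.mod_one] at this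
    have h3 : (x l).testBit 0 = decide (x l = 1) := by
      interval_cases x l <;> rfl
    rw [h3, decide_eq_decide] at this
    omega
  have h0m : 0 < m 0 := by have := M.m_ne 0 (by omega); omega
  have heven : pk 1 x c % 2 = 0 := by
    have h := hbit 0 hc1
    rw [pow_zero, Nat.div_one] at h
    rw [h, hx]
    dsimp only
    rw [if_neg]
    rintro ⟨i, hi, him, hl, hcol⟩
    rcases Nat.eq_zero_or_pos i with h | h
    · subst h; rw [M.col0] at hcol; omega
    · have := lab_strict h0m him h; omega
  refine ⟨pk 1 x c / 2, ?_, fun j hj => ?_⟩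
  · have : 2^c = 2 * 2^(c-1) := by rw [← pow_succ']; congr 1; omega
    omega
  · rw [show 2 * (pk 1 x c / 2) = pk 1 x c by omega]
    show (pk 1 x c >>> lab m j + BN 0 1 (Nat.ble (m j) j)) &&& 1 = _
    rw [Nat.and_one_is_mod, Nat.shiftRight_eq_div_pow, Nat.add_mod, hbit _ (lab_lt M hj)]
    have hcm := M.col_m j hj
    have hne := M.m_ne j hj
    have hm := M.m_lt j hj
    have hinv := M.m_inv j hj
    have hop : ∀ i < 2*c, i < m i → x (lab m i) = col i := by
      intro i hi him
      have hci := M.col_m i hi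
      rw [hx]; dsimp only
      by_cases h : col i = 1
      · rw [if_pos ⟨i, hi, him, rfl, h⟩, h]
      · rw [if_neg]
        · omega
        · rintro ⟨i', hi', him', hl, hcol⟩
          rcases lt_trichotomy i i' with h' | h' | h'
          · have := lab_strict him him' h'; omega
          · subst h'; exact h hcol
          · have := lab_strict him' him h'; omega
    rcases Nat.lt_or_ge j (m j) with h | h
    · have hb : Nat.ble (m j) j = false := by
        cases hb : Nat.ble (m j) j
        · rfl
        · have := Nat.le_of_ble_eq_true hb; omega
      rw [hb, hop j hj h]; simp only []; omega
    · have hb : Nat.ble (m j) j = true := Nat.ble_eq_true_of_le h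
      rw [hb, ← lab_m M hj, hop (m j) hm (by omega)]; simp only []; omega
end
end BP

namespace BP
open Finset
section
variable {c r : ℕ} {m w col : ℕ → ℕ}

def odd' (c : ℕ) (col : ℕ → ℕ) (j : ℕ) : Prop := (col j + col ((j+1) % (2*c))) % 2 = 1
def nmn (c : ℕ) (m : ℕ → ℕ) (t : ℕ) : ℕ := if t < 2*c then m t else 2*c
noncomputable def z0 (c : ℕ) (m col : ℕ → ℕ) (j : ℕ) : Bool :=
  BR (BR true false (Nat.ble (m j) (nmn c m (j+1)))) false (Nat.beq ((col j + col ((j+1) % (2*c))) % 2) 1)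
noncomputable def l0 (c : ℕ) (m col : ℕ → ℕ) (j : ℕ) : ℕ :=
  BN (BN 0 2 (Nat.ble (m j) (nmn c m (j+1)))) (BN 1 3 (Nat.beq (m j) ((j+1) % (2*c)))) (Nat.beq ((col j + col ((j+1) % (2*c))) % 2) 1)

theorem arcs_eq (y : ℕ) (hy : ∀ j < 2*c, colr y j (m j) (lab m j) = col j) : ∀ t ≤ 2*c, ∀ K : ZL → Bool,
    arcs y (preEL c m t) (col (t % (2*c))) (nmn c m t) (t % (2*c)) K = K (toZL c m (z0 c m col) (l0 c m col) t) := by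
  intro t
  induction t with
  | zero => intro _ K; rfl
  | succ t ih =>
    intro ht K
    have ih := ih (by omega)
    rw [Nat.mod_eq_of_lt (show t < 2*c by omega)] at ih
    have e : nmn c m t = m t := by unfold nmn; rw [if_pos (by omega)]
    rw [e] at ih
    show arcs y (preEL c m t) (colr y t (m t) (lab m t)) (m t) t (fun tz => 
      BR
      (BR (K (ZL.cons true 0 (Wp c m t) (Xp c m t) (vrP c m t) (sufP c m t) tz)) (K (ZL.cons false 2 (Wp c m t) (Xp c m t) (vrP c m t) (sufP c m t) tz)) (Nat.ble (m t) (nmn c m (t+1))))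
      (K (ZL.cons false (BN 1 3 (Nat.beq (m t) ((t+1) % (2*c)))) (Wp c m t) (Xp c m t) (vrP c m t) (sufP c m t) tz))
      (Nat.beq ((colr y t (m t) (lab m t) + col ((t+1) % (2*c))) &&& 1) 1)) = _
    rw [hy t (by omega), ih, Nat.and_one_is_mod]
    show _ = K (ZL.cons (z0 c m col t) (l0 c m col t) _ _ _ _ _)
    unfold z0 l0
    cases Nat.beq ((col t + col ((t+1) % (2*c))) % 2) 1 <;> cases Nat.ble (m t) (nmn c m (t+1)) <;> rfl

theorem sumZ_eq (z : ℕ → Bool) (lo : ℕ → ℕ) (K : ℕ → ℕ → ℕ → Bool) : ∀ t m0 v X, ∃ m', 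
    sumZ (toZL c m z lo t) m0 v X K = K m' (v + ∑ j ∈ range t, lo j) (X + ∑ j ∈ range t, (lo j * Wp c m j + Xp c m j)) ∧
    ∀ b, m0 ≤ b → (∀ j < t, lo j ≤ b) → m' ≤ b := by
  intro t
  induction t with
  | zero => intro m0 v X; exact ⟨m0, rfl, fun b h _ => h⟩
  | succ t ih =>
    intro m0 v X
    obtain ⟨m', h1, h2⟩ := ih (BN m0 (lo t) (Nat.ble m0 (lo t))) (v + lo t) (X + (lo t * Wp c m t + Xp c m t))
    refine ⟨m', ?_, fun b hb hl => h2 b ?_ fun j hj => hl j (by omega)⟩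
    · rw [sum_range_succ, sum_range_succ, add_comm (∑ j ∈ range t, lo j), add_comm (∑ j ∈ range t, (lo j * Wp c m j + Xp c m j)),
        ← add_assoc, ← add_assoc, ← h1]
      rfl
    · cases Nat.ble m0 (lo t)
      · exact hb
      · exact hl t (by omega)

theorem v0_eq : (mkCst c).v0 = PB (2^(c+1)) (bp c) := by
  show pk 231 (fun f => pk 1 (fun g => v0bit f g) (2^(c+1))) (2^(c+1)) = _
  unfold PB
  refine pk_congr fun f hf => pk_congr fun g hg => ?_
  have key : Nat.land (Nat.shiftRight g 1) (Nat.shiftRight f 1) = Nat.shiftRight g 1 ↔ ∀ i < c, bit g (i+1) ≤ bit f (i+1) := by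
    show (g >>> 1) &&& (f >>> 1) = g >>> 1 ↔ _
    simp only [bit_eq]
    constructor
    · intro h i hi
      have := congrArg (fun x => x.testBit i) h
      simp only [Nat.testBit_and, Nat.testBit_shiftRight] at this
      rw [show 1 + i = i + 1 by omega] at this
      cases h1 : g.testBit (i+1) <;> cases h2 : f.testBit (i+1) <;> simp_all
    · intro h
      apply Nat.eq_of_testBit_eq
      intro i
      rw [Nat.testBit_and, Nat.testBit_shiftRight, Nat.testBit_shiftRight, show 1 + i = i + 1 by omega]
      by_cases hi : i < c
      · have := h i hi
        cases h1 : g.testBit (i+1) <;> cases h2 : f.testBit (i+1) <;> simp_all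
      · rw [Nat.testBit_lt_two_pow (hg.trans_le (Nat.pow_le_pow_right (by norm_num) (by omega : c + 1 ≤ i + 1)))]
        rfl
  unfold bp v0bit
  rw [← key]
  cases h1 : Nat.beq g 0
  · have h1 := Nat.ne_of_beq_eq_false h1
    cases h2 : Nat.beq g f
    · have h2 := Nat.ne_of_beq_eq_false h2
      cases h3 : Nat.beq (Nat.land (Nat.shiftRight g 1) (Nat.shiftRight f 1)) (Nat.shiftRight g 1)
      · have h3 := Nat.ne_of_beq_eq_false h3
        rw [if_pos (Or.inr (Or.inr h3))]
      · have h3 := Nat.eq_of_beq_eq_true h3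
        rw [if_neg]
        rintro (h | h | h)
        · exact h1 h
        · exact h2 h
        · exact h h3
    · have h2 := Nat.eq_of_beq_eq_true h2
      rw [if_pos (Or.inr (Or.inl h2))]
  · have h1 := Nat.eq_of_beq_eq_true h1
    rw [if_pos (Or.inl h1)]

theorem X_eq (lo : ℕ → ℕ) : (mkCst c).X0 + ∑ j ∈ range (2*c), (lo j * Wp c m j + Xp c m j) =
    P2 (2^(c+1)) (XX c m lo (range (2*c)) (fun _ _ => 0)) := by
  have h : ∑ j ∈ range (2*c), lo j * Wp c m j = P2 (2^(c+1)) (fun f s => ∑ j ∈ range (2*c), lo j * Wl m j f s) := by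
    simp only [Wp, P2_mul]
    simp only [P2, pk_sum]
  have h' : ∑ j ∈ range (2*c), Xp c m j = P2 (2^(c+1)) (fun f s => ∑ j ∈ range (2*c), Xl m j f s) := by
    simp only [Xp]
    simp only [P2, pk_sum]
  show P2 (2^(c+1)) (x0 c) + _ = _
  rw [sum_add_distrib, h, h', P2_add, P2_add]
  refine P2_congr fun f _ s _ => ?_
  unfold XX; ring

theorem l0_prop (M : Model c r m w col) {j : ℕ} (hj : j < 2*c) : l0 c m col j ≤ w j ∧ l0 c m col j % 2 = w j % 2 ∧ l0 c m col j ≤ 3 ∧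
    (z0 c m col j = true → l0 c m col j = 0) ∧ (z0 c m col j = false → w j ≠ 0) := by
  have hp := M.par j hj
  have h1 := M.no1 j hj
  have hwp := M.wpos
  have hti := M.tie j
  unfold l0 z0
  cases h : Nat.beq ((col j + col ((j+1) % (2*c))) % 2) 1
  · have h := Nat.ne_of_beq_eq_false h
    cases h2 : Nat.ble (m j) (nmn c m (j+1))
    · refine ⟨by simp, by simp only []; omega, by simp, by simp, by simp⟩
    · have h2 := Nat.le_of_ble_eq_true h2
      unfold nmn at h2
      have hw : w j ≠ 0 := by
        intro h0
        split_ifs at h2 with hh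
        · have := hti hh h0; omega
        · have : j = 2*c-1 := by omega
          subst this; omega
      refine ⟨by simp only []; omega, by simp only []; omega, by simp, by simp, fun _ => hw⟩
  · have h := Nat.eq_of_beq_eq_true h
    cases h2 : Nat.beq (m j) ((j+1) % (2*c))
    · refine ⟨by simp only []; omega, by simp only []; omega, by simp, by simp, fun _ => by omega⟩
    · have := h1 (Nat.eq_of_beq_eq_true h2)
      refine ⟨by simp only []; omega, by simp only []; omega, by simp, by simp, fun _ => by omega⟩

theorem colored_sound (M : Model c r m w col) (y : ℕ) (hy : ∀ j < 2*c, colr y j (m j) (lab m j) = col j)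
    (h : colored (mkCst c) (preEL c m (2*c)) y = true) : False := by
  have hc1 := M.c1
  have hn := n64 M
  unfold colored at h
  have e0 := arcs_eq (c := c) (m := m) (col := col) y hy (2*c) le_rfl
  rw [Nat.mod_self, M.col0, show nmn c m (2*c) = 2*c by unfold nmn; rw [if_neg (lt_irrefl _)]] at e0
  rw [show (mkCst c).nn = 2*c from rfl, e0] at h
  set z := z0 c m col
  set lo := l0 c m col with hlo
  obtain ⟨N, hN⟩ : ∃ N, 2*c = N+1 := ⟨2*c-1, by omega⟩
  have hN' : 2*c-1 = N := by omega
  rw [hN] at h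
  have h : sumZ (toZL c m z lo N) 0 (lo N) ((mkCst c).X0 + (lo N * Wp c m N + Xp c m N)) (fun m' v X =>
      bumped (lo N) m' fun dh h' => zs (mkCst c) (Wp c m N) (Xp c m N) (toZL c m z lo N) ((mkCst c).v0 ||| vrP c m N) AL.nil h' (v + dh) (X + dh * Wp c m N)) = true := h
  obtain ⟨m', e1, hm'⟩ := sumZ_eq (c := c) (m := m) z lo (fun m' v X =>
      bumped (lo N) m' fun dh h' => zs (mkCst c) (Wp c m N) (Xp c m N) (toZL c m z lo N) ((mkCst c).v0 ||| vrP c m N) AL.nil h' (v + dh) (X + dh * Wp c m N)) N 0 (lo N) ((mkCst c).X0 + (lo N * Wp c m N + Xp c m N))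
  rw [e1] at h
  have hNl : N < 2*c := by omega
  have hL : ∀ j < 2*c, lo j ≤ w j ∧ lo j % 2 = w j % 2 ∧ lo j ≤ 3 ∧ (z j = true → lo j = 0) ∧ (z j = false → w j ≠ 0) :=
    fun j hj => l0_prop M hj
  have hmw : m' ≤ w N := hm' _ (Nat.zero_le _) fun j hj => (hL j (by omega)).1.trans (hN' ▸ M.wmax j (by omega))
  have hm3 : m' ≤ 3 := hm' _ (Nat.zero_le _) fun j hj => (hL j (by omega)).2.2.1
  obtain ⟨dh, hz, hle, hdp, -, hmx⟩ := bumped_sound (hL N hNl).1 hmw (hL N hNl).2.1 h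
  have h3 := (hL N hNl).2.2.1
  set L : ℕ → ℕ := fun i => lo i + bmp (2*c) N 0 dh i with hLdef
  have hbN : bmp (2*c) N 0 dh N = dh := by unfold bmp; simp [hN']
  have hbj : ∀ j, j ≠ N → bmp (2*c) N 0 dh j = 0 := by
    intro j hj; unfold bmp; rw [hN', if_neg hj, if_neg hj]
  refine zs_sound M z lo (fun j hj => (hL j hj).2.2.2.1) (fun j hj => (hL j hj).2.2.2.2) N hN'.ge [] L (range (2*c)) {N} ?_ ?_ ?_ ?_ ?_
  · refine ⟨fun j hj => ?_, fun j hj => ?_, fun j hj hj' => absurd (mem_range.2 hj) hj', by simpa using List.nodup_range, ?_, ?_⟩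
    · by_cases hjN : j = N
      · subst hjN; rw [hLdef]; dsimp only; rw [hbN]; exact hle
      · rw [hLdef]; dsimp only; rw [hbj j hjN]; exact (hL j hj).1
    · by_cases hjN : j = N
      · subst hjN; rw [hLdef]; dsimp only; rw [hbN]; have := (hL j hj).2.1; omega
      · rw [hLdef]; dsimp only; rw [hbj j hjN]; exact (hL j hj).2.1
    · intro j hj; simp at hj; omega
    · intro j; simp; omega
  · intro j hj; rw [hLdef]; dsimp only; rw [hbj j (by omega)]; rfl
  · intro j hj
    by_cases hjN : j = N
    · subst hjN; rw [hLdef]; dsimp only; rw [hbN]; omega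
    · rw [hLdef]; dsimp only; rw [hbj j hjN]; have := (hL j hj).2.2.1; omega
  · intro e
    rw [mem_singleton]
    constructor
    · rintro rfl; have := M.wpos; rw [hN'] at this; exact ⟨le_rfl, hNl, by omega⟩
    · omega
  · have ev : (mkCst c).v0 ||| vrP c m N = PB (2^(c+1)) (vp c m {N}) := by
      rw [v0_eq]; unfold vrP; rw [PB_lor hn]
      exact PB_congr fun f _ g _ => by unfold vp; simp
    have es : lo N + ∑ j ∈ range N, lo j + dh = ∑ j ∈ range (2*c), L j := by
      rw [hLdef, sum_add_distrib, bmp_sum1 hNl, hN, sum_range_succ]; ring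
    have eX : (mkCst c).X0 + (lo N * Wp c m N + Xp c m N) + ∑ j ∈ range N, (lo j * Wp c m j + Xp c m j) + dh * Wp c m N =
        P2 (2^(c+1)) (XX c m L (range (2*c)) (fun _ _ => 0)) := by
      rw [hLdef, ← XX_bump, ← X_eq, bmp_sum hNl, hN', hN, sum_range_succ]; ring
    have eh : L (2*c-1) = lo N + dh := by rw [hN', hLdef]; dsimp only; rw [hbN]
    rw [hN', ← es, ← eX, ← ev, ← hN', eh, hN']
    exact hz

theorem allCol_sound (k : Cst) (l : EL) : ∀ n, allCol k l n = true → ∀ i < n, colored k l (2*i) = true := by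
  intro n
  induction n with
  | zero => intro _ i hi; omega
  | succ n ih =>
    intro h i hi
    obtain ⟨h1, h2⟩ := BR_and (A := allCol k l n) (B := colored k l (2*n)) h
    rcases Nat.lt_succ_iff_lt_or_eq.1 hi with h | rfl
    · exact ih h1 i h
    · exact h2

theorem findM_eq (M : Model c r m w col) {j : ℕ} (hj : j < 2*c) (K : ℕ → ℕ → Bool) (F : Bool) : ∀ t ≤ 2*c, 
    findM j K F (preEL c m t) = if m j < t then K (m j) (lab m j) else F := by
  intro t
  induction t with
  | zero => intro _; rfl
  | succ t ih =>
    intro ht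
    show BR (findM j K F (preEL c m t)) (K t (lab m t)) (Nat.beq (m t) j) = _
    cases h : Nat.beq (m t) j
    · have h := Nat.ne_of_beq_eq_false h
      show findM j K F (preEL c m t) = _
      rw [ih (by omega)]
      have : m j ≠ t := by rintro h'; rw [← h', M.m_inv j hj] at h; exact h rfl
      congr 1
      rw [eq_iff_iff]; omega
    · have h := Nat.eq_of_beq_eq_true h
      subst h
      rw [M.m_inv t (by omega), if_pos (by omega), lab_m M (by omega)]

theorem freeM_eq {q : ℕ} : ∀ t, (∀ i < t, m i ≠ q) → freeM q (preEL c m t) = true := by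
  intro t
  induction t with
  | zero => intro _; rfl
  | succ t ih =>
    intro h
    show BR (freeM q (preEL c m t)) false (Nat.beq (m t) q) = true
    have : Nat.beq (m t) q = false := by
      cases h' : Nat.beq (m t) q
      · rfl
      · exact absurd (Nat.eq_of_beq_eq_true h') (h t (by omega))
    rw [this]
    exact ih fun i hi => h i (by omega)

theorem nOpen_eq : ∀ t, nOpen (preEL c m t) = ((range t).filter fun i => i < m i).card := by
  intro t
  induction t with
  | zero => rfl
  | succ t ih =>
    show BN (nOpen (preEL c m t) + 1) (nOpen (preEL c m t)) (Nat.ble (m t) t) = _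
    rw [range_add_one, filter_insert, ih]
    cases h : Nat.ble (m t) t
    · have h : t < m t := by
        by_contra hh
        rw [Nat.ble_eq_true_of_le (by omega)] at h; cases h
      rw [if_pos h, card_insert_of_notMem (by simp)]
    · have h := Nat.le_of_ble_eq_true h
      rw [if_neg (by omega)]

theorem openers_sound (j : ℕ) (pre : EL) (K : ℕ → Bool) {q : ℕ} (hq : j < q) (hf : freeM q pre = true) : ∀ n, q < n →
    openers j pre K n = true → K q = true := by
  intro n
  induction n with
  | zero => intro h; omega
  | succ n ih =>
    intro hn h
    have h : BR (BR (openers j pre K n) (BR false (openers j pre K n) (K n)) (freeM n pre)) true (Nat.ble n j) = true := h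
    have hb : Nat.ble n j = false := by
      cases hb : Nat.ble n j
      · rfl
      · have := Nat.le_of_ble_eq_true hb; omega
    rw [hb] at h
    rcases Nat.lt_succ_iff_lt_or_eq.1 hn with hlt | rfl
    · refine ih hlt ?_
      cases hfn : freeM n pre
      · rw [hfn] at h; exact h
      · rw [hfn] at h
        exact (BR_and h).1
    · rw [hf] at h
      exact (BR_and h).2

theorem gen_sound (M : Model c r m w col) : ∀ q j, j + q = 2*c → gen (mkCst c) q j (preEL c m j) = true → False := by
  intro q
  induction q with
  | zero =>
    intro j hj h
    rw [show j = 2*c by omega] at h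
    obtain ⟨i, hi, hy⟩ := exists_y M
    exact colored_sound M _ hy (allCol_sound _ _ _ h i hi)
  | succ q ih =>
    intro j hj h
    have h : findM j (fun i lab => mkEn (mkCst c) j i lab (preEL c m j) (gen (mkCst c) q (j+1)))
      (openers j (preEL c m j) (fun q' => mkEn (mkCst c) j q' (nOpen (preEL c m j)) (preEL c m j) (gen (mkCst c) q (j+1))) (2*c)) (preEL c m j) = true := h
    rw [findM_eq M (by omega) _ _ _ (by omega)] at h
    have key : mkEn (mkCst c) j (m j) (lab m j) (preEL c m j) (gen (mkCst c) q (j+1)) = true := by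
      split_ifs at h with hm
      · exact h
      · have hne := M.m_ne j (by omega)
        have := openers_sound j _ _ (q := m j) (by omega) (freeM_eq j fun i hi hh => by
          have h1 := M.m_inv i (by omega)
          rw [hh, M.m_inv j (by omega)] at h1; omega) (2*c) (M.m_lt j (by omega)) h
        rw [lab_open (by omega), ← nOpen_eq (c := c)]
        exact this
    rw [mkEn_eq M.c5 j (lab_lt M (by omega))] at key
    exact ih (j+1) (by omega) key

theorem chunk_sound (M : Model c r m w col) (h : chunk c (m 0) = true) : False := by
  have hc1 := M.c1
  have hl : lab m 0 = 0 := by unfold lab; simp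
  have h : mkEn (mkCst c) 0 (m 0) 0 (preEL c m 0) (gen (mkCst c) (2*c-1) 1) = true := h
  have h2 := mkEn_eq (m := m) M.c5 0 (lab_lt M (by omega)) (gen (mkCst c) (2*c-1) 1)
  rw [hl] at h2
  rw [h2] at h
  exact gen_sound M (2*c-1) 1 (by omega) h
end
end BP

namespace BP
theorem ch1_1 : chunk 1 1 = true := by decide +kernel
theorem ch2_1 : chunk 2 1 = true := by decide +kernel
theorem ch2_2 : chunk 2 2 = true := by decide +kernel
theorem ch2_3 : chunk 2 3 = true := by decide +kernel
theorem ch3_1 : chunk 3 1 = true := by decide +kernel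
theorem ch3_2 : chunk 3 2 = true := by decide +kernel
theorem ch3_3 : chunk 3 3 = true := by decide +kernel
theorem ch3_4 : chunk 3 4 = true := by decide +kernel
theorem ch3_5 : chunk 3 5 = true := by decide +kernel
theorem ch4_1 : chunk 4 1 = true := by decide +kernel
theorem ch4_2 : chunk 4 2 = true := by decide +kernel
theorem ch4_3 : chunk 4 3 = true := by decide +kernel
theorem ch4_4 : chunk 4 4 = true := by decide +kernel
theorem ch4_5 : chunk 4 5 = true := by decide +kernel
theorem ch4_6 : chunk 4 6 = true := by decide +kernel
theorem ch4_7 : chunk 4 7 = true := by decide +kernel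
theorem ch5_1 : chunk 5 1 = true := by decide +kernel
theorem ch5_2 : chunk 5 2 = true := by decide +kernel
theorem ch5_3 : chunk 5 3 = true := by decide +kernel
theorem ch5_4 : chunk 5 4 = true := by decide +kernel
theorem ch5_5 : chunk 5 5 = true := by decide +kernel
theorem ch5_6 : chunk 5 6 = true := by decide +kernel
theorem ch5_7 : chunk 5 7 = true := by decide +kernel
theorem ch5_8 : chunk 5 8 = true := by decide +kernel
theorem ch5_9 : chunk 5 9 = true := by decide +kernel
theorem no_model {c r : ℕ} {m w col : ℕ → ℕ} (M : Model c r m w col) : False := by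
  have hc1 := M.c1
  have hc5 := M.c5
  have h1 := M.m_lt 0 (by omega)
  have h2 := M.m_ne 0 (by omega)
  have h3 := chunk_sound M
  generalize m 0 = q at *
  clear M
  have h2 : 1 ≤ q := by omega
  interval_cases c
  · interval_cases q
    · exact h3 ch1_1
  · interval_cases q
    · exact h3 ch2_1
    · exact h3 ch2_2
    · exact h3 ch2_3
  · interval_cases q
    · exact h3 ch3_1
    · exact h3 ch3_2
    · exact h3 ch3_3
    · exact h3 ch3_4
    · exact h3 ch3_5
  · interval_cases q
    · exact h3 ch4_1
    · exact h3 ch4_2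
    · exact h3 ch4_3
    · exact h3 ch4_4
    · exact h3 ch4_5
    · exact h3 ch4_6
    · exact h3 ch4_7
  · interval_cases q
    · exact h3 ch5_1
    · exact h3 ch5_2
    · exact h3 ch5_3
    · exact h3 ch5_4
    · exact h3 ch5_5
    · exact h3 ch5_6
    · exact h3 ch5_7
    · exact h3 ch5_8
    · exact h3 ch5_9
end BP

namespace BP
open SimpleGraph
section
variable {V : Type*} [Fintype V] {G : SimpleGraph V}

def EvenSet (F : Set (Sym2 V)) : Prop := ∀ a : V, Even {b | s(a, b) ∈ F}.ncard
def MinEven (G : SimpleGraph V) (F : Set (Sym2 V)) : Prop :=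
  F ⊆ G.edgeSet ∧ EvenSet F ∧ F.Nonempty ∧ ∀ F' ⊆ F, EvenSet F' → F'.Nonempty → F' = F

theorem exists_cycle_of_even {F : Set (Sym2 V)} (hF : F ⊆ G.edgeSet) (he : EvenSet F) (hne : F.Nonempty) :
    ∃ k ≥ 3, ∃ H : G.Subgraph, H.edgeSet ⊆ F ∧ Nonempty (H.coe ≃g cycleGraph k) := by
  classical
  set G' := fromEdgeSet F with hG'
  have hadj : ∀ a b, G'.Adj a b ↔ s(a, b) ∈ F := by
    intro a b
    rw [hG', fromEdgeSet_adj]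
    exact ⟨fun h => h.1, fun h => ⟨h, (hF h : G.Adj a b).ne⟩⟩
  have hle : G' ≤ G := fun a b h => hF ((hadj a b).1 h)
  by_cases hac : G'.IsAcyclic
  · exfalso
    obtain ⟨e, heF⟩ := hne
    induction e with
    | h x y =>
    have hxy : G'.Adj x y := (hadj x y).2 heF
    have : Nonempty V := ⟨x⟩
    have ⟨u, v, p, hp, hmax⟩ := Walk.exists_isPath_forall_isPath_length_le_length G'
    have hnil : ¬p.Nil := by
      have h1 := hmax _ _ hxy.toWalk (by simpa using hxy.ne)
      intro hn
      have := Walk.length_eq_zero_iff.2 hn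
      simp at h1
      omega
    have key : {b | s(u, b) ∈ F} = {p.snd} := by
      ext w
      simp only [Set.mem_ofPred_eq, Set.mem_singleton_iff, ← hadj]
      constructor
      · intro hw
        apply hac.eq_snd_of_adj_start hp hw
        have : ¬(p.cons hw.symm).IsPath := by grind [Walk.length_cons]
        grind [hp.cons]
      · rintro rfl
        exact p.adj_snd hnil
    have := he u
    rw [key, Set.ncard_singleton] at this
    exact absurd this (by decide)
  · rw [isAcyclic_iff_free_cycleGraph] at hac
    push Not at hac
    obtain ⟨k, hk, hc⟩ := hac
    obtain ⟨f⟩ := hc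
    set f' : Copy (cycleGraph k) G := (Copy.ofLE _ _ hle).comp f
    refine ⟨k, hk, f'.toSubgraph, ?_, ⟨f'.isoToSubgraph.symm⟩⟩
    intro e he
    induction e with
    | h x y =>
    have he : f'.toSubgraph.Adj x y := he
    rw [Subgraph.map_adj] at he
    obtain ⟨a, b, hab, rfl, rfl⟩ := he
    exact (hadj _ _).1 (f.toHom.map_adj hab)

theorem cyc_verts {k : ℕ} {H : G.Subgraph} (φ : H.coe ≃g cycleGraph k) : H.verts.ncard = k := by
  have := Nat.card_congr φ.toEquiv
  rw [Nat.card_fin] at this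
  exact this

theorem cyc_nbr {k : ℕ} (hk : 3 ≤ k) {H : G.Subgraph} (φ : H.coe ≃g cycleGraph k) {a : V} (ha : a ∈ H.verts) :
    {b | H.Adj a b}.ncard = 2 := by
  classical
  obtain ⟨n, rfl⟩ : ∃ n, k = n + 3 := ⟨k-3, by omega⟩
  have h1 := cycleGraph_degree_three_le (v := φ ⟨a, ha⟩)
  rw [φ.degree_eq, Subgraph.coe_degree] at h1
  rw [← h1, Subgraph.degree, ← Nat.card_eq_fintype_card]
  rfl

theorem cyc_min {k : ℕ} (hk : 3 ≤ k) {H : G.Subgraph} (φ : H.coe ≃g cycleGraph k) : MinEven G H.edgeSet := by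
  have hd := fun a (ha : a ∈ H.verts) => cyc_nbr hk φ ha
  have hmem : ∀ a b, s(a, b) ∈ H.edgeSet ↔ H.Adj a b := fun a b => Subgraph.mem_edgeSet
  obtain ⟨n, rfl⟩ : ∃ n, k = n + 3 := ⟨k-3, by omega⟩
  refine ⟨H.edgeSet_subset, ?_, ?_, ?_⟩
  · intro a
    simp only [hmem]
    by_cases ha : a ∈ H.verts
    · rw [hd a ha]; decide
    · have : {b | H.Adj a b} = ∅ := by
        ext b; simp only [Set.mem_ofPred_eq, Set.mem_empty_iff_false, iff_false]
        intro h; exact ha h.fst_mem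
      rw [this, Set.ncard_empty]; decide
  · have h0 := (φ.symm 0).2
    have := hd _ h0
    obtain ⟨b, hb⟩ := Set.nonempty_of_ncard_ne_zero (by rw [this]; norm_num)
    exact ⟨s(_, b), (hmem _ _).2 hb⟩
  · intro F' hF' hev hne
    have full : ∀ a b, s(a, b) ∈ F' → ∀ b', H.Adj a b' → s(a, b') ∈ F' := by
      intro a b hab b' hb'
      have h1 : {b | s(a, b) ∈ F'} ⊆ {b | H.Adj a b} := fun b hb => (hmem a b).1 (hF' hb)
      have h2 := Set.ncard_le_ncard h1
      have h3 : 0 < {b | s(a, b) ∈ F'}.ncard := (Set.ncard_pos).2 ⟨b, hab⟩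
      obtain ⟨q, hq⟩ := hev a
      rw [hd a hb'.fst_mem] at h2
      have h4 := Set.eq_of_subset_of_ncard_le h1 (by rw [hd a hb'.fst_mem]; omega)
      have : b' ∈ {b | s(a, b) ∈ F'} := by rw [h4]; exact hb'
      exact this
    obtain ⟨e, heF⟩ := hne
    induction e with
    | h x y =>
    have hconn : H.coe.Connected := φ.symm.connected_iff.1 cycleGraph_connected
    have hxv : x ∈ H.verts := ((hmem _ _).1 (hF' heF)).fst_mem
    have all : ∀ z : H.verts, ∃ b, s((z : V), b) ∈ F' := by
      intro z
      obtain ⟨p⟩ := hconn.preconnected ⟨x, hxv⟩ z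
      generalize hx' : (⟨x, hxv⟩ : H.verts) = x' at p
      have hx2 : ∃ b, s((x' : V), b) ∈ F' := by rw [← hx']; exact ⟨y, heF⟩
      clear hx'
      induction p with
      | nil => exact hx2
      | cons h p ih =>
        refine ih ?_
        obtain ⟨b, hb⟩ := hx2
        have := full _ _ hb _ h
        rw [Sym2.eq_swap] at this
        exact ⟨_, this⟩
    apply Set.Subset.antisymm hF'
    intro e he
    induction e with
    | h a b =>
    have hab := (hmem a b).1 he
    obtain ⟨b', hb'⟩ := all ⟨a, hab.fst_mem⟩
    exact full _ _ hb' _ hab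

theorem cyc_edges {k : ℕ} (hk : 3 ≤ k) {H : G.Subgraph} (φ : H.coe ≃g cycleGraph k) : H.edgeSet.ncard = k := by
  classical
  have h1 := H.spanningCoe.sum_degrees_eq_twice_card_edges
  have h2 : H.edgeSet.ncard = H.spanningCoe.edgeFinset.card := by
    rw [← Subgraph.edgeSet_spanningCoe, ← Set.ncard_coe_finset, coe_edgeFinset]
  have h3 : ∀ a, H.spanningCoe.degree a = if a ∈ H.verts then 2 else 0 := by
    intro a
    have e : H.spanningCoe.degree a = {b | H.Adj a b}.ncard := by
      rw [← card_neighborSet_eq_degree, ← Nat.card_eq_fintype_card]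
      rfl
    rw [e]
    split_ifs with ha
    · exact cyc_nbr hk φ ha
    · have : {b | H.Adj a b} = ∅ := by
        ext b; simp only [Set.mem_ofPred_eq, Set.mem_empty_iff_false, iff_false]
        intro h; exact ha h.fst_mem
      rw [this, Set.ncard_empty]
  have h4 := cyc_verts φ
  simp only [h3] at h1
  rw [← Finset.sum_filter, Finset.sum_const, smul_eq_mul, ← h2] at h1
  have h5 : (Finset.univ.filter fun a => a ∈ H.verts).card = H.verts.ncard := by
    rw [← Set.ncard_coe_finset]; congr 1; ext; simp
  omega

theorem cyc_inj {k k' : ℕ} (hk : 3 ≤ k) (hk' : 3 ≤ k') {H H' : G.Subgraph} (φ : H.coe ≃g cycleGraph k)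
    (φ' : H'.coe ≃g cycleGraph k') (h : H.edgeSet = H'.edgeSet) : H = H' := by
  have hadj : ∀ a b, H.Adj a b ↔ H'.Adj a b := fun a b => by
    rw [← Subgraph.mem_edgeSet, h, Subgraph.mem_edgeSet]
  ext a b
  · constructor
    · intro ha
      obtain ⟨b, hb⟩ := Set.nonempty_of_ncard_ne_zero (s := {b | H.Adj a b}) (by rw [cyc_nbr hk φ ha]; norm_num)
      exact ((hadj a b).1 hb).fst_mem
    · intro ha
      obtain ⟨b, hb⟩ := Set.nonempty_of_ncard_ne_zero (s := {b | H'.Adj a b}) (by rw [cyc_nbr hk' φ' ha]; norm_num)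
      exact ((hadj a b).2 hb).fst_mem
  · exact hadj a b

theorem min_cyc {F : Set (Sym2 V)} (hF : MinEven G F) : ∃ k ≥ 3, ∃ H : G.Subgraph, H.edgeSet = F ∧ Nonempty (H.coe ≃g cycleGraph k) := by
  obtain ⟨h1, h2, h3, h4⟩ := hF
  obtain ⟨k, hk, H, hH, ⟨φ⟩⟩ := exists_cycle_of_even h1 h2 h3
  have := cyc_min hk φ
  exact ⟨k, hk, H, h4 _ hH this.2.1 this.2.2.1, ⟨φ⟩⟩

theorem cyc_even {k : ℕ} (hk : 3 ≤ k) {H : G.Subgraph} (φ : H.coe ≃g cycleGraph k) (hG : G.Colorable 2) : Even k := by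
  by_contra ho
  rw [Nat.not_even_iff_odd] at ho
  have h1 := chromaticNumber_cycleGraph_of_odd k (by omega) ho
  have h2 : (cycleGraph k).Colorable 2 := hG.of_hom (H.hom.comp φ.symm.toHom)
  have := h2.chromaticNumber_le
  rw [h1] at this
  exact absurd this (by decide)

theorem count_eq {k : ℕ} (hk : 3 ≤ k) : {H : G.Subgraph | Nonempty (H.coe ≃g cycleGraph k)}.ncard = {F | MinEven G F ∧ F.ncard = k}.ncard := by
  have : {F | MinEven G F ∧ F.ncard = k} = (fun H : G.Subgraph => H.edgeSet) '' {H : G.Subgraph | Nonempty (H.coe ≃g cycleGraph k)} := by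
    ext F
    simp only [Set.mem_ofPred_eq, Set.mem_image]
    constructor
    · rintro ⟨h1, h2⟩
      obtain ⟨k', hk', H, rfl, ⟨φ⟩⟩ := min_cyc h1
      have := cyc_edges hk' φ
      have : k' = k := by omega
      subst this
      exact ⟨H, ⟨φ⟩, rfl⟩
    · rintro ⟨H, ⟨φ⟩, rfl⟩
      exact ⟨cyc_min hk φ, cyc_edges hk φ⟩
  rw [this, Set.InjOn.ncard_image]
  rintro H ⟨φ⟩ H' ⟨φ'⟩ h
  exact cyc_inj hk hk φ φ' h

theorem min_bounds (hG : G.Colorable 2) {F : Set (Sym2 V)} (hF : MinEven G F) : Even F.ncard ∧ 4 ≤ F.ncard ∧ F.ncard ≤ Fintype.card V := by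
  obtain ⟨k, hk, H, rfl, ⟨φ⟩⟩ := min_cyc hF
  have h1 := cyc_edges hk φ
  have h2 := cyc_even hk φ hG
  have h3 := cyc_verts φ
  have h4 : H.verts.ncard ≤ Fintype.card V := by
    rw [← Nat.card_eq_fintype_card]; exact Set.ncard_le_card _
  rw [h1]
  obtain ⟨q, hq⟩ := h2
  exact ⟨⟨q, hq⟩, by omega, by omega⟩
end
end BP

namespace BP
open SimpleGraph Finset
section
variable {V : Type*} {G : SimpleGraph V} {v : ℕ} {u : ℕ → V}

structure Lab (G : SimpleGraph V) (v : ℕ) (u : ℕ → V) : Prop where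
  v4 : 4 ≤ v
  per : ∀ x, u (x+v) = u x
  inj : ∀ x < v, ∀ y < v, u x = u y → x = y
  surj : ∀ a, ∃ x < v, u x = a
  adj : ∀ x, G.Adj (u x) (u (x+1))

def CE (u : ℕ → V) : Set (Sym2 V) := Set.range fun z => s(u z, u (z+1))
def ch (G : SimpleGraph V) (u : ℕ → V) (x y : ℕ) : Prop := G.Adj (u x) (u y) ∧ s(u x, u y) ∉ CE u
def isP (G : SimpleGraph V) (u : ℕ → V) (x : ℕ) : Prop := ∃ y, ch G u x y
def nx (v x : ℕ) : ℕ := if x + 1 < v then x + 1 else 0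
def pr (v x : ℕ) : ℕ := if x = 0 then v - 1 else x - 1

theorem Lab.per_mul (L : Lab G v u) (x t : ℕ) : u (x + t*v) = u x := by
  induction t with
  | zero => simp
  | succ t ih => rw [show x + (t+1)*v = x + t*v + v by ring, L.per, ih]
theorem Lab.mod (L : Lab G v u) (x : ℕ) : u (x % v) = u x := by
  conv_rhs => rw [← Nat.mod_add_div x v, mul_comm]
  rw [L.per_mul]
theorem Lab.nx (L : Lab G v u) {x : ℕ} (hx : x < v) : u (x+1) = u (nx v x) := by
  unfold BP.nx
  split_ifs with h
  · rfl
  · rw [show x + 1 = 0 + v by omega, L.per]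
theorem Lab.nx_lt (L : Lab G v u) {x : ℕ} : BP.nx v x < v := by
  have := L.v4
  unfold BP.nx; split_ifs <;> omega
theorem Lab.pr_lt (L : Lab G v u) {x : ℕ} (hx : x < v) : BP.pr v x < v := by
  have := L.v4
  unfold BP.pr; split_ifs <;> omega
theorem Lab.pr (L : Lab G v u) {x : ℕ} (hx : x < v) : u (pr v x + 1) = u x := by
  have := L.v4
  unfold BP.pr
  split_ifs with h
  · subst h; rw [show v - 1 + 1 = 0 + v by omega, L.per]
  · congr 1; omega
theorem Lab.nx_pr {x : ℕ} (hx : x < v) : BP.nx v (BP.pr v x) = x := by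
  unfold BP.nx BP.pr
  by_cases h : x = 0
  · subst h
    rw [if_pos rfl, if_neg (by omega)]
  · rw [if_neg h, if_pos (by omega)]; omega
theorem Lab.pr_nx {x : ℕ} (hx : x < v) : BP.pr v (BP.nx v x) = x := by
  unfold BP.nx BP.pr
  by_cases h : x + 1 < v
  · simp [h]
  · simp [h]; omega
theorem Lab.mem_CE (L : Lab G v u) {e : Sym2 V} : e ∈ CE u ↔ ∃ x < v, e = s(u x, u (x+1)) := by
  constructor
  · rintro ⟨z, rfl⟩
    refine ⟨z % v, Nat.mod_lt _ (by have := L.v4; omega), ?_⟩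
    have h := L.per_mul (z % v + 1) (z / v)
    rw [show z % v + 1 + z / v * v = z + 1 by have := Nat.mod_add_div z v; rw [mul_comm] at this; omega] at h
    rw [L.mod, ← h]
  · rintro ⟨x, _, rfl⟩; exact ⟨x, rfl⟩
theorem Lab.E_inj (L : Lab G v u) {x y : ℕ} (hx : x < v) (hy : y < v) (h : s(u x, u (x+1)) = s(u y, u (y+1))) : x = y := by
  have := L.v4
  rw [L.nx hx, L.nx hy] at h
  have hnx := L.nx_lt (x := x)
  have hny := L.nx_lt (x := y)
  rw [Sym2.eq_iff] at h
  rcases h with ⟨h, _⟩ | ⟨h1, h2⟩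
  · exact L.inj _ hx _ hy h
  · have h1 := L.inj _ hx _ hny h1
    have h2 := L.inj _ hnx _ hy h2
    unfold BP.nx at h1 h2
    split_ifs at h1 h2 <;> omega

theorem Lab.rot (L : Lab G v u) (t : ℕ) : Lab G v (fun x => u (x+t)) := by
  have hv : 0 < v := by have := L.v4; omega
  have hadd : ∀ x y, x < v → y < v → u (x+t) = u (y+t) → x = y := by
    intro x y hx hy h
    rw [← L.mod (x+t), ← L.mod (y+t)] at h
    have h := L.inj _ (Nat.mod_lt _ hv) _ (Nat.mod_lt _ hv) h
    have h : x + t ≡ y + t [MOD v] := h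
    have h := Nat.ModEq.add_right_cancel' t h
    have h : x % v = y % v := h
    rwa [Nat.mod_eq_of_lt hx, Nat.mod_eq_of_lt hy] at h
  refine ⟨L.v4, fun x => ?_, fun x hx y hy h => hadd x y hx hy h, fun a => ?_, fun x => ?_⟩
  · rw [show x + v + t = x + t + v by ring, L.per]
  · obtain ⟨x, hx, rfl⟩ := L.surj a
    refine ⟨(x + t*v - t) % v, Nat.mod_lt _ hv, ?_⟩
    have hle : t ≤ t * v := Nat.le_mul_of_pos_right _ hv
    rw [← L.mod]
    have : ((x + t*v - t) % v + t) % v = x % v := by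
      rw [Nat.mod_add_mod, show x + t*v - t + t = x + t*v by omega, Nat.add_mul_mod_self_right]
    rw [this, L.mod]
  · have := L.adj (x+t)
    rwa [show x + t + 1 = x + 1 + t by ring] at this
theorem Lab.CE_rot (L : Lab G v u) (t : ℕ) : CE (fun x => u (x+t)) = CE u := by
  have hv : 0 < v := by have := L.v4; omega
  have hle : t ≤ t * v := Nat.le_mul_of_pos_right _ hv
  ext e; constructor
  · rintro ⟨z, rfl⟩; exact ⟨z+t, by simp only []; rw [show z + t + 1 = z + 1 + t by ring]⟩
  · rintro ⟨z, rfl⟩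
    refine ⟨z + t*v - t, ?_⟩
    simp only []
    rw [show z + t*v - t + t = z + t*v by omega, show z + t*v - t + 1 + t = z + 1 + t*v by omega, L.per_mul, L.per_mul]
theorem Lab.isP_rot (L : Lab G v u) (t x : ℕ) : isP G (fun x => u (x+t)) x ↔ isP G u (x+t) := by
  have hv : 0 < v := by have := L.v4; omega
  have hle : t ≤ t * v := Nat.le_mul_of_pos_right _ hv
  unfold isP ch
  rw [L.CE_rot]
  constructor
  · rintro ⟨y, h⟩; exact ⟨y+t, h⟩
  · rintro ⟨y, h⟩
    refine ⟨y + t*v - t, ?_⟩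
    show G.Adj (u (x+t)) (u (y+t*v-t+t)) ∧ s(u (x+t), u (y+t*v-t+t)) ∉ CE u
    rw [show y + t*v - t + t = y + t*v by omega, L.per_mul]; exact h
theorem Lab.isP_per (L : Lab G v u) (x : ℕ) : isP G u (x+v) ↔ isP G u x := by
  unfold isP ch; rw [L.per]

theorem Lab.best (L : Lab G v u) (h0 : isP G u 0) : ∃ u' ℓ, Lab G v u' ∧ isP G u' 0 ∧ (∀ x < v, isP G u' x → x + ℓ ≤ v) ∧
    ∀ a b, a < b → b < v → isP G u' b → (∀ x, a < x → x < b → ¬ isP G u' x) → b - a ≤ ℓ := by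
  classical
  have hv : 0 < v := by have := L.v4; omega
  let Q : ℕ → Prop := fun ℓ => ∃ u', Lab G v u' ∧ isP G u' 0 ∧ ∀ x < v, isP G u' x → x + ℓ ≤ v
  have hQ0 : Q 0 := ⟨u, L, h0, fun x hx _ => by omega⟩
  have hQv : ∀ ℓ, Q ℓ → ℓ ≤ v := by
    rintro ℓ ⟨u', L', h1, h2⟩
    have := h2 0 hv h1; omega
  have hs := Nat.findGreatest_spec (P := Q) (Nat.zero_le v) hQ0
  obtain ⟨u', L', h1, h2⟩ := hs
  refine ⟨u', Nat.findGreatest Q v, L', h1, h2, fun a b hab hb hPb hno => ?_⟩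
  have hq : Q (b - a) := by
    refine ⟨_, L'.rot b, ?_, fun x hx hPx => ?_⟩
    · rw [L'.isP_rot, zero_add]; exact hPb
    · rw [L'.isP_rot] at hPx
      by_contra hc
      have : x + b = (x + b - v) + v := by omega
      rw [this, L'.isP_per] at hPx
      exact hno _ (by omega) (by omega) hPx
  exact Nat.le_findGreatest (hQv _ hq) hq
end
end BP

namespace BP
open SimpleGraph Finset

structure Slots (n v : ℕ) (R : ℕ → ℕ → Prop) (p q m : ℕ → ℕ) : Prop where
  pl : ∀ j < n, p j < v
  ql : ∀ j < n, q j < v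
  rel : ∀ j < n, R (p j) (q j)
  comp : ∀ x < v, ∀ y < v, R x y → ∃ j < n, p j = x ∧ q j = y
  ord : ∀ j j', j < j' → j' < n → p j < p j' ∨ (p j = p j' ∧ q j' < q j)
  m_lt : ∀ j < n, m j < n
  mp : ∀ j < n, p (m j) = q j
  mq : ∀ j < n, q (m j) = p j

theorem slots (v : ℕ) (R : ℕ → ℕ → Prop) (sym : ∀ x y, R x y → R y x) (S : Finset (ℕ × ℕ))
    (hS : ∀ d, d ∈ S ↔ d.1 < v ∧ d.2 < v ∧ R d.1 d.2) : ∃ p q m, Slots S.card v R p q m := by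
  classical
  let key : ℕ × ℕ → ℕ := fun d => d.1 * v + (v - 1 - d.2)
  have k1 : ∀ d ∈ S, key d / v = d.1 := by
    intro d hd; have := (hS d).1 hd
    show (d.1 * v + (v - 1 - d.2)) / v = d.1
    rw [add_comm, Nat.add_mul_div_right _ _ (by omega), Nat.div_eq_of_lt (by omega), zero_add]
  have k2 : ∀ d ∈ S, v - 1 - key d % v = d.2 := by
    intro d hd; have := (hS d).1 hd
    show v - 1 - (d.1 * v + (v - 1 - d.2)) % v = d.2
    rw [add_comm, Nat.add_mul_mod_self_right, Nat.mod_eq_of_lt (by omega)]; omega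
  have kinj : Set.InjOn key S := by
    intro d hd d' hd' h
    have a := k1 d hd; have b := k2 d hd
    rw [h] at a b
    exact Prod.ext (a.symm.trans (k1 d' hd')) (b.symm.trans (k2 d' hd'))
  have hcard : (S.image key).card = S.card := card_image_of_injOn kinj
  let g := (S.image key).orderEmbOfFin hcard
  let K : ℕ → ℕ := fun j => if h : j < S.card then g ⟨j, h⟩ else 0
  have hK : ∀ j < S.card, ∃ d ∈ S, K j = key d := by
    intro j hj
    have := (S.image key).orderEmbOfFin_mem hcard ⟨j, hj⟩
    obtain ⟨d, hd, h⟩ := mem_image.1 this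
    exact ⟨d, hd, by simp only [K, dif_pos hj]; exact h.symm⟩
  have hmem : ∀ j < S.card, (K j / v, v - 1 - K j % v) ∈ S := by
    intro j hj
    obtain ⟨d, hd, h⟩ := hK j hj
    rw [h, k1 d hd, k2 d hd]; exact hd
  have hcomp : ∀ d ∈ S, ∃ j < S.card, K j / v = d.1 ∧ v - 1 - K j % v = d.2 := by
    intro d hd
    have : key d ∈ Set.range g := by
      rw [range_orderEmbOfFin]; exact mem_image_of_mem _ hd
    obtain ⟨i, hi⟩ := this
    refine ⟨i, i.2, ?_⟩
    have : K i = key d := by simp only [K, dif_pos i.2]; exact hi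
    rw [this]; exact ⟨k1 d hd, k2 d hd⟩
  have hm : ∀ j, ∃ j', j < S.card → j' < S.card ∧ K j' / v = v - 1 - K j % v ∧ v - 1 - K j' % v = K j / v := by
    intro j
    by_cases hj : j < S.card
    · have h := (hS _).1 (hmem j hj)
      obtain ⟨j', h1, h2, h3⟩ := hcomp (v - 1 - K j % v, K j / v) ((hS _).2 ⟨h.2.1, h.1, sym _ _ h.2.2⟩)
      exact ⟨j', fun _ => ⟨h1, h2, h3⟩⟩
    · exact ⟨0, fun h => absurd h hj⟩
  choose m hm using hm
  refine ⟨fun j => K j / v, fun j => v - 1 - K j % v, m, ?_⟩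
  refine ⟨fun j hj => ((hS _).1 (hmem j hj)).1, fun j hj => ((hS _).1 (hmem j hj)).2.1, fun j hj => ((hS _).1 (hmem j hj)).2.2,
    fun x hx y hy hr => hcomp (x, y) ((hS _).2 ⟨hx, hy, hr⟩), fun j j' hjj hj' => ?_, fun j hj => (hm j hj).1,
    fun j hj => (hm j hj).2.1, fun j hj => (hm j hj).2.2⟩
  have hlt : K j < K j' := by
    simp only [K, dif_pos hj', dif_pos (hjj.trans hj')]
    exact g.strictMono hjj
  have hv : 0 < v := by have := (hS _).1 (hmem j' hj'); omega
  have h1 := Nat.div_le_div_right (c := v) hlt.le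
  rcases h1.lt_or_eq with h | h
  · exact Or.inl h
  · refine Or.inr ⟨h, ?_⟩
    show v - 1 - K j' % v < v - 1 - K j % v
    have a := Nat.div_add_mod (K j) v
    have b := Nat.div_add_mod (K j') v
    have := Nat.mod_lt (K j') hv
    rw [h] at a
    omega

section
variable {V : Type*} {G : SimpleGraph V} {v : ℕ} {u : ℕ → V}

theorem Lab.start [Fintype V] (h4 : 4 ≤ Fintype.card V) {H : G.Subgraph} (φ : H.coe ≃g cycleGraph (Fintype.card V)) :
    ∃ u, Lab G (Fintype.card V) u := by
  classical
  have hv := cyc_verts φ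
  have huniv : ∀ a, a ∈ H.verts := by
    have : H.verts = Set.univ := by
      apply Set.eq_of_subset_of_ncard_le (Set.subset_univ _)
      rw [Set.ncard_univ, Nat.card_eq_fintype_card, hv]
    intro a; rw [this]; trivial
  generalize hn : Fintype.card V = n at *
  obtain ⟨k, rfl⟩ : ∃ k, n = k + 3 := ⟨n-3, by omega⟩
  let e : ℕ → Fin (k+3) := fun x => ⟨x % (k+3), Nat.mod_lt _ (by omega)⟩
  refine ⟨fun x => (φ.symm (e x) : V), by omega, fun x => ?_, fun x hx y hy h => ?_, fun a => ?_, fun x => ?_⟩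
  · simp only [e, Nat.add_mod_right]
  · have h := φ.symm.injective (Subtype.ext h)
    have h := Fin.ext_iff.1 h
    simp only [e] at h
    rwa [Nat.mod_eq_of_lt hx, Nat.mod_eq_of_lt hy] at h
  · refine ⟨φ ⟨a, huniv a⟩, (φ ⟨a, huniv a⟩).2, ?_⟩
    have : e (φ ⟨a, huniv a⟩) = φ ⟨a, huniv a⟩ := Fin.ext (Nat.mod_eq_of_lt (φ ⟨a, huniv a⟩).2)
    simp only [this, RelIso.symm_apply_apply]
  · apply H.adj_sub
    have : (cycleGraph (k+3)).Adj (e x) (e (x+1)) := by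
      rw [cycleGraph_adj]
      right
      have : e (x+1) = e x + 1 := by
        apply Fin.ext
        simp only [e, Fin.val_add]
        simp
      rw [this]; simp
    exact φ.symm.map_adj_iff.2 this

theorem ch_symm {x y : ℕ} (h : ch G u x y) : ch G u y x := ⟨h.1.symm, by rw [Sym2.eq_swap]; exact h.2⟩

theorem Lab.CE_card (L : Lab G v u) : (CE u).ncard = v := by
  have : CE u = (fun x => s(u x, u (x+1))) '' (Finset.range v : Set ℕ) := by
    ext e; rw [L.mem_CE]; simp only [Set.mem_image, mem_coe, mem_range]
    exact ⟨fun ⟨x, a, b⟩ => ⟨x, a, b.symm⟩, fun ⟨x, a, b⟩ => ⟨x, a, b.symm⟩⟩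
  rw [this, Set.ncard_image_of_injOn, Set.ncard_coe_finset, card_range]
  intro x hx y hy h
  simp only [mem_coe, mem_range] at hx hy
  exact L.E_inj hx hy h
theorem Lab.CE_sub (L : Lab G v u) : CE u ⊆ G.edgeSet := by
  rintro _ ⟨x, rfl⟩; exact L.adj x

open Classical in
theorem Lab.darts [Fintype V] (L : Lab G v u) {c : ℕ} (hc : G.edgeSet.ncard = v + c) :
    ((range v ×ˢ range v).filter fun d => ch G u d.1 d.2).card = 2*c := by
  let X : SimpleGraph V := G.deleteEdges (CE u)
  have hX : X.edgeSet = G.edgeSet \ CE u := edgeSet_deleteEdges _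
  have hXc : X.edgeFinset.card = c := by
    rw [← Set.ncard_coe_finset, coe_edgeFinset, hX, Set.ncard_diff L.CE_sub (Set.toFinite _), L.CE_card, hc]; omega
  have hadj : ∀ a b, X.Adj a b ↔ G.Adj a b ∧ s(a,b) ∉ CE u := fun a b => by simp [X]
  rw [← hXc, ← dart_card_eq_twice_card_edges, ← card_univ]
  symm
  choose pos hpos hup using L.surj
  apply Finset.card_bij (fun (d : X.Dart) _ => (pos d.fst, pos d.snd))
  · intro d _
    simp only [mem_filter, mem_product, mem_range]
    refine ⟨⟨hpos _, hpos _⟩, ?_⟩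
    unfold ch; rw [hup, hup]; exact (hadj _ _).1 d.adj
  · intro d _ d' _ h
    have h1 := congrArg u (congrArg Prod.fst h)
    have h2 := congrArg u (congrArg Prod.snd h)
    simp only [hup] at h1 h2
    exact Dart.ext _ _ (Prod.ext h1 h2)
  · intro d hd
    simp only [mem_filter, mem_product, mem_range] at hd
    refine ⟨⟨(u d.1, u d.2), (hadj _ _).2 hd.2⟩, mem_univ _, ?_⟩
    exact Prod.ext (L.inj _ (hpos _) _ hd.1.1 (hup _)) (L.inj _ (hpos _) _ hd.1.2 (hup _))

theorem Lab.slots [Fintype V] (L : Lab G v u) {c : ℕ} (hc : G.edgeSet.ncard = v + c) :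
    ∃ p q m, Slots (2*c) v (ch G u) p q m := by
  classical
  rw [← L.darts hc]
  apply BP.slots
  · intro x y; exact ch_symm
  · intro d; simp only [mem_filter, mem_product, mem_range]; tauto
end

section
variable {n v : ℕ} {R : ℕ → ℕ → Prop} {p q m : ℕ → ℕ}
theorem Slots.inj (S : Slots n v R p q m) {i j : ℕ} (hi : i < n) (hj : j < n) (h1 : p i = p j) (h2 : q i = q j) : i = j := by
  rcases lt_trichotomy i j with h | h | h
  · have := S.ord _ _ h hj; omega
  · exact h
  · have := S.ord _ _ h hi; omega
theorem Slots.m_inv (S : Slots n v R p q m) {j : ℕ} (hj : j < n) : m (m j) = j := by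
  have h := S.m_lt j hj
  apply S.inj (S.m_lt _ h) hj
  · rw [S.mp _ h, S.mq _ hj]
  · rw [S.mq _ h, S.mp _ hj]
theorem Slots.m_ne (S : Slots n v R p q m) (hR : ∀ x, ¬ R x x) {j : ℕ} (hj : j < n) : m j ≠ j := by
  intro h
  have h1 := S.mp j hj
  rw [h] at h1
  have := S.rel j hj
  rw [← h1] at this
  exact hR _ this
theorem Slots.mono (S : Slots n v R p q m) {i j : ℕ} (hij : i ≤ j) (hj : j < n) : p i ≤ p j := by
  rcases hij.lt_or_eq with h | h
  · have := S.ord _ _ h hj; omega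
  · rw [h]
theorem Slots.tie (S : Slots n v R p q m) {j : ℕ} (hj : j + 1 < n) (h : p j = p (j+1)) : m (j+1) < m j := by
  have h1 := S.ord j (j+1) (by omega) hj
  have h2 : q (j+1) < q j := by omega
  rw [← S.mp _ hj, ← S.mp j (by omega)] at h2
  by_contra hc
  have := S.mono (not_lt.1 hc) (S.m_lt _ hj)
  omega
end
end BP

namespace BP
open SimpleGraph Finset

theorem eq_of_bits {n f g : ℕ} (hf : f < 2^n) (hg : g < 2^n) (h : ∀ i < n, bit f i = bit g i) : f = g := by
  apply Nat.eq_of_testBit_eq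
  intro i
  by_cases hi : i < n
  · have := h i hi
    rw [bit_eq, bit_eq] at this
    revert this
    cases f.testBit i <;> cases g.testBit i <;> simp
  · have h2 : 2^n ≤ 2^i := Nat.pow_le_pow_right (by norm_num) (by omega)
    rw [Nat.testBit_lt_two_pow (by omega), Nat.testBit_lt_two_pow (by omega)]
theorem exists_bits (n : ℕ) (b : ℕ → ℕ) (hb : ∀ i, b i ≤ 1) : ∃ f < 2^n, ∀ i < n, bit f i = b i := by
  have h2 : ∀ i < n, b i < 2^1 := fun i _ => by have := hb i; omega
  refine ⟨pk 1 b n, by simpa using pk_lt h2, fun i hi => ?_⟩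
  rw [bit_eq, pk_testBit (by norm_num) h2]
  have := hb i
  rcases Nat.le_one_iff_eq_zero_or_eq_one.1 this with h | h <;> simp [h, Nat.mod_one, hi]
theorem popc_sum (f c : ℕ) : popc f c = ∑ i ∈ range c, bit f (i+1) := by
  induction c with
  | zero => rfl
  | succ c ih => rw [sum_range_succ, ← ih]; rfl
theorem bit_zero (i : ℕ) : bit 0 i = 0 := by rw [bit_eq]; simp

section
variable {c : ℕ} {m : ℕ → ℕ}
theorem lab_m' (hinv : ∀ j < 2*c, m (m j) = j) {j : ℕ} (hj : j < 2*c) : lab m (m j) = lab m j := by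
  unfold lab; rw [hinv j hj, min_comm]
theorem lab_image (hlt : ∀ j < 2*c, m j < 2*c) (hinv : ∀ j < 2*c, m (m j) = j) (hne : ∀ j < 2*c, m j ≠ j) :
    Set.InjOn (lab m) ((range (2*c)).filter fun i => i < m i) ∧ ((range (2*c)).filter fun i => i < m i).image (lab m) = range c := by
  have hinj : Set.InjOn (lab m) ((range (2*c)).filter fun i => i < m i) := by
    intro i hi j hj h
    simp only [coe_filter, mem_range, Set.mem_ofPred_eq] at hi hj
    rcases lt_trichotomy i j with h' | h' | h'
    · have := lab_strict hi.2 hj.2 h'; omega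
    · exact h'
    · have := lab_strict hj.2 hi.2 h'; omega
  refine ⟨hinj, ?_⟩
  apply eq_of_subset_of_card_le
  · intro i hi
    obtain ⟨j, hj, rfl⟩ := mem_image.1 hi
    simp only [mem_filter, mem_range] at hj
    exact mem_range.2 (lab_lt0 hlt hinv hne hj.1)
  · rw [card_range, card_image_of_injOn hinj, openers_card hlt hinv hne]
theorem lab_rep (hlt : ∀ j < 2*c, m j < 2*c) (hinv : ∀ j < 2*c, m (m j) = j) (hne : ∀ j < 2*c, m j ≠ j)
    {i : ℕ} (hi : i < c) : ∃ j < 2*c, j < m j ∧ lab m j = i := by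
  have := (lab_image hlt hinv hne).2
  rw [← mem_range, ← this] at hi
  obtain ⟨j, hj, rfl⟩ := mem_image.1 hi
  simp only [mem_filter, mem_range] at hj
  exact ⟨j, hj.1, hj.2, rfl⟩
theorem lab_eq (hlt : ∀ j < 2*c, m j < 2*c) (hinv : ∀ j < 2*c, m (m j) = j) (hne : ∀ j < 2*c, m j ≠ j)
    {i j : ℕ} (hi : i < 2*c) (hj : j < 2*c) (h : lab m i = lab m j) : i = j ∨ i = m j := by
  have hinj := (lab_image hlt hinv hne).1
  have key : ∀ i < 2*c, ∃ k, k < 2*c ∧ k < m k ∧ lab m k = lab m i ∧ (i = k ∨ i = m k) := by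
    intro i hi
    rcases lt_or_gt_of_ne (hne i hi) with h | h
    · exact ⟨m i, hlt i hi, by rw [hinv i hi]; exact h, lab_m' hinv hi, Or.inr (hinv i hi).symm⟩
    · exact ⟨i, hi, h, rfl, Or.inl rfl⟩
  obtain ⟨k, k1, k2, k3, k4⟩ := key i hi
  obtain ⟨l, l1, l2, l3, l4⟩ := key j hj
  have : k = l := hinj (by simp [k1, k2]) (by simp [l1, l2]) (by rw [k3, l3, h])
  subst this
  have := hinv k k1
  rcases k4 with rfl | rfl <;> rcases l4 with rfl | rfl
  · exact Or.inl rfl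
  · exact Or.inr this.symm
  · exact Or.inr rfl
  · exact Or.inl rfl
theorem sum_open (hlt : ∀ j < 2*c, m j < 2*c) (hinv : ∀ j < 2*c, m (m j) = j) (hne : ∀ j < 2*c, m j ≠ j) (g : ℕ → ℕ) :
    ∑ j ∈ (range (2*c)).filter fun i => i < m i, g (lab m j) = ∑ i ∈ range c, g i := by
  have h := lab_image hlt hinv hne
  rw [← h.2, sum_image h.1]
theorem sum_lab (hlt : ∀ j < 2*c, m j < 2*c) (hinv : ∀ j < 2*c, m (m j) = j) (hne : ∀ j < 2*c, m j ≠ j) (g : ℕ → ℕ) :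
    ∑ j ∈ range (2*c), g (lab m j) = 2 * ∑ i ∈ range c, g i := by
  rw [← sum_filter_add_sum_filter_not (range (2*c)) (fun i => i < m i), two_mul (∑ i ∈ range c, g i)]
  congr 1
  · exact sum_open hlt hinv hne g
  · rw [← sum_open hlt hinv hne g]
    refine sum_bij' (fun i _ => m i) (fun i _ => m i) ?_ ?_ ?_ ?_ ?_
    · intro i hi; simp only [mem_filter, mem_range] at hi ⊢
      have := hne i hi.1
      rw [hinv i hi.1]; exact ⟨hlt i hi.1, by omega⟩
    · intro i hi; simp only [mem_filter, mem_range] at hi ⊢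
      rw [hinv i hi.1]; exact ⟨hlt i hi.1, by omega⟩
    · intro i hi; simp only [mem_filter, mem_range] at hi; exact hinv i hi.1
    · intro i hi; simp only [mem_filter, mem_range] at hi; exact hinv i hi.1
    · intro i hi; simp only [mem_filter, mem_range] at hi; rw [lab_m' hinv hi.1]
end

def PP (n v : ℕ) (p : ℕ → ℕ) (t : ℕ) : ℕ := if t < n then p t else v
def ww (n v : ℕ) (p : ℕ → ℕ) (j : ℕ) : ℕ := PP n v p (j+1) - PP n v p j
def AA (n : ℕ) (p m : ℕ → ℕ) (f x : ℕ) : ℕ := (bit f 0 + ∑ j ∈ (range n).filter fun j => p j ≤ x, bit f (lab m j + 1)) % 2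

section
variable {n v : ℕ} {R : ℕ → ℕ → Prop} {p q m : ℕ → ℕ}
theorem Slots.PP_mono (S : Slots n v R p q m) (t : ℕ) : PP n v p t ≤ PP n v p (t+1) := by
  unfold PP
  split_ifs with h1 h2
  · exact S.mono (by omega) h2
  · exact (S.pl _ h1).le
  · omega
  · exact le_rfl
theorem AA_le (f x : ℕ) : AA n p m f x ≤ 1 := by unfold AA; omega
theorem Slots.AA_inn (S : Slots n v R p q m) {j x : ℕ} (hj : j < n) (h1 : PP n v p j ≤ x) (h2 : x < PP n v p (j+1)) (f : ℕ) :
    AA n p m f x = inn m f j := by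
  unfold AA inn
  congr 3
  ext i
  simp only [mem_filter, mem_range]
  unfold PP at h1 h2
  rw [if_pos hj] at h1
  constructor
  · rintro ⟨hi, hx⟩
    by_contra hc
    rw [if_pos (by omega)] at h2
    have := S.mono (i := j+1) (j := i) (by omega) hi
    omega
  · intro hi
    exact ⟨by omega, (S.mono (i := i) (j := j) (by omega) hj).trans h1⟩
theorem Slots.find (S : Slots n v R p q m) (hn : 0 < n) (h0 : p 0 = 0) {x : ℕ} (hx : x < v) :
    ∃ j < n, PP n v p j ≤ x ∧ x < PP n v p (j+1) := by
  have key : ∀ t ≤ n, x < PP n v p t → ∃ j < t, PP n v p j ≤ x ∧ x < PP n v p (j+1) := by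
    intro t
    induction t with
    | zero => intro _ h; unfold PP at h; rw [if_pos hn] at h; omega
    | succ t ih =>
      intro ht h
      by_cases h' : x < PP n v p t
      · obtain ⟨j, hj, h⟩ := ih (by omega) h'
        exact ⟨j, by omega, h⟩
      · exact ⟨t, by omega, not_lt.1 h', h⟩
  exact key n le_rfl (by unfold PP; simpa using hx)
theorem Slots.sumA (S : Slots n v R p q m) (hn : 0 < n) (h0 : p 0 = 0) (f : ℕ) :
    ∑ x ∈ range v, AA n p m f x = ∑ j ∈ range n, inn m f j * ww n v p j := by
  have key : ∀ t ≤ n, ∑ x ∈ range (PP n v p t), AA n p m f x = ∑ j ∈ range t, inn m f j * ww n v p j := by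
    intro t
    induction t with
    | zero => intro _; unfold PP; rw [if_pos hn, h0]; simp
    | succ t ih =>
      intro ht
      rw [sum_range_succ, ← ih (by omega), range_eq_Ico, range_eq_Ico, ← sum_Ico_consecutive _ (Nat.zero_le _) (S.PP_mono t)]
      congr 1
      rw [sum_congr rfl (g := fun _ => inn m f t)]
      · rw [sum_const, Nat.card_Ico, smul_eq_mul, mul_comm]; rfl
      · intro x hx
        rw [mem_Ico] at hx
        exact S.AA_inn (by omega) hx.1 hx.2 f
  have := key n le_rfl
  rwa [show PP n v p n = v by simp [PP]] at this
theorem Slots.sumw (S : Slots n v R p q m) (hn : 0 < n) (h0 : p 0 = 0) : ∑ j ∈ range n, ww n v p j = v := by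
  have key : ∀ t ≤ n, ∑ j ∈ range t, ww n v p j = PP n v p t := by
    intro t
    induction t with
    | zero => intro _; unfold PP; rw [if_pos hn, h0]; simp
    | succ t ih =>
      intro ht
      rw [sum_range_succ, ih (by omega)]
      have := S.PP_mono t
      unfold ww; omega
  have := key n le_rfl
  rwa [show PP n v p n = v by simp [PP]] at this
theorem AA_succ (f x : ℕ) : (AA n p m f (x+1) + AA n p m f x + ∑ j ∈ (range n).filter fun j => p j = x+1, bit f (lab m j + 1)) % 2 = 0 := by
  unfold AA
  have : ∑ j ∈ (range n).filter fun j => p j ≤ x+1, bit f (lab m j + 1) = ∑ j ∈ (range n).filter fun j => p j ≤ x, bit f (lab m j + 1) +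
      ∑ j ∈ (range n).filter fun j => p j = x+1, bit f (lab m j + 1) := by
    rw [← sum_union]
    · congr 1; ext i; simp only [mem_filter, mem_range, mem_union]; omega
    · rw [Finset.disjoint_left]; intro i; simp only [mem_filter, mem_range]; omega
  rw [this]; omega
theorem AA_zero (f : ℕ) : AA n p m f 0 = (bit f 0 + ∑ j ∈ (range n).filter fun j => p j = 0, bit f (lab m j + 1)) % 2 := by
  unfold AA
  simp only [Nat.le_zero]
end
theorem Slots.AA_last {c v : ℕ} {R : ℕ → ℕ → Prop} {p q m : ℕ → ℕ} (S : Slots (2*c) v R p q m) (hR : ∀ x, ¬ R x x) (f : ℕ) :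
    AA (2*c) p m f (v-1) = bit f 0 := by
  unfold AA
  rw [filter_true_of_mem, sum_lab (g := fun i => bit f (i+1)) S.m_lt (fun j => S.m_inv) (fun j => S.m_ne hR)]
  · have := bit_le f 0; omega
  · intro j hj; have := S.pl j (mem_range.1 hj); omega
end BP

namespace BP
open SimpleGraph Finset
section
variable {V : Type*} {G : SimpleGraph V} {v c : ℕ} {u : ℕ → V} {p q m : ℕ → ℕ}

theorem ch_irr (x : ℕ) : ¬ ch G u x x := fun h => G.irrefl h.1

def Fset (c v : ℕ) (u : ℕ → V) (p q m : ℕ → ℕ) (f : ℕ) : Set (Sym2 V) :=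
  {e | (∃ x < v, e = s(u x, u (x+1)) ∧ AA (2*c) p m f x = 1) ∨ ∃ j < 2*c, e = s(u (p j), u (q j)) ∧ bit f (lab m j + 1) = 1}

theorem D_eq (L : Lab G v u) (S : Slots (2*c) v (ch G u) p q m) {i j : ℕ} (hi : i < 2*c) (hj : j < 2*c)
    (h : s(u (p i), u (q i)) = s(u (p j), u (q j))) : i = j ∨ i = m j := by
  rw [Sym2.eq_iff] at h
  rcases h with ⟨h1, h2⟩ | ⟨h1, h2⟩
  · left
    exact S.inj hi hj (L.inj _ (S.pl i hi) _ (S.pl j hj) h1) (L.inj _ (S.ql i hi) _ (S.ql j hj) h2)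
  · right
    have hm := S.m_lt j hj
    apply S.inj hi hm
    · rw [S.mp j hj]; exact L.inj _ (S.pl i hi) _ (S.ql j hj) h1
    · rw [S.mq j hj]; exact L.inj _ (S.ql i hi) _ (S.pl j hj) h2
theorem D_m (S : Slots (2*c) v (ch G u) p q m) {j : ℕ} (hj : j < 2*c) : s(u (p (m j)), u (q (m j))) = s(u (p j), u (q j)) := by
  rw [S.mp j hj, S.mq j hj, Sym2.eq_swap]
theorem D_lab (L : Lab G v u) (S : Slots (2*c) v (ch G u) p q m) {i j : ℕ} (hi : i < 2*c) (hj : j < 2*c) :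
    s(u (p i), u (q i)) = s(u (p j), u (q j)) ↔ lab m i = lab m j := by
  constructor
  · intro h
    rcases D_eq L S hi hj h with rfl | rfl
    · rfl
    · exact lab_m' (fun j => S.m_inv) hj
  · intro h
    rcases lab_eq S.m_lt (fun j => S.m_inv) (fun j => S.m_ne ch_irr) hi hj h with rfl | rfl
    · rfl
    · exact D_m S hj
theorem mem_E (L : Lab G v u) (S : Slots (2*c) v (ch G u) p q m) {x : ℕ} (hx : x < v) (f : ℕ) :
    s(u x, u (x+1)) ∈ Fset c v u p q m f ↔ AA (2*c) p m f x = 1 := by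
  constructor
  · rintro (⟨y, hy, h, h'⟩ | ⟨j, hj, h, h'⟩)
    · rw [L.E_inj hx hy h]; exact h'
    · exact absurd ⟨x, h⟩ (S.rel j hj).2
  · intro h; exact Or.inl ⟨x, hx, rfl, h⟩
theorem mem_D (L : Lab G v u) (S : Slots (2*c) v (ch G u) p q m) {j : ℕ} (hj : j < 2*c) (f : ℕ) :
    s(u (p j), u (q j)) ∈ Fset c v u p q m f ↔ bit f (lab m j + 1) = 1 := by
  constructor
  · rintro (⟨y, hy, h, h'⟩ | ⟨i, hi, h, h'⟩)
    · exact absurd ⟨y, h.symm⟩ (S.rel j hj).2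
    · rw [(D_lab L S hj hi).1 h]; exact h'
  · intro h; exact Or.inr ⟨j, hj, rfl, h⟩
theorem edge_cases (L : Lab G v u) (S : Slots (2*c) v (ch G u) p q m) {e : Sym2 V} (he : e ∈ G.edgeSet) :
    (∃ x < v, e = s(u x, u (x+1))) ∨ ∃ j < 2*c, e = s(u (p j), u (q j)) := by
  by_cases h : e ∈ CE u
  · exact Or.inl (L.mem_CE.1 h)
  · right
    induction e using Sym2.ind with
    | _ a b =>
      obtain ⟨x, hx, rfl⟩ := L.surj a
      obtain ⟨y, hy, rfl⟩ := L.surj b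
      obtain ⟨j, hj, rfl, rfl⟩ := S.comp x hx y hy ⟨he, h⟩
      exact ⟨j, hj, rfl⟩
theorem D_mem (S : Slots (2*c) v (ch G u) p q m) {j : ℕ} (hj : j < 2*c) : s(u (p j), u (q j)) ∈ G.edgeSet := (S.rel j hj).1
theorem F_sub (L : Lab G v u) (S : Slots (2*c) v (ch G u) p q m) (f : ℕ) : Fset c v u p q m f ⊆ G.edgeSet := by
  rintro e (⟨x, hx, rfl, _⟩ | ⟨j, hj, rfl, _⟩)
  · exact L.adj x
  · exact D_mem S hj
theorem ext_F (L : Lab G v u) (S : Slots (2*c) v (ch G u) p q m) {F F' : Set (Sym2 V)} (h : F ⊆ G.edgeSet)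
    (h1 : ∀ x < v, s(u x, u (x+1)) ∈ F → s(u x, u (x+1)) ∈ F') (h2 : ∀ j < 2*c, s(u (p j), u (q j)) ∈ F → s(u (p j), u (q j)) ∈ F') : F ⊆ F' := by
  intro e he
  rcases edge_cases L S (h he) with ⟨x, hx, rfl⟩ | ⟨j, hj, rfl⟩
  · exact h1 x hx he
  · exact h2 j hj he

open Classical in
theorem deg_eq (L : Lab G v u) (S : Slots (2*c) v (ch G u) p q m) {F : Set (Sym2 V)} (hF : F ⊆ G.edgeSet) {x : ℕ} (hx : x < v) :
    {b | s(u x, b) ∈ F}.ncard = (if s(u x, u (x+1)) ∈ F then 1 else 0) + (if s(u (pr v x), u (pr v x + 1)) ∈ F then 1 else 0)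
      + ∑ j ∈ (range (2*c)).filter fun j => p j = x, if s(u (p j), u (q j)) ∈ F then 1 else 0 := by
  have h4 := L.v4
  have hnl := L.nx_lt (x := x)
  have hpl := L.pr_lt hx
  have hnp : nx v x ≠ pr v x := by unfold nx pr; split_ifs <;> omega
  have e1 : s(u x, u (x+1)) = s(u x, u (nx v x)) := by rw [L.nx hx]
  have e2 : s(u (pr v x), u (pr v x + 1)) = s(u x, u (pr v x)) := by rw [L.pr hx, Sym2.eq_swap]
  have hn : s(u x, u (nx v x)) ∈ CE u := by rw [← e1]; exact ⟨x, rfl⟩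
  have hp : s(u x, u (pr v x)) ∈ CE u := by rw [← e2]; exact ⟨_, rfl⟩
  have T1 : {b | s(u x, b) ∈ F} = u '' ((range v).filter fun y => s(u x, u y) ∈ F : Finset ℕ) := by
    ext b; simp only [Set.mem_ofPred_eq, Set.mem_image, coe_filter, mem_range]
    constructor
    · intro h; obtain ⟨y, hy, rfl⟩ := L.surj b; exact ⟨y, ⟨hy, h⟩, rfl⟩
    · rintro ⟨y, ⟨_, h⟩, rfl⟩; exact h
  have hinj : Set.InjOn u ((range v).filter fun y => s(u x, u y) ∈ F : Finset ℕ) := by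
    intro y hy z hz h
    simp only [coe_filter, mem_range, Set.mem_ofPred_eq] at hy hz
    exact L.inj _ hy.1 _ hz.1 h
  rw [T1, hinj.ncard_image, Set.ncard_coe_finset]
  have T2 : ((range v).filter fun y => s(u x, u y) ∈ F) = ((({nx v x} : Finset ℕ).filter fun y => s(u x, u y) ∈ F) ∪ (({pr v x} : Finset ℕ).filter fun y => s(u x, u y) ∈ F))
      ∪ ((range (2*c)).filter fun j => p j = x ∧ s(u (p j), u (q j)) ∈ F).image q := by
    ext y
    simp only [mem_union, mem_filter, mem_range, mem_singleton, mem_image]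
    constructor
    · rintro ⟨hy, h⟩
      by_cases hC : s(u x, u y) ∈ CE u
      · left
        obtain ⟨z, hz, h'⟩ := L.mem_CE.1 hC
        rw [Sym2.eq_iff] at h'
        rcases h' with ⟨a, b⟩ | ⟨a, b⟩
        · left
          have := L.inj _ hx _ hz a; subst this
          rw [L.nx hx] at b
          exact ⟨L.inj _ hy _ hnl b, h⟩
        · right
          have := L.inj _ hy _ hz b; subst this
          rw [L.nx hy] at a
          have := L.inj _ hx _ L.nx_lt a
          refine ⟨?_, h⟩
          rw [this, Lab.pr_nx hy]
      · right
        obtain ⟨j, hj, rfl, rfl⟩ := S.comp x hx y hy ⟨hF h, hC⟩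
        exact ⟨j, ⟨hj, rfl, h⟩, rfl⟩
    · rintro ((⟨rfl, h⟩ | ⟨rfl, h⟩) | ⟨j, ⟨hj, rfl, h⟩, rfl⟩)
      · exact ⟨hnl, h⟩
      · exact ⟨hpl, h⟩
      · exact ⟨S.ql j hj, h⟩
  rw [T2, card_union_of_disjoint, card_union_of_disjoint, filter_singleton, filter_singleton, e1, e2, card_image_of_injOn]
  · rw [← filter_filter, card_filter (fun j => s(u (p j), u (q j)) ∈ F)]
    congr 2 <;> split_ifs <;> rfl
  · intro i hi j hj h
    simp only [coe_filter, mem_range, Set.mem_ofPred_eq] at hi hj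
    exact S.inj hi.1 hj.1 (hi.2.1.trans hj.2.1.symm) h
  · rw [Finset.disjoint_left]; intro y
    simp only [mem_filter, mem_singleton]; rintro ⟨rfl, _⟩ ⟨h, _⟩; exact hnp h
  · rw [Finset.disjoint_left]; intro y
    simp only [mem_union, mem_filter, mem_singleton, mem_image, mem_range]
    rintro h ⟨j, ⟨hj, rfl, h'⟩, rfl⟩
    have := (S.rel j hj).2
    rcases h with ⟨h, _⟩ | ⟨h, _⟩
    · rw [h] at this; exact this hn
    · rw [h] at this; exact this hp

theorem ind_eq {b : ℕ} {Q : Prop} [Decidable Q] (hb : b ≤ 1) (h : Q ↔ b = 1) : (if Q then 1 else 0) = b := by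
  split_ifs with hq
  · exact (h.1 hq).symm
  · have : b ≠ 1 := fun h' => hq (h.2 h')
    omega

theorem F_even (L : Lab G v u) (S : Slots (2*c) v (ch G u) p q m) (f : ℕ) : EvenSet (Fset c v u p q m f) := by
  classical
  intro a
  obtain ⟨x, hx, rfl⟩ := L.surj a
  have h4 := L.v4
  rw [deg_eq L S (F_sub L S f) hx, ind_eq (AA_le f x) (mem_E L S hx f), ind_eq (AA_le f _) (mem_E L S (L.pr_lt hx) f),
    sum_congr rfl (g := fun j => bit f (lab m j + 1)) (fun j hj => ind_eq (bit_le _ _) (mem_D L S (mem_range.1 (mem_filter.1 hj).1) f)), Nat.even_iff]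
  rcases x with _ | x
  · rw [show pr v 0 = v - 1 by simp [pr], S.AA_last ch_irr, AA_zero]
    omega
  · rw [show pr v (x+1) = x by simp [pr]]
    exact AA_succ f x

theorem F_exists (L : Lab G v u) (S : Slots (2*c) v (ch G u) p q m) {F : Set (Sym2 V)} (hF : F ⊆ G.edgeSet) (he : EvenSet F) :
    ∃ f < 2^(c+1), F = Fset c v u p q m f := by
  classical
  have h4 := L.v4
  have hrep : ∀ i, ∃ j, i < c → j < 2*c ∧ lab m j = i := by
    intro i
    by_cases hi : i < c
    · obtain ⟨j, h1, _, h2⟩ := lab_rep S.m_lt (fun j => S.m_inv) (fun j => S.m_ne ch_irr) hi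
      exact ⟨j, fun _ => ⟨h1, h2⟩⟩
    · exact ⟨0, fun h => absurd h hi⟩
  choose ρ hρ using hrep
  obtain ⟨f, hf, hbit⟩ := exists_bits (c+1) (fun i => if i = 0 then (if s(u (v-1), u (v-1+1)) ∈ F then 1 else 0)
    else (if s(u (p (ρ (i-1))), u (q (ρ (i-1)))) ∈ F then 1 else 0)) (fun i => by split_ifs <;> omega)
  have hb0 : (if s(u (v-1), u (v-1+1)) ∈ F then 1 else 0) = bit f 0 := by rw [hbit 0 (by omega)]; simp
  have hD : ∀ j < 2*c, (if s(u (p j), u (q j)) ∈ F then 1 else 0) = bit f (lab m j + 1) := by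
    intro j hj
    have hl := lab_lt0 S.m_lt (fun j => S.m_inv) (fun j => S.m_ne ch_irr) hj
    rw [hbit _ (by omega)]
    have := hρ _ hl
    have := (D_lab L S this.1 hj).2 this.2
    simp only [Nat.add_sub_cancel, this]
    simp
  have hev : ∀ x < v, ((if s(u x, u (x+1)) ∈ F then 1 else 0) + (if s(u (pr v x), u (pr v x + 1)) ∈ F then 1 else 0)
      + ∑ j ∈ (range (2*c)).filter fun j => p j = x, bit f (lab m j + 1)) % 2 = 0 := by
    intro x hx
    have := he (u x)
    rw [deg_eq L S hF hx, sum_congr rfl (g := fun j => bit f (lab m j + 1)) (fun j hj => hD j (mem_range.1 (mem_filter.1 hj).1)), Nat.even_iff] at this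
    exact this
  have hE : ∀ x < v, (if s(u x, u (x+1)) ∈ F then 1 else 0) = AA (2*c) p m f x := by
    intro x
    induction x with
    | zero =>
      intro hx
      have h := hev 0 hx
      rw [show pr v 0 = v - 1 by simp [pr], hb0] at h
      rw [AA_zero]
      split_ifs at h ⊢ <;> omega
    | succ x ih =>
      intro hx
      have h := hev _ hx
      rw [show pr v (x+1) = x by simp [pr], ih (by omega)] at h
      have := AA_succ (n := 2*c) (p := p) (m := m) f x
      have := AA_le (n := 2*c) (p := p) (m := m) f (x+1)
      split_ifs at h ⊢ <;> omega
  refine ⟨f, hf, ?_⟩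
  have i1 : ∀ x < v, s(u x, u (x+1)) ∈ F ↔ s(u x, u (x+1)) ∈ Fset c v u p q m f := by
    intro x hx; rw [mem_E L S hx, ← hE x hx]; split_ifs with hq <;> simp [hq]
  have i2 : ∀ j < 2*c, s(u (p j), u (q j)) ∈ F ↔ s(u (p j), u (q j)) ∈ Fset c v u p q m f := by
    intro j hj; rw [mem_D L S hj, ← hD j hj]; split_ifs with hq <;> simp [hq]
  apply Set.Subset.antisymm
  · exact ext_F L S hF (fun x hx => (i1 x hx).1) (fun j hj => (i2 j hj).1)
  · exact ext_F L S (F_sub L S f) (fun x hx => (i1 x hx).2) (fun j hj => (i2 j hj).2)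

theorem F_sub_iff (L : Lab G v u) (S : Slots (2*c) v (ch G u) p q m) (hc : 0 < 2*c) (h0 : p 0 = 0) (g f : ℕ) :
    Fset c v u p q m g ⊆ Fset c v u p q m f ↔ subc c m (ww (2*c) v p) g f := by
  constructor
  · intro h
    constructor
    · intro i hi
      obtain ⟨j, hj, _, rfl⟩ := lab_rep S.m_lt (fun j => S.m_inv) (fun j => S.m_ne ch_irr) hi
      by_contra hcon
      have a := bit_le g (lab m j + 1)
      have := (mem_D L S hj f).1 (h ((mem_D L S hj g).2 (by omega)))
      omega
    · intro j hj hw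
      have hPP : PP (2*c) v p j < PP (2*c) v p (j+1) := by unfold ww at hw; omega
      have hv : PP (2*c) v p j < v := by unfold PP; rw [if_pos hj]; exact S.pl j hj
      have e := S.AA_inn hj le_rfl hPP
      by_contra hcon
      have a := inn_le m g j
      have := (mem_E L S hv f).1 (h ((mem_E L S hv g).2 (by rw [e]; omega)))
      rw [e] at this
      omega
  · rintro ⟨h1, h2⟩
    apply ext_F L S (F_sub L S g)
    · intro x hx
      obtain ⟨j, hj, ha, hb⟩ := S.find hc h0 hx
      rw [mem_E L S hx, mem_E L S hx, S.AA_inn hj ha hb, S.AA_inn hj ha hb]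
      have := h2 j hj (by unfold ww; omega)
      have := inn_le m f j
      omega
    · intro j hj
      rw [mem_D L S hj, mem_D L S hj]
      have := h1 _ (lab_lt0 S.m_lt (fun j => S.m_inv) (fun j => S.m_ne ch_irr) hj)
      have := bit_le f (lab m j + 1)
      omega

theorem F_inj (L : Lab G v u) (S : Slots (2*c) v (ch G u) p q m) {g f : ℕ} (hg : g < 2^(c+1)) (hf : f < 2^(c+1))
    (h : Fset c v u p q m g = Fset c v u p q m f) : g = f := by
  have h4 := L.v4
  apply eq_of_bits hg hf
  intro i hi
  rcases i with _ | i
  · rw [← S.AA_last ch_irr g, ← S.AA_last ch_irr f]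
    have := mem_E L S (x := v-1) (by omega) g
    rw [h, mem_E L S (by omega)] at this
    have a := AA_le (n := 2*c) (p := p) (m := m) f (v-1)
    have b := AA_le (n := 2*c) (p := p) (m := m) g (v-1)
    omega
  · obtain ⟨j, hj, _, rfl⟩ := lab_rep S.m_lt (fun j => S.m_inv) (fun j => S.m_ne ch_irr) (by omega : i < c)
    have := mem_D L S hj g
    rw [h, mem_D L S hj] at this
    have a := bit_le f (lab m j + 1)
    have b := bit_le g (lab m j + 1)
    omega
theorem F_zero : Fset c v u p q m 0 = ∅ := by
  ext e; simp [Fset, AA, bit_zero]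
theorem F_ne (L : Lab G v u) (S : Slots (2*c) v (ch G u) p q m) {f : ℕ} (hf : f < 2^(c+1)) : (Fset c v u p q m f).Nonempty ↔ f ≠ 0 := by
  rw [Set.nonempty_iff_ne_empty, not_iff_not, ← F_zero (c := c) (v := v) (u := u) (p := p) (q := q) (m := m)]
  exact ⟨fun h => F_inj L S hf (Nat.pow_pos (by norm_num)) h, fun h => by rw [h]⟩

theorem circ_iff (L : Lab G v u) (S : Slots (2*c) v (ch G u) p q m) (hc : 0 < 2*c) (h0 : p 0 = 0) {f : ℕ} (hf : f < 2^(c+1)) :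
    circ c m (ww (2*c) v p) f ↔ MinEven G (Fset c v u p q m f) := by
  constructor
  · rintro ⟨h1, h2⟩
    refine ⟨F_sub L S f, F_even L S f, (F_ne L S hf).2 h1, fun F' hF' he hne => ?_⟩
    obtain ⟨g, hg, rfl⟩ := F_exists L S (hF'.trans (F_sub L S f)) he
    rw [h2 g hg ((F_ne L S hg).1 hne) ((F_sub_iff L S hc h0 g f).1 hF')]
  · rintro ⟨_, _, h1, h2⟩
    refine ⟨(F_ne L S hf).1 h1, fun g hg hg0 hs => ?_⟩
    exact F_inj L S hg hf (h2 _ ((F_sub_iff L S hc h0 g f).2 hs) (F_even L S g) ((F_ne L S hg).2 hg0))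

theorem F_card (L : Lab G v u) (S : Slots (2*c) v (ch G u) p q m) (hc : 0 < 2*c) (h0 : p 0 = 0) (f : ℕ) :
    (Fset c v u p q m f).ncard = wt c m (ww (2*c) v p) f := by
  classical
  let O := (range (2*c)).filter fun i => i < m i
  let EX := ((range v).filter fun x => AA (2*c) p m f x = 1).image fun x => s(u x, u (x+1))
  let DX := (O.filter fun j => bit f (lab m j + 1) = 1).image fun j => s(u (p j), u (q j))
  have hF : Fset c v u p q m f = ((EX ∪ DX : Finset (Sym2 V)) : Set (Sym2 V)) := by
    ext e
    simp only [Fset, EX, DX, O, Set.mem_ofPred_eq, coe_union, coe_image, coe_filter, mem_filter, mem_range, Set.mem_union, Set.mem_image]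
    constructor
    · rintro (⟨x, hx, rfl, h⟩ | ⟨j, hj, rfl, h⟩)
      · exact Or.inl ⟨x, ⟨hx, h⟩, rfl⟩
      · right
        have hne := S.m_ne ch_irr hj
        rcases lt_or_gt_of_ne hne with h' | h'
        · refine ⟨m j, ⟨⟨S.m_lt j hj, ?_⟩, ?_⟩, D_m S hj⟩
          · rw [S.m_inv hj]; exact h'
          · rw [lab_m' (fun j => S.m_inv) hj]; exact h
        · exact ⟨j, ⟨⟨hj, h'⟩, h⟩, rfl⟩
    · rintro (⟨x, ⟨hx, h⟩, rfl⟩ | ⟨j, ⟨⟨hj, _⟩, h⟩, rfl⟩)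
      · exact Or.inl ⟨x, hx, rfl, h⟩
      · exact Or.inr ⟨j, hj, rfl, h⟩
  have hE : EX.card = ∑ x ∈ range v, AA (2*c) p m f x := by
    rw [card_image_of_injOn, card_filter]
    · exact sum_congr rfl fun x _ => ind_eq (AA_le f x) Iff.rfl
    · intro x hx y hy h
      simp only [coe_filter, mem_range, Set.mem_ofPred_eq] at hx hy
      exact L.E_inj hx.1 hy.1 h
  have hD : DX.card = popc f c := by
    rw [popc_sum, ← sum_open (g := fun i => bit f (i+1)) S.m_lt (fun j => S.m_inv) (fun j => S.m_ne ch_irr), card_image_of_injOn, card_filter]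
    · exact sum_congr rfl fun x _ => ind_eq (bit_le _ _) Iff.rfl
    · intro i hi j hj h
      simp only [O, coe_filter, mem_filter, mem_range, Set.mem_ofPred_eq] at hi hj
      rcases D_eq L S hi.1.1 hj.1.1 h with h' | h'
      · exact h'
      · have a := hi.1.2; rw [h', S.m_inv hj.1.1] at a; have := hj.1.2; omega
  have hdis : Disjoint EX DX := by
    rw [Finset.disjoint_left]
    intro e he he'
    simp only [EX, DX, O, mem_image, mem_filter, mem_range] at he he'
    obtain ⟨x, _, rfl⟩ := he
    obtain ⟨j, hj, h⟩ := he'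
    exact (S.rel j hj.1.1).2 ⟨x, h.symm⟩
  rw [hF, Set.ncard_coe_finset, card_union_of_disjoint hdis, hE, hD, S.sumA hc h0, wt, add_comm]

open Classical in
theorem cnt_eq (L : Lab G v u) (S : Slots (2*c) v (ch G u) p q m) (hc : 0 < 2*c) (h0 : p 0 = 0) (k : ℕ) :
    {F | MinEven G F ∧ F.ncard = k}.ncard =
    ((range (2^(c+1))).filter fun f => circ c m (ww (2*c) v p) f ∧ wt c m (ww (2*c) v p) f = k).card := by
  have : {F | MinEven G F ∧ F.ncard = k} = Fset c v u p q m '' ((range (2^(c+1))).filter fun f => circ c m (ww (2*c) v p) f ∧ wt c m (ww (2*c) v p) f = k : Finset ℕ) := by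
    ext F
    simp only [Set.mem_ofPred_eq, Set.mem_image, coe_filter, mem_range]
    constructor
    · rintro ⟨h, hk⟩
      obtain ⟨f, hf, rfl⟩ := F_exists L S h.1 h.2.1
      exact ⟨f, ⟨hf, (circ_iff L S hc h0 hf).2 h, by rw [← F_card L S hc h0, hk]⟩, rfl⟩
    · rintro ⟨f, ⟨hf, h1, h2⟩, rfl⟩
      exact ⟨(circ_iff L S hc h0 hf).1 h1, by rw [F_card L S hc h0, h2]⟩
  rw [this, Set.InjOn.ncard_image, Set.ncard_coe_finset]
  intro g hg f hf h
  simp only [coe_filter, mem_range, Set.mem_ofPred_eq] at hg hf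
  exact F_inj L S hg.1 hf.1 h
end
end BP

namespace BP
open SimpleGraph Finset
section
variable {V : Type*} {G : SimpleGraph V} {v c : ℕ} {u : ℕ → V} {p q m : ℕ → ℕ}

theorem Lab.parity (L : Lab G v u) (hG : G.Colorable 2) {x y : ℕ} (h : G.Adj (u x) (u y)) : x % 2 + y % 2 = 1 := by
  obtain ⟨C⟩ := hG
  have key : ∀ x, (C (u x)).val = ((C (u 0)).val + x) % 2 := by
    intro x
    induction x with
    | zero => have := (C (u 0)).2; omega
    | succ x ih =>
      have h1 : C (u x) ≠ C (u (x+1)) := C.valid (L.adj x)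
      have h2 : (C (u x)).val ≠ (C (u (x+1))).val := fun h => h1 (Fin.ext h)
      have := (C (u x)).2
      have := (C (u (x+1))).2
      omega
  have h1 : C (u x) ≠ C (u y) := C.valid h
  have h2 : (C (u x)).val ≠ (C (u y)).val := fun h => h1 (Fin.ext h)
  have := key x
  have := key y
  omega

theorem finish [Fintype V] (r ℓ : ℕ) (hr : 3 ≤ r) (hG : G.Colorable 2) (hev : Even v) (hV : v = Fintype.card V) (L : Lab G v u) (h0 : isP G u 0)
    (hl : ∀ x < v, isP G u x → x + ℓ ≤ v)
    (hm : ∀ a b, a < b → b < v → isP G u b → (∀ x, a < x → x < b → ¬ isP G u x) → b - a ≤ ℓ)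
    (hc5 : c ≤ 5) (S : Slots (2*c) v (ch G u) p q m)
    (hcnt : ∀ k, 4 ≤ k → k ≤ v → Even k → {F | MinEven G F ∧ F.ncard = k}.ncard = r) : False := by
  classical
  have h4 := L.v4
  have hPj : ∀ x < v, isP G u x → ∃ j < 2*c, p j = x := by
    rintro x hx ⟨y, hy⟩
    obtain ⟨z, hz, hzy⟩ := L.surj (u y)
    have : ch G u x z := by unfold ch; rw [hzy]; exact hy
    obtain ⟨j, hj, a, _⟩ := S.comp x hx z hz this
    exact ⟨j, hj, a⟩
  obtain ⟨j0, hj0, hpj0⟩ := hPj 0 (by omega) h0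
  have hc : 0 < 2*c := by omega
  have hp0 : p 0 = 0 := by have := S.mono (Nat.zero_le j0) hj0; omega
  have hsum := S.sumw hc hp0
  have hcol : ∀ j < 2*c, p j % 2 + p (m j) % 2 = 1 := by
    intro j hj
    rw [S.mp j hj]
    exact L.parity hG (S.rel j hj).1
  have hwin : ∀ j, j + 1 < 2*c → ww (2*c) v p j = p (j+1) - p j ∧ p j ≤ p (j+1) := by
    intro j hj
    refine ⟨?_, S.mono (by omega) hj⟩
    unfold ww PP; rw [if_pos hj, if_pos (by omega)]
  have hwlast : ww (2*c) v p (2*c-1) = v - p (2*c-1) ∧ p (2*c-1) < v := by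
    refine ⟨?_, S.pl _ (by omega)⟩
    unfold ww PP; rw [if_neg (by omega), if_pos (by omega)]
  have hisP : ∀ j < 2*c, isP G u (p j) := fun j hj => ⟨_, S.rel j hj⟩
  have hlast : ∀ j < 2*c, j + 1 < 2*c ∨ j = 2*c-1 := by intro j hj; omega
  have hV' : ∑ j ∈ range (2*c), ww (2*c) v p j = Fintype.card V := hsum.trans hV
  refine no_model (c := c) (r := r) (m := m) (w := ww (2*c) v p) (col := fun j => p j % 2) ?_
  refine
  { c1 := by omega
    c5 := hc5
    m_lt := S.m_lt
    m_inv := fun j => S.m_inv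
    m_ne := fun j => S.m_ne ch_irr
    col0 := by simp [hp0]
    col_m := hcol
    par := fun j hj => ?_
    tie := fun j hj hw => S.tie hj (by have := hwin j hj; omega)
    wmax := fun j hj => ?_
    wpos := by omega
    no1 := fun j hj hmj hw => ?_
    r3 := hr
    v4 := by omega
    vev := by rw [hsum]; exact hev
    ceven := fun f hf h => ?_
    cge := fun f hf h => ?_
    cle := fun f hf h => ?_
    cnt := fun k h1 h2 h3 => ?_ }
  · show _ = (p j % 2 + p ((j+1) % (2*c)) % 2) % 2
    rcases hlast j hj with h | rfl
    · rw [Nat.mod_eq_of_lt h]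
      have := hwin j h
      omega
    · rw [show 2*c-1+1 = 2*c by omega, Nat.mod_self, hp0]
      obtain ⟨z, hz⟩ := hev
      omega
  · rcases hlast j hj with h | rfl
    · have hw := hwin j h
      have h1 := hl _ hwlast.2 (hisP _ (by omega))
      by_cases he : p j = p (j+1)
      · omega
      · have := hm (p j) (p (j+1)) (by omega) (S.pl _ h) (hisP _ h) (fun x hx hx' hP => by
          obtain ⟨i, hi, rfl⟩ := hPj x (by have := S.pl _ h; omega) hP
          by_cases hij : i ≤ j
          · have := S.mono hij (by omega); omega
          · have := S.mono (i := j+1) (j := i) (by omega) hi; omega)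
        omega
    · exact le_rfl
  · have hq := S.mp j hj
    apply (S.rel j hj).2
    rw [← hq, hmj]
    rcases hlast j hj with h | rfl
    · rw [Nat.mod_eq_of_lt h]
      have := hwin j h
      exact ⟨p j, by simp only []; rw [show p (j+1) = p j + 1 by omega]⟩
    · rw [show 2*c-1+1 = 2*c by omega, Nat.mod_self, hp0]
      refine ⟨p (2*c-1), ?_⟩
      simp only []
      rw [show p (2*c-1) + 1 = 0 + v by omega, L.per]
  · rw [← F_card L S hc hp0]
    exact (min_bounds hG ((circ_iff L S hc hp0 hf).1 h)).1
  · rw [← F_card L S hc hp0]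
    exact (min_bounds hG ((circ_iff L S hc hp0 hf).1 h)).2.1
  · rw [← F_card L S hc hp0, hV']
    exact (min_bounds hG ((circ_iff L S hc hp0 hf).1 h)).2.2
  · have := cnt_eq L S hc hp0 k
    rw [hcnt k h1 (by omega) h3] at this
    rw [this]
end

end BP

theorem no_r_bipancyclic_with_few_edges {V : Type*} [Fintype V] (G : SimpleGraph V)
    (r : ℕ) (hr : 3 ≤ r) (he : G.edgeSet.ncard ≤ Fintype.card V + 5) :
    ¬ IsRBipancyclic G r := by
  rintro ⟨hG, hev, h4, hcyc⟩
  have hcnt : ∀ k, 4 ≤ k → k ≤ Fintype.card V → Even k → {F | BP.MinEven G F ∧ F.ncard = k}.ncard = r := by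
    intro k h1 h2 h3
    rw [← BP.count_eq (by omega)]
    exact hcyc k h1 h2 h3
  have hr0 := hcyc _ h4 le_rfl hev
  obtain ⟨H, ⟨φ⟩⟩ : {H : G.Subgraph | Nonempty (H.coe ≃g cycleGraph (Fintype.card V))}.Nonempty := by
    apply Set.nonempty_of_ncard_ne_zero
    unfold cycleCount at hr0
    omega
  obtain ⟨u, L⟩ := BP.Lab.start h4 φ
  have hle : Fintype.card V ≤ G.edgeSet.ncard := by
    have := Set.ncard_le_ncard L.CE_sub (Set.toFinite _)
    rwa [L.CE_card] at this
  by_cases hx : ∃ x, BP.isP G u x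
  · obtain ⟨x, hx⟩ := hx
    obtain ⟨u', ℓ, L', h1, h2, h3⟩ := (L.rot x).best (by rw [L.isP_rot, zero_add]; exact hx)
    obtain ⟨c, hc⟩ : ∃ c, G.edgeSet.ncard = Fintype.card V + c := ⟨_, (Nat.add_sub_cancel' hle).symm⟩
    obtain ⟨p, q, m, S⟩ := L'.slots hc
    exact BP.finish r ℓ hr hG hev rfl L' h1 h2 h3 (by omega) S hcnt
  · have hE : G.edgeSet ⊆ BP.CE u := by
      intro e he
      induction e using Sym2.ind with
      | _ a b =>
        obtain ⟨x, _, rfl⟩ := L.surj a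
        obtain ⟨y, _, rfl⟩ := L.surj b
        by_contra hn
        exact hx ⟨x, y, he, hn⟩
    have hsub : {F | BP.MinEven G F ∧ F.ncard = Fintype.card V} ⊆ {BP.CE u} := by
      rintro F ⟨hF, hk⟩
      rw [Set.mem_singleton_iff]
      exact Set.eq_of_subset_of_ncard_le (hF.1.trans hE) (by rw [L.CE_card, hk]) (Set.toFinite _)
    have := Set.ncard_le_ncard hsub (Set.toFinite _)
    rw [hcnt _ h4 le_rfl hev, Set.ncard_singleton] at this
    omega
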